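/- arXiv:2006.11866 — 4 statements merged into one kernel-verified Lean document; each statement's English description precedes it below -/
import Mathlib

section
/- Davenport–Hasse relation: let χ be a multiplicative character of order m on F_q^× (so m divides q-1) and A any multiplicative character on F_q. Then Π_{i=0}^{m-1} g(χ^i A) = g(A^m)·Ā^m(m)·Π_{i=1}^{m-1} g(χ^i). -/
open Finset

variable {F : Type*} [Field F] [Fintype F] [DecidableEq F]

noncomputable instance : Fintype (MulChar F ℂ) := Fintype.ofFinite _

/-- Greene's binomial coefficient `(A choose B) = B(-1)/q * J(A, B⁻¹)`. -/
noncomputable def greeneBinom (A B : MulChar F ℂ) : ℂ :=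
  B (-1) / (Fintype.card F : ℂ) * ∑ x : F, A x * B⁻¹ (1 - x)

/-- Greene's finite field hypergeometric series ₂F₁. -/
noncomputable def greeneF21 (A B C : MulChar F ℂ) (x : F) : ℂ :=
  ((Fintype.card F : ℂ) / ((Fintype.card F : ℂ) - 1)) *
    ∑ χ : MulChar F ℂ, greeneBinom (A * χ) χ * greeneBinom (B * χ) (C * χ) * χ x

/-- Greene's finite field hypergeometric series ₃F₂. -/
noncomputable def greeneF32 (A B C D E : MulChar F ℂ) (x : F) : ℂ :=
  ((Fintype.card F : ℂ) / ((Fintype.card F : ℂ) - 1)) *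
    ∑ χ : MulChar F ℂ, greeneBinom (A * χ) χ * greeneBinom (B * χ) (D * χ) *
      greeneBinom (C * χ) (E * χ) * χ x

/-- Greene's finite field hypergeometric series ₄F₃. -/
noncomputable def greeneF43 (A₀ A₁ A₂ A₃ B₁ B₂ B₃ : MulChar F ℂ) (x : F) : ℂ :=
  ((Fintype.card F : ℂ) / ((Fintype.card F : ℂ) - 1)) *
    ∑ χ : MulChar F ℂ, greeneBinom (A₀ * χ) χ * greeneBinom (A₁ * χ) (B₁ * χ) *
      greeneBinom (A₂ * χ) (B₂ * χ) * greeneBinom (A₃ * χ) (B₃ * χ) * χ x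

open Finset
open Polynomial in
noncomputable def DHlog {K : Type*} [Field K] (f : K[X]) : PowerSeries K :=
  PowerSeries.X * PowerSeries.derivative K (f.reverse : PowerSeries K) * (f.reverse : PowerSeries K)⁻¹

open Polynomial in
noncomputable def DHlsum {K : Type*} [Field K] (r : ℕ) (f : K[X]) : K :=
  - PowerSeries.coeff r (DHlog f)

open Polynomial in
theorem DHrev_const {K : Type*} [Field K] {f : K[X]} (hf : f.Monic) :
    PowerSeries.constantCoeff (f.reverse : PowerSeries K) = 1 := by
  simp [hf.leadingCoeff]

open Polynomial in
theorem DHrev_inv {K : Type*} [Field K] {f : K[X]} (hf : f.Monic) :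
    (f.reverse : PowerSeries K) * (f.reverse : PowerSeries K)⁻¹ = 1 := by
  apply PowerSeries.mul_inv_cancel
  rw [DHrev_const hf]; simp

open Polynomial in
theorem DHlog_spec {K : Type*} [Field K] {f : K[X]} (hf : f.Monic) :
    DHlog f * (f.reverse : PowerSeries K) = PowerSeries.X * PowerSeries.derivative K (f.reverse : PowerSeries K) := by
  rw [DHlog, mul_assoc, mul_comm _ (f.reverse : PowerSeries K), DHrev_inv hf, mul_one]

open Polynomial in
theorem DHlog_unique {K : Type*} [Field K] {f : K[X]} (hf : f.Monic) {L : PowerSeries K}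
    (h : L * (f.reverse : PowerSeries K) = PowerSeries.X * PowerSeries.derivative K (f.reverse : PowerSeries K)) :
    L = DHlog f := by
  rw [DHlog, ← h, mul_assoc, DHrev_inv hf, mul_one]

open Polynomial in
theorem DHlsum_mul {K : Type*} [Field K] {f g : K[X]} (hf : f.Monic) (hg : g.Monic) (r : ℕ) :
    DHlsum r (f * g) = DHlsum r f + DHlsum r g := by
  have : DHlog f + DHlog g = DHlog (f * g) := by
    apply DHlog_unique (hf.mul hg)
    have h1 := DHlog_spec hf
    have h2 := DHlog_spec hg
    rw [reverse_mul_of_domain, Polynomial.coe_mul, Derivation.leibniz]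
    simp only [smul_eq_mul]
    linear_combination (g.reverse : PowerSeries K) * h1 + (f.reverse : PowerSeries K) * h2
  simp only [DHlsum, ← this, map_add]; ring

open Polynomial in
theorem DHlsum_one {K : Type*} [Field K] (r : ℕ) : DHlsum r (1 : K[X]) = 0 := by
  have := DHlsum_mul (K := K) monic_one monic_one r
  simpa using this

open Polynomial in
theorem DHlsum_pow {K : Type*} [Field K] {f : K[X]} (hf : f.Monic) (r n : ℕ) :
    DHlsum r (f ^ n) = n * DHlsum r f := by
  induction n with
  | zero => simp [DHlsum_one]
  | succ n ih => rw [pow_succ, DHlsum_mul (hf.pow n) hf, ih]; push_cast; ring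

open Polynomial in
theorem DHlsum_X_sub_C {K : Type*} [Field K] (a : K) {r : ℕ} (hr : 1 ≤ r) :
    DHlsum r (X - C a) = a ^ r := by
  have hrev : (X - C a : K[X]).reverse = 1 - C a * X := by
    ext i
    rw [coeff_reverse]
    rcases i with _ | _ | i
    · simp [Polynomial.revAt]
    · simp [Polynomial.revAt, coeff_one]
    · simp [Polynomial.revAt, coeff_X, coeff_C, coeff_one]
  have : -(PowerSeries.mk (fun n => if n = 0 then 0 else a ^ n)) = DHlog (X - C a) := by
    apply DHlog_unique (monic_X_sub_C a)
    rw [hrev]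
    ext n
    have e : ((1 - C a * X : K[X]) : PowerSeries K) = 1 - PowerSeries.C a * PowerSeries.X := by
      simp
    rw [e, mul_sub, mul_one, map_sub, ← mul_assoc]
    rcases n with _ | _ | n
    · simp
    · simp [PowerSeries.coeff_succ_mul_X, PowerSeries.coeff_succ_X_mul, PowerSeries.coeff_derivative]
    · simp [PowerSeries.coeff_succ_mul_X, PowerSeries.coeff_succ_X_mul, PowerSeries.coeff_derivative, PowerSeries.coeff_mul_C, PowerSeries.coeff_X, PowerSeries.coeff_one]
      ring
  rw [DHlsum, ← this]
  simp [show r ≠ 0 by omega]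

open Polynomial in
theorem DHlsum_prod {K : Type*} [Field K] (s : Multiset K) {r : ℕ} (hr : 1 ≤ r) :
    DHlsum r ((s.map (fun a => X - C a)).prod) = (s.map (fun a => a ^ r)).sum := by
  induction s using Multiset.induction_on with
  | empty => simp [DHlsum_one]
  | cons a s ih =>
    simp only [Multiset.map_cons, Multiset.prod_cons, Multiset.sum_cons]
    rw [DHlsum_mul (monic_X_sub_C a) (monic_multiset_prod_of_monic _ _ fun b _ => monic_X_sub_C b), ih,
      DHlsum_X_sub_C _ hr]

open Polynomial in
theorem DHlsum_map {K E : Type*} [Field K] [Field E] (φ : K →+* E) {f : K[X]} (hf : f.Monic) (r : ℕ) :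
    DHlsum r (f.map φ) = φ (DHlsum r f) := by
  have : PowerSeries.map φ (DHlog f) = DHlog (f.map φ) := by
    apply DHlog_unique (hf.map φ)
    have h := congrArg (PowerSeries.map φ) (DHlog_spec hf)
    have hr : (f.map φ).reverse = f.reverse.map φ := by
      ext i
      simp [coeff_reverse]
    rw [hr, Polynomial.polynomial_map_coe]
    rw [map_mul] at h
    rw [h]
    ext n
    rcases n with _ | n
    · simp
    · simp [PowerSeries.coeff_succ_X_mul, PowerSeries.coeff_derivative]
  rw [DHlsum, ← this, DHlsum]; simp

open Polynomial in
theorem DHmonic_add {K : Type*} [Field K] {f : K[X]} (hf : f.Monic) {r : ℕ} (hr : 1 ≤ r)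
    (hrn : r ≤ f.natDegree) (c : K) :
    (f + C c * X ^ (f.natDegree - r)).Monic ∧ (f + C c * X ^ (f.natDegree - r)).natDegree = f.natDegree := by
  have hd : (C c * X ^ (f.natDegree - r)).degree < f.degree := by
    refine lt_of_le_of_lt (degree_C_mul_X_pow_le _ _) ?_
    rw [degree_eq_natDegree hf.ne_zero]
    exact_mod_cast (by omega)
  refine ⟨hf.add_of_left hd, ?_⟩
  exact natDegree_eq_of_degree_eq (degree_add_eq_left_of_degree_lt hd)

open Polynomial in
theorem DHlsum_add {K : Type*} [Field K] {f : K[X]} (hf : f.Monic) {r : ℕ} (hr : 1 ≤ r)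
    (hrn : r ≤ f.natDegree) (c : K) :
    DHlsum r (f + C c * X ^ (f.natDegree - r)) = DHlsum r f - r * c := by
  obtain ⟨hm, hd⟩ := DHmonic_add hf hr hrn c
  set g := f + C c * X ^ (f.natDegree - r) with hg
  have hrev : g.reverse = f.reverse + C c * X ^ r := by
    ext i
    rw [coeff_reverse, hd, coeff_add f.reverse, coeff_reverse, hg, coeff_add]
    congr 1
    rw [coeff_C_mul_X_pow, coeff_C_mul_X_pow]
    congr 1
    have : (revAt f.natDegree) i = if i ≤ f.natDegree then f.natDegree - i else i := rfl
    rw [this]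
    apply propext
    split_ifs <;> omega
  have h1 := DHlog_spec hf
  have h2 := DHlog_spec hm
  have hc := DHrev_const hm
  set R : PowerSeries K := (g.reverse : PowerSeries K) with hR
  have hrev' : R = (f.reverse : PowerSeries K) + PowerSeries.C c * PowerSeries.X ^ r := by
    rw [hR, hrev]; simp
  have hder : PowerSeries.X * PowerSeries.derivative K R
     = PowerSeries.X * PowerSeries.derivative K (f.reverse : PowerSeries K) + PowerSeries.C (r * c) * PowerSeries.X ^ r := by
    rw [hrev', map_add, mul_add]
    congr 1
    obtain ⟨r', rfl⟩ : ∃ r', r = r' + 1 := ⟨r - 1, by omega⟩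
    simp [Derivation.leibniz, PowerSeries.derivative_pow, map_mul]
    ring
  rw [hder, ← h1] at h2
  have hL0 : PowerSeries.constantCoeff (DHlog f) = 0 := by simp [DHlog]
  obtain ⟨M, hM⟩ := PowerSeries.X_dvd_iff.mpr hL0
  obtain ⟨Q, hQ⟩ : ∃ Q, R = 1 + PowerSeries.X * Q := by
    have : PowerSeries.constantCoeff (R - 1) = 0 := by simp [hc]
    obtain ⟨Q, hQ⟩ := PowerSeries.X_dvd_iff.mpr this
    exact ⟨Q, by rw [← hQ]; ring⟩
  have hRi : R * R⁻¹ = 1 := PowerSeries.mul_inv_cancel _ (by rw [hc]; simp)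
  have key : DHlog g - DHlog f = PowerSeries.C (r * c) * PowerSeries.X ^ r +
      PowerSeries.X ^ (r+1) * ((- PowerSeries.C (r*c) * Q - PowerSeries.C c * M) * R⁻¹) := by
    have : (DHlog g - DHlog f) * R = PowerSeries.C (r * c) * PowerSeries.X ^ r - PowerSeries.C c * PowerSeries.X ^ r * (PowerSeries.X * M) := by
      rw [← hM]
      have : (f.reverse : PowerSeries K) = R - PowerSeries.C c * PowerSeries.X ^ r := by rw [hrev']; ring
      rw [this] at h2
      linear_combination h2
    calc DHlog g - DHlog f = ((DHlog g - DHlog f) * R) * R⁻¹ := by rw [mul_assoc, hRi, mul_one]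
      _ = _ := by
        rw [this]
        have h3 : (1 + PowerSeries.X * Q) * R⁻¹ = 1 := by rw [← hQ, hRi]
        linear_combination (PowerSeries.C (r * c) * PowerSeries.X ^ r) * h3
  have := congrArg (PowerSeries.coeff r) key
  rw [map_sub, map_add, PowerSeries.coeff_X_pow_mul'] at this
  simp [PowerSeries.coeff_X_pow] at this
  have e : PowerSeries.coeff r (PowerSeries.C (r * c) * PowerSeries.X ^ r : PowerSeries K) = r * c := by
    rw [PowerSeries.coeff_C_mul]; simp
  simp only [map_mul, map_natCast] at e
  rw [e] at this
  simp only [DHlsum]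
  linear_combination -this

open Finset
open Polynomial IntermediateField in
noncomputable def DHcp (F : Type*) {E : Type*} [Field F] [Field E] [Algebra F E] (α : E) : F[X] :=
  minpoly F α ^ (Module.finrank F E / (minpoly F α).natDegree)

section
open Polynomial IntermediateField
variable {F E : Type*} [Field F] [Finite F] [Field E] [Finite E] [Algebra F E]

theorem DHcp_monic (α : E) : (DHcp F α).Monic :=
  (minpoly.monic (Algebra.IsIntegral.isIntegral α)).pow _

theorem DHcp_natDegree (α : E) : (DHcp F α).natDegree = Module.finrank F E := by
  rw [DHcp, (minpoly.monic (Algebra.IsIntegral.isIntegral α)).natDegree_pow]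
  exact Nat.div_mul_cancel (minpoly.degree_dvd (Algebra.IsIntegral.isIntegral α))

theorem DHcp_exp (α : E) : Module.finrank F E / (minpoly F α).natDegree = Module.finrank F⟮α⟯ E := by
  have h := Module.finrank_mul_finrank F F⟮α⟯ E
  have hi : IsIntegral F α := Algebra.IsIntegral.isIntegral α
  rw [IntermediateField.adjoin.finrank hi] at h
  rw [← h, Nat.mul_div_cancel_left _ (minpoly.natDegree_pos hi)]

theorem DHcp_coeff (α : E) : (-1) ^ (Module.finrank F E) * (DHcp F α).coeff 0 = Algebra.norm F α := by
  have hi : IsIntegral F α := Algebra.IsIntegral.isIntegral α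
  have hs := IsAlgClosed.splits ((minpoly F α).map (algebraMap F (AlgebraicClosure F)))
  have h := Algebra.norm_eq_prod_roots (AlgebraicClosure F) (x := α) hs
  apply (algebraMap F (AlgebraicClosure F)).injective
  rw [h]
  have h2 := hs.coeff_zero_eq_prod_roots_of_monic ((minpoly.monic hi).map _)
  rw [natDegree_map, coeff_map] at h2
  rw [DHcp, ← DHcp_exp, coeff_zero_eq_eval_zero, eval_pow, ← coeff_zero_eq_eval_zero,
    map_mul, map_pow, map_pow, h2, mul_pow, map_neg, map_one, ← mul_assoc, ← pow_mul,
    Nat.mul_div_cancel' (minpoly.degree_dvd hi), ← mul_pow]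
  simp [aroots]

theorem DHcp_lsum (α : E) {r : ℕ} (hr : 1 ≤ r) : DHlsum r (DHcp F α) = Algebra.trace F E (α ^ r) := by
  have hi : IsIntegral F α := Algebra.IsIntegral.isIntegral α
  have hs := IsAlgClosed.splits ((minpoly F α).map (algebraMap F (AlgebraicClosure F)))
  have h1 : algebraMap F (AlgebraicClosure F) (DHlsum r (minpoly F α)) =
      (((minpoly F α).aroots (AlgebraicClosure F)).map (fun a => a ^ r)).sum := by
    rw [← DHlsum_map _ (minpoly.monic hi), ← DHlsum_prod _ hr]
    congr 1
    exact hs.eq_prod_roots_of_monic ((minpoly.monic hi).map _)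
  have hgen : α ^ r = algebraMap F⟮α⟯ E ((AdjoinSimple.gen F α) ^ r) := by simp
  have h2 : Algebra.trace F E (α ^ r) = Module.finrank F⟮α⟯ E *
      Algebra.trace F F⟮α⟯ ((AdjoinSimple.gen F α) ^ r) := by
    rw [hgen, ← Algebra.trace_trace (S := F⟮α⟯), Algebra.trace_algebraMap, map_nsmul, nsmul_eq_mul]
  rw [h2, DHcp, DHlsum_pow (minpoly.monic hi), DHcp_exp]
  congr 1
  apply (algebraMap F (AlgebraicClosure F)).injective
  rw [h1, trace_eq_sum_embeddings (AlgebraicClosure F)]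
  have hsep : (minpoly F α).Separable := PerfectField.separable_of_irreducible (minpoly.irreducible hi)
  have hnd : ((minpoly F α).aroots (AlgebraicClosure F)).Nodup := nodup_roots hsep.map
  classical
  rw [← (Multiset.dedup_eq_self.mpr hnd)]
  change ∑ a ∈ ((minpoly F α).aroots (AlgebraicClosure F)).toFinset, a ^ r = _
  symm
  refine Finset.sum_bij' (fun σ _ => σ (AdjoinSimple.gen F α))
    (fun a ha => (algHomAdjoinIntegralEquiv F hi).symm ⟨a, Multiset.mem_toFinset.mp ha⟩) ?_ ?_ ?_ ?_ ?_
  · intro σ _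
    rw [Multiset.mem_toFinset, mem_aroots]
    refine ⟨minpoly.ne_zero hi, ?_⟩
    rw [← minpoly_gen F α, aeval_algHom_apply, minpoly.aeval, map_zero]
  · intro a ha
    exact Finset.mem_univ _
  · intro σ _
    exact (Equiv.symm_apply_eq _).mpr (Subtype.ext rfl)
  · intro a ha
    exact algHomAdjoinIntegralEquiv_symm_apply_gen F hi _
  · intro σ _
    simp

theorem DHcount [Fintype E] [DecidableEq F] {P : F[X]} (hP : P.Monic) (hirr : Irreducible P)
    (hd : P.natDegree ∣ Module.finrank F E) :
    #{α : E | minpoly F α = P} = P.natDegree := by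
  classical
  have hsep : P.Separable := PerfectField.separable_of_irreducible hirr
  have hdv := (hirr.natDegree_dvd_iff_dvd_X_pow_card_pow_sub_X).mp hd
  rw [← Module.natCard_eq_pow_finrank, Nat.card_eq_fintype_card] at hdv
  have hsp : (P.map (algebraMap F E)).Splits := by
    have := (FiniteField.isSplittingField_sub E F).splits
    refine this.of_dvd ?_ (Polynomial.map_dvd _ hdv)
    exact Polynomial.map_ne_zero (FiniteField.X_pow_card_sub_X_ne_zero _ Fintype.one_lt_card)
  rw [← card_rootSet_eq_natDegree hsep hsp, ← Set.toFinset_card]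
  congr 1
  ext α
  simp only [Finset.mem_filter, Finset.mem_univ, true_and, Set.mem_toFinset, mem_rootSet]
  constructor
  · rintro rfl
    exact ⟨hP.ne_zero, minpoly.aeval _ _⟩
  · rintro ⟨_, h⟩
    exact (minpoly.eq_of_irreducible_of_monic hirr h hP).symm
end

open Finset
section
open Polynomial
variable {F : Type*} [Field F] [Finite F] {E : ℕ → Type*} [∀ k, Field (E k)] [∀ k, Fintype (E k)]
  [∀ k, Algebra F (E k)]

open Classical in
theorem DHstar_step (hE : ∀ k, Module.finrank F (E k) = k + 1) {P a : F[X]} (hP : P.Monic)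
    (hirr : Irreducible P) (ha : a ≠ 0) :
    ∃ v : ℕ, P ^ (v + 1) ∣ P * a ∧ ∀ k, #{α : E k | DHcp F α ∣ P * a} = #{α : E k | DHcp F α ∣ a} +
      if k + 1 = P.natDegree * (v + 1) then P.natDegree else 0 := by
  have hfin : FiniteMultiplicity P a :=
    FiniteMultiplicity.of_prime_left hirr.prime ha
  set v := multiplicity P a with hv
  have hpow : ∀ j, P ^ j ∣ a ↔ j ≤ v := fun j => hfin.pow_dvd_iff_le_multiplicity
  have hpow' : ∀ j, P ^ (j + 1) ∣ P * a ↔ j ≤ v := fun j => by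
    rw [pow_succ', mul_dvd_mul_iff_left hP.ne_zero, hpow]
  refine ⟨v, (hpow' v).mpr le_rfl, fun k => ?_⟩
  have hpos : 0 < P.natDegree := hirr.natDegree_pos
  have hd : ∀ α : E k, DHcp F α ∣ a → DHcp F α ∣ P * a := fun α h => h.mul_left P
  have hmem : ∀ α : E k, (DHcp F α ∣ P * a ∧ ¬ DHcp F α ∣ a) ↔
      (k + 1 = P.natDegree * (v + 1) ∧ minpoly F α = P) := by
    intro α
    have hi : IsIntegral F α := Algebra.IsIntegral.isIntegral α
    by_cases hα : minpoly F α = P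
    · have hdvd := minpoly.degree_dvd hi
      rw [hE, hα] at hdvd
      obtain ⟨j, hj⟩ := hdvd
      have hcp : DHcp F α = P ^ j := by
        rw [DHcp, hα, hE, hj, Nat.mul_div_cancel_left _ hpos]
      rw [hcp, hpow, hj]
      simp only [hα, and_true, Nat.mul_right_inj hpos.ne']
      rcases j with _ | j
      · omega
      · rw [hpow']; omega
    · simp only [hα, and_false, iff_false, not_and, not_not]
      intro h
      have hcop : IsCoprime (DHcp F α) P := by
        apply IsCoprime.pow_left
        rw [(minpoly.irreducible hi).coprime_iff_not_dvd]
        intro hdvd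
        apply hα
        exact eq_of_monic_of_associated (minpoly.monic hi) hP
          ((minpoly.irreducible hi).associated_of_dvd hirr hdvd)
      exact hcop.dvd_of_dvd_mul_left h
  have hsplit : (univ.filter fun α : E k => DHcp F α ∣ P * a) =
      (univ.filter fun α : E k => DHcp F α ∣ a) ∪
      (univ.filter fun α : E k => k + 1 = P.natDegree * (v + 1) ∧ minpoly F α = P) := by
    ext α
    simp only [mem_filter, mem_univ, true_and, mem_union, ← hmem]
    have := hd α
    tauto
  rw [hsplit, card_union_of_disjoint]
  · congr 1
    split_ifs with h
    · simp only [h, true_and]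
      exact DHcount hP hirr (by rw [hE, h]; exact dvd_mul_right _ _)
    · simp [h]
  · rw [Finset.disjoint_left]
    intro α h1 h2
    simp only [mem_filter, mem_univ, true_and] at h1 h2
    exact ((hmem α).mpr h2).2 h1

open Classical in
theorem DHstar (hE : ∀ k, Module.finrank F (E k) = k + 1) (f : F[X]) (hf : f ≠ 0) (N : ℕ) (hN : f.natDegree ≤ N) :
    ∑ k ∈ range N, #{α : E k | DHcp F α ∣ f} = f.natDegree := by
  induction f using UniqueFactorizationMonoid.induction_on_prime with
  | h₁ => exact absurd rfl hf
  | h₂ u hu =>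
    rw [natDegree_eq_zero_of_isUnit hu]
    apply Finset.sum_eq_zero
    intro k _
    rw [Finset.card_eq_zero, Finset.filter_eq_empty_iff]
    intro α _ h
    have := natDegree_eq_zero_of_isUnit (isUnit_of_dvd_unit h hu)
    rw [DHcp_natDegree, hE] at this
    omega
  | h₃ a p ha hp ih =>
    have hp0 := hp.ne_zero
    set P := p * C (p.leadingCoeff⁻¹) with hPdef
    have hP : P.Monic := monic_mul_leadingCoeff_inv hp0
    have hu : IsUnit (C (p.leadingCoeff⁻¹)) := by
      rw [isUnit_C]; simpa using hp0
    have hass : Associated p P := associated_mul_unit_right p _ hu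
    have hirr : Irreducible P := hass.irreducible hp.irreducible
    have hdeg : p.natDegree = P.natDegree := by
      rw [hPdef, natDegree_mul_C]; simpa using hp0
    have hdvd : ∀ x, x ∣ p * a ↔ x ∣ P * a := fun x => (hass.mul_right a).dvd_iff_dvd_right
    simp only [hdvd]
    rw [natDegree_mul hp0 ha, hdeg] at hN ⊢
    obtain ⟨v, hv, hk⟩ := DHstar_step hE hP hirr ha
    simp only [hk]
    rw [sum_add_distrib, ih ha (by omega)]
    have hle := natDegree_le_of_dvd hv (mul_ne_zero hP.ne_zero ha)
    rw [natDegree_pow, natDegree_mul hP.ne_zero ha] at hle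
    have hpos : 0 < P.natDegree := hirr.natDegree_pos
    have h1 : P.natDegree * (v + 1) = (P.natDegree * (v+1) - 1) + 1 := by
      have : 0 < P.natDegree * (v+1) := by positivity
      omega
    rw [Finset.sum_eq_single (P.natDegree * (v+1) - 1)]
    · rw [if_pos h1.symm]; ring
    · intro b _ hb
      rw [if_neg]; omega
    · intro hnot
      rw [mem_range] at hnot
      rw [mul_comm] at hle
      omega

end

theorem DHM_finite (F : Type*) [Field F] [Finite F] (n : ℕ) : {f : Polynomial F | f.Monic ∧ f.natDegree = n}.Finite := by
  rw [← Set.finite_coe_iff]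
  refine Finite.of_injective (fun (f : {f : Polynomial F | f.Monic ∧ f.natDegree = n}) => fun i : Fin n => f.1.coeff i) ?_
  rintro ⟨f, hf, hfn⟩ ⟨g, hg, hgn⟩ h
  apply Subtype.ext
  ext i
  rcases lt_trichotomy i n with h1 | h1 | h1
  · exact congrFun h ⟨i, h1⟩
  · have e1 := hf.coeff_natDegree
    have e2 := hg.coeff_natDegree
    rw [hfn] at e1; rw [hgn] at e2
    simp only [h1, e1, e2]
  · simp only
    rw [Polynomial.coeff_eq_zero_of_natDegree_lt (by omega), Polynomial.coeff_eq_zero_of_natDegree_lt (by omega)]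

noncomputable def DHM (F : Type*) [Field F] [Finite F] (n : ℕ) : Finset (Polynomial F) := (DHM_finite F n).toFinset

theorem mem_DHM {F : Type*} [Field F] [Finite F] {n : ℕ} {f : Polynomial F} :
    f ∈ DHM F n ↔ f.Monic ∧ f.natDegree = n := by
  simp [DHM]

noncomputable def DHc {F : Type*} [Field F] [Finite F] (Λ : Polynomial F → ℂ) (n : ℕ) : ℂ :=
  ∑ f ∈ DHM F n, Λ f

section
open Polynomial
variable {F : Type*} [Field F] [Finite F] {E : ℕ → Type*} [∀ k, Field (E k)] [∀ k, Fintype (E k)]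
  [∀ k, Algebra F (E k)]

theorem DHrec (hE : ∀ k, Module.finrank F (E k) = k + 1) (Λ : F[X] → ℂ)
    (hΛ : ∀ f g : F[X], f.Monic → g.Monic → Λ (f * g) = Λ f * Λ g) (n : ℕ) :
    (n : ℂ) * DHc Λ n = ∑ k ∈ range n, (∑ α : E k, Λ (DHcp F α)) * DHc Λ (n - 1 - k) := by
  classical
  have inner : ∀ k ∈ range n, ∀ α : E k, Λ (DHcp F α) * DHc Λ (n - 1 - k) =
      ∑ f ∈ DHM F n, if DHcp F α ∣ f then Λ f else 0 := by
    intro k hk α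
    rw [mem_range] at hk
    have hmon := DHcp_monic (F := F) α
    have hdeg := DHcp_natDegree (F := F) α
    rw [hE] at hdeg
    rw [← Finset.sum_filter, DHc, Finset.mul_sum]
    apply Finset.sum_bij (fun g _ => DHcp F α * g)
    · intro g hg
      rw [mem_DHM] at hg
      rw [mem_filter, mem_DHM, hmon.natDegree_mul hg.1]
      exact ⟨⟨hmon.mul hg.1, by omega⟩, dvd_mul_right _ _⟩
    · intro g _ g' _ h
      exact mul_left_cancel₀ hmon.ne_zero h
    · intro f hf
      rw [mem_filter, mem_DHM] at hf
      obtain ⟨⟨hf1, hf2⟩, g, rfl⟩ := hf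
      have hg : g.Monic := hmon.of_mul_monic_left hf1
      rw [hmon.natDegree_mul hg] at hf2
      exact ⟨g, mem_DHM.mpr ⟨hg, by omega⟩, rfl⟩
    · intro g hg
      rw [hΛ _ _ hmon (mem_DHM.mp hg).1]
  have : ∀ k ∈ range n, (∑ α : E k, Λ (DHcp F α)) * DHc Λ (n - 1 - k) =
      ∑ f ∈ DHM F n, (#{α : E k | DHcp F α ∣ f} : ℂ) * Λ f := by
    intro k hk
    rw [Finset.sum_mul, Finset.sum_congr rfl (fun α _ => inner k hk α), Finset.sum_comm]
    apply Finset.sum_congr rfl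
    intro f _
    rw [← Finset.sum_filter, Finset.sum_const, nsmul_eq_mul]
  rw [Finset.sum_congr rfl this, Finset.sum_comm, DHc, Finset.mul_sum]
  apply Finset.sum_congr rfl
  intro f hf
  rw [mem_DHM] at hf
  rw [← Finset.sum_mul, ← Nat.cast_sum, DHstar hE f hf.1.ne_zero n hf.2.le, hf.2]

theorem DHode (hE : ∀ k, Module.finrank F (E k) = k + 1) (Λ : F[X] → ℂ)
    (hΛ : ∀ f g : F[X], f.Monic → g.Monic → Λ (f * g) = Λ f * Λ g) :
    PowerSeries.derivative ℂ (PowerSeries.mk (DHc Λ)) =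
      PowerSeries.mk (fun k => ∑ α : E k, Λ (DHcp F α)) * PowerSeries.mk (DHc Λ) := by
  ext n
  have := DHrec hE Λ hΛ (n + 1)
  rw [PowerSeries.coeff_derivative, PowerSeries.coeff_mul, Finset.Nat.sum_antidiagonal_eq_sum_range_succ_mk]
  simp only [PowerSeries.coeff_mk]
  push_cast at this
  rw [mul_comm, this]

theorem DHc_zero (Λ : F[X] → ℂ) (h1 : Λ 1 = 1) : DHc Λ 0 = 1 := by
  have : DHM F 0 = {1} := by
    ext f
    rw [mem_DHM, mem_singleton]
    constructor
    · rintro ⟨h, h'⟩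
      exact (Polynomial.Monic.natDegree_eq_zero h).mp h'
    · rintro rfl
      simp
  rw [DHc, this]; simp [h1]
end

theorem DHode_unique {S L M : PowerSeries ℂ} (hL : PowerSeries.derivative ℂ L = S * L)
    (hM : PowerSeries.derivative ℂ M = S * M) (h0 : PowerSeries.constantCoeff L = PowerSeries.constantCoeff M) :
    L = M := by
  ext n
  induction n using Nat.strong_induction_on with
  | _ n ih =>
    rcases n with _ | n
    · simpa using h0
    · have h1 := congrArg (PowerSeries.coeff n) hL
      have h2 := congrArg (PowerSeries.coeff n) hM
      rw [PowerSeries.coeff_derivative, PowerSeries.coeff_mul] at h1 h2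
      have : ((n : ℂ) + 1) ≠ 0 := by exact_mod_cast Nat.succ_ne_zero n
      apply mul_right_cancel₀ this
      rw [h1, h2]
      apply Finset.sum_congr rfl
      intro x hx
      rw [HasAntidiagonal.mem_antidiagonal] at hx
      rw [ih x.2 (by omega)]

theorem DHode_prod (m : ℕ) (S L : ℕ → PowerSeries ℂ) (h : ∀ i, PowerSeries.derivative ℂ (L i) = S i * L i) :
    PowerSeries.derivative ℂ (∏ i ∈ range m, L i) = (∑ i ∈ range m, S i) * ∏ i ∈ range m, L i := by
  induction m with
  | zero => simp
  | succ m ih =>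
    rw [prod_range_succ, sum_range_succ, Derivation.leibniz, ih, h]
    simp only [smul_eq_mul]
    ring

open Finset

theorem DHroots {F E : Type*} [Field F] [Finite F] [Field E] [Fintype E] [DecidableEq E] [Algebra F E]
    (χ : MulChar F ℂ) (m : ℕ) (hm : orderOf χ = m) (hm0 : 0 < m) (u : Eˣ) :
    (#{s : E | s ^ m = u} : ℂ) = ∑ i ∈ range m, (χ ^ i) (Algebra.norm F (u : E)) := by
  obtain ⟨γ, hγ⟩ := IsCyclic.exists_generator (α := Eˣ)
  let N : Eˣ →* Fˣ := Units.map (Algebra.norm F)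
  have hN : ∀ x : Eˣ, Algebra.norm F (x : E) = (N x : F) := fun x => rfl
  let X' : Eˣ →* ℂˣ := χ.toUnitHom.comp N
  have hX : ∀ (x : Eˣ) (i : ℕ), (χ ^ i) (Algebra.norm F (x : E)) = ((X' x : ℂˣ) : ℂ) ^ i := by
    intro x i
    rw [hN, MulChar.pow_apply_coe]
    simp [X', MulChar.coe_toUnitHom]
  have hprim : IsPrimitiveRoot (X' γ) m := by
    constructor
    · apply Units.ext
      rw [Units.val_pow_eq_pow_val, ← hX, ← hm, pow_orderOf_eq_one, hN]
      simp
    · intro l hl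
      rw [← hm]
      apply orderOf_dvd_of_pow_eq_one
      rw [MulChar.eq_one_iff]
      intro a
      obtain ⟨b, rfl⟩ := FiniteField.unitsMap_norm_surjective F E a
      obtain ⟨j, rfl⟩ := (Subgroup.mem_zpowers_iff).mp (hγ b)
      change (χ ^ l) (Algebra.norm F ((γ ^ j : Eˣ) : E)) = 1
      rw [hX, map_zpow, ← Units.val_pow_eq_pow_val, ← zpow_natCast, ← zpow_mul, mul_comm, zpow_mul,
        zpow_natCast, hl]
      simp
  have hord : m ∣ Fintype.card Eˣ := by
    apply hprim.dvd_of_pow_eq_one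
    rw [← map_pow, pow_card_eq_one, map_one]
  have hγo : orderOf γ = Fintype.card Eˣ := orderOf_eq_card_of_forall_mem_zpowers hγ |>.trans Nat.card_eq_fintype_card
  have hpow : X' u = 1 ↔ ∃ s : Eˣ, s ^ m = u := by
    constructor
    · intro h
      obtain ⟨j, hj⟩ := (Subgroup.mem_zpowers_iff).mp (hγ u)
      rw [← hj, map_zpow, hprim.zpow_eq_one_iff_dvd] at h
      obtain ⟨l, hl⟩ := h
      exact ⟨γ ^ l, by rw [← hj, hl, mul_comm, zpow_mul, zpow_natCast]⟩
    · rintro ⟨s, rfl⟩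
      obtain ⟨j, rfl⟩ := (Subgroup.mem_zpowers_iff).mp (hγ s)
      rw [map_pow, map_zpow, ← zpow_natCast, ← zpow_mul, mul_comm, zpow_mul, zpow_natCast, hprim.pow_eq_one, one_zpow]
  simp only [hX]
  by_cases h : X' u = 1
  · obtain ⟨s0, hs0⟩ := hpow.mp h
    have hw : IsPrimitiveRoot (γ ^ (Fintype.card Eˣ / m)) m := by
      have : IsPrimitiveRoot γ (Fintype.card Eˣ) := hγo ▸ IsPrimitiveRoot.orderOf γ
      exact this.pow (Fintype.card_pos) (Nat.div_mul_cancel hord).symm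
    have hw' := (IsPrimitiveRoot.coe_units_iff).mpr hw
    have hcard := hw'.card_nthRootsFinset
    rw [h]
    simp only [Units.val_one, one_pow, sum_const, card_range, nsmul_eq_mul, mul_one]
    norm_cast
    refine (Finset.card_bij' (fun s _ => s * (s0 : E)⁻¹) (fun t _ => t * s0) ?_ ?_ ?_ ?_).trans hcard
    · intro s hs
      rw [mem_filter] at hs
      rw [Polynomial.mem_nthRootsFinset hm0, mul_pow, hs.2, ← hs0, inv_pow]
      simp
    · intro t ht
      rw [Polynomial.mem_nthRootsFinset hm0] at ht
      simp [mul_pow, ht, ← hs0]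
    · intro s _; simp
    · intro s _; simp
  · have h1 : (#{s : E | s ^ m = u} : ℂ) = 0 := by
      norm_cast
      rw [Finset.card_eq_zero, Finset.filter_eq_empty_iff]
      intro s _ hs
      apply h
      rw [hpow]
      have : s ≠ 0 := by
        rintro rfl
        rw [zero_pow hm0.ne'] at hs
        exact u.ne_zero hs.symm
      exact ⟨Units.mk0 s this, Units.ext (by simpa using hs)⟩
    rw [h1]
    have h2 : ((X' u : ℂˣ) : ℂ) ≠ 1 := by
      intro h'; exact h (Units.ext h')
    rw [geom_sum_eq h2, ← hX, ← hm, pow_orderOf_eq_one, hN]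
    simp

noncomputable def DHΛ {F : Type*} [Field F] (ψ : AddChar F ℂ) (B : MulChar F ℂ) (r : ℕ) (f : Polynomial F) : ℂ :=
  B ((-1) ^ f.natDegree * f.coeff 0) * ψ (DHlsum r f)

section
open Polynomial
variable {F : Type*} [Field F] [Fintype F] (ψ : AddChar F ℂ) (B : MulChar F ℂ)

theorem DHΛ_mul (r : ℕ) (f g : F[X]) (hf : f.Monic) (hg : g.Monic) :
    DHΛ ψ B r (f * g) = DHΛ ψ B r f * DHΛ ψ B r g := by
  rw [DHΛ, DHΛ, DHΛ, DHlsum_mul hf hg, AddChar.map_add_eq_mul, mul_coeff_zero, hf.natDegree_mul hg, pow_add]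
  rw [show ((-1 : F) ^ f.natDegree * (-1) ^ g.natDegree * (f.coeff 0 * g.coeff 0)) =
    ((-1 : F) ^ f.natDegree * f.coeff 0) * ((-1) ^ g.natDegree * g.coeff 0) by ring, map_mul]
  ring

theorem DHΛ_one (r : ℕ) : DHΛ ψ B r 1 = 1 := by
  simp [DHΛ, DHlsum_one]

theorem DHΛ_cp {E : Type*} [Field E] [Finite E] [Algebra F E] {r : ℕ} (hr : 1 ≤ r) (α : E) :
    DHΛ ψ B r (DHcp F α) = B (Algebra.norm F α) * ψ (Algebra.trace F E (α ^ r)) := by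
  rw [DHΛ, DHcp_natDegree, DHcp_coeff, DHcp_lsum _ hr]

theorem DHsum_eq {E : Type*} [Field E] [Fintype E] [Algebra F E] (χ A : MulChar F ℂ) (m : ℕ)
    (hm : orderOf χ = m) (hm0 : 0 < m) :
    ∑ α : E, DHΛ ψ (A ^ m) m (DHcp F α) = ∑ i ∈ range m, ∑ α : E, DHΛ ψ (χ ^ i * A) 1 (DHcp F α) := by
  classical
  simp only [DHΛ_cp ψ _ hm0, DHΛ_cp ψ _ le_rfl]
  rw [Finset.sum_comm]
  have h1 : ∀ s : E, (A ^ m) (Algebra.norm F s) * ψ (Algebra.trace F E (s ^ m)) =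
      (fun u => A (Algebra.norm F u) * ψ (Algebra.trace F E u)) (s ^ m) := by
    intro s
    simp only [map_pow]
    rw [MulChar.pow_apply' _ hm0.ne']
  simp only [h1]
  rw [← Finset.sum_fiberwise_of_maps_to (t := univ) (g := fun s : E => s ^ m) (fun _ _ => mem_univ _)]
  apply Finset.sum_congr rfl
  intro u _
  rw [Finset.sum_congr rfl (g := fun _ => A (Algebra.norm F u) * ψ (Algebra.trace F E u))
    (fun s hs => by rw [(mem_filter.mp hs).2]), Finset.sum_const, nsmul_eq_mul]
  by_cases hu : u = 0
  · subst hu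
    have : Algebra.norm F (0 : E) = 0 := Algebra.norm_zero
    have hA0 : A 0 = 0 := MulChar.map_zero A
    simp [this, hA0]
  · have := DHroots (F := F) χ m hm hm0 (Units.mk0 u hu)
    rw [Units.val_mk0] at this
    rw [this, Finset.sum_mul]
    apply Finset.sum_congr rfl
    intro i _
    rw [MulChar.mul_apply, pow_one]; ring

theorem DHc_one : DHc (DHΛ ψ B 1) 1 = gaussSum B ψ := by
  rw [gaussSum, DHc]
  symm
  apply Finset.sum_bij (fun a _ => X - C a)
  · intro a _
    rw [mem_DHM]
    exact ⟨monic_X_sub_C a, natDegree_X_sub_C a⟩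
  · intro a _ b _ h
    simpa using h
  · intro f hf
    rw [mem_DHM] at hf
    refine ⟨- f.coeff 0, mem_univ _, ?_⟩
    have := hf.1.eq_X_add_C hf.2
    conv_rhs => rw [this]
    simp
  · intro a _
    rw [DHΛ, DHlsum_X_sub_C _ le_rfl]
    simp

theorem DHc_ge_two (hψ : ψ ≠ 1) (n : ℕ) (hn : 2 ≤ n) : DHc (DHΛ ψ B 1) n = 0 := by
  obtain ⟨c, hc⟩ := AddChar.ne_one_iff.mp hψ
  have h : DHc (DHΛ ψ B 1) n = ψ c * DHc (DHΛ ψ B 1) n := by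
    rw [DHc, Finset.mul_sum]
    symm
    refine Finset.sum_bij' (fun f _ => f + C (-c) * X ^ (n - 1)) (fun f _ => f + C c * X ^ (n - 1)) ?_ ?_ ?_ ?_ ?_
    · intro f hf
      rw [mem_DHM] at hf ⊢
      have := DHmonic_add hf.1 (r := 1) le_rfl (by omega) (-c)
      rw [hf.2] at this
      exact this
    · intro f hf
      rw [mem_DHM] at hf ⊢
      have := DHmonic_add hf.1 (r := 1) le_rfl (by omega) c
      rw [hf.2] at this
      exact this
    · intro f _
      simp
    · intro f _
      simp
    · intro f hf
      rw [mem_DHM] at hf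
      have h1 := DHmonic_add hf.1 (r := 1) le_rfl (by omega) (-c)
      have h2 := DHlsum_add hf.1 (r := 1) le_rfl (by omega) (-c)
      rw [hf.2] at h1 h2
      rw [DHΛ, DHΛ, h1.2, h2, hf.2, coeff_add, coeff_C_mul_X_pow, if_neg (by omega), add_zero]
      rw [show DHlsum 1 f - ((1 : ℕ) : F) * -c = c + DHlsum 1 f by push_cast; ring, AddChar.map_add_eq_mul]
      ring
  have : (1 - ψ c) * DHc (DHΛ ψ B 1) n = 0 := by linear_combination h
  rcases mul_eq_zero.mp this with h | h
  · exact absurd (by linear_combination -h) hc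
  · exact h

theorem DHL_eq (hψ : ψ ≠ 1) : PowerSeries.mk (DHc (DHΛ ψ B 1)) =
    ((1 + C (gaussSum B ψ) * X : ℂ[X]) : PowerSeries ℂ) := by
  ext n
  rw [PowerSeries.coeff_mk, Polynomial.coeff_coe]
  rcases n with _ | _ | n
  · rw [DHc_zero _ (DHΛ_one ψ B 1)]; simp
  · rw [zero_add, DHc_one]; simp [coeff_one]
  · rw [DHc_ge_two ψ B hψ _ (by omega)]; simp [coeff_one, coeff_X]

theorem DHfactor [DecidableEq F] (A : MulChar F ℂ) (m : ℕ) (hm0 : 0 < m) (hmF : (m : F) ≠ 0) :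
    DHc (DHΛ ψ (A ^ m) m) m = (∑ h ∈ DHM F m with h.coeff 0 = 0, ψ (DHlsum m h)) *
      (gaussSum (A ^ m) ψ * (A ^ m)⁻¹ (m : F)) := by
  have h1 : DHc (DHΛ ψ (A ^ m) m) m = ∑ x ∈ ((DHM F m).filter fun h => h.coeff 0 = 0) ×ˢ (univ : Finset F),
      (A ^ m) ((-1) ^ m * x.2) * ψ (DHlsum m x.1 - m * x.2) := by
    rw [DHc]
    symm
    refine Finset.sum_bij' (fun x _ => x.1 + C x.2 * X ^ (m - m)) (fun f _ => (f + C (- f.coeff 0) * X ^ (m - m), f.coeff 0)) ?_ ?_ ?_ ?_ ?_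
    · rintro ⟨f, c⟩ hf
      rw [mem_product, mem_filter, mem_DHM] at hf
      rw [mem_DHM]
      have := DHmonic_add hf.1.1.1 (r := m) hm0 hf.1.1.2.ge c
      rw [hf.1.1.2] at this
      exact this
    · intro f hf
      rw [mem_DHM] at hf
      rw [mem_product, mem_filter, mem_DHM]
      have := DHmonic_add hf.1 (r := m) hm0 hf.2.ge (- f.coeff 0)
      rw [hf.2] at this
      refine ⟨⟨this, by simp⟩, mem_univ _⟩
    · rintro ⟨f, c⟩ hf
      rw [mem_product, mem_filter, mem_DHM] at hf
      have := hf.1.2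
      simp at this
      simp [this]
    · intro f _
      simp
    · rintro ⟨f, c⟩ hf
      rw [mem_product, mem_filter, mem_DHM] at hf
      have h1 := DHmonic_add hf.1.1.1 (r := m) hm0 hf.1.1.2.ge c
      have h2 := DHlsum_add hf.1.1.1 (r := m) hm0 hf.1.1.2.ge c
      have h3 := hf.1.2
      simp only at h1 h2 h3
      rw [hf.1.1.2] at h1 h2
      simp only
      rw [DHΛ, h1.2, h2]
      simp [h3]
  rw [h1, Finset.sum_product, Finset.sum_mul]
  apply Finset.sum_congr rfl
  intro h _
  have hsq : (A ^ m) ((-1) ^ m * (-1)) = 1 := by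
    rw [MulChar.pow_apply' _ hm0.ne', ← map_pow, ← pow_succ, ← pow_mul, mul_comm]
    rw [Even.neg_one_pow (Nat.even_mul_succ_self m), map_one]
  rw [gaussSum, Finset.sum_mul, Finset.mul_sum]
  refine Finset.sum_bij' (fun c _ => - m * c) (fun u _ => - u / m) ?_ ?_ ?_ ?_ ?_
  · simp
  · simp
  · intro c _; field_simp
  · intro c _; field_simp
  · intro c _
    simp only
    rw [MulChar.inv_apply', sub_eq_add_neg, AddChar.map_add_eq_mul]
    have : (A ^ m) (-m * c) * (A ^ m) ((m : F)⁻¹) = (A ^ m) ((-1) ^ m * c) := by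
      rw [← map_mul, show (-(m : F) * c * (m : F)⁻¹) = -c by field_simp]
      calc (A ^ m) (-c) = (A ^ m) (-c) * (A ^ m) ((-1) ^ m * (-1)) := by rw [hsq, mul_one]
        _ = _ := by rw [← map_mul]; congr 1; ring
    rw [← this]
    rw [show -((m : F) * c) = -m * c by ring]
    ring

theorem DHmain (hψ : ψ ≠ 1) (χ A : MulChar F ℂ) (m : ℕ) (hm : orderOf χ = m) (hm0 : 0 < m) :
    ∏ i ∈ range m, gaussSum (χ ^ i * A) ψ = DHc (DHΛ ψ (A ^ m) m) m := by
  classical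
  obtain ⟨p, hp⟩ := CharP.exists F
  have : Fact p.Prime := ⟨CharP.char_is_prime F p⟩
  let E : ℕ → Type := fun k => FiniteField.Extension F p (k + 1)
  let _ : ∀ k, Field (E k) := fun k => inferInstanceAs (Field (FiniteField.Extension F p (k + 1)))
  let _ : ∀ k, Fintype (E k) := fun k => 
    have : Finite (FiniteField.Extension F p (k + 1)) := inferInstance
    Fintype.ofFinite (FiniteField.Extension F p (k + 1))
  let _ : ∀ k, Algebra F (E k) := fun k => inferInstanceAs (Algebra F (FiniteField.Extension F p (k + 1)))
  have hE : ∀ k, Module.finrank F (E k) = k + 1 := fun k => FiniteField.finrank_extension F p (k + 1)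
  have hprod := DHode_prod m _ _ (fun i => DHode hE (DHΛ ψ (χ ^ i * A) 1) (DHΛ_mul ψ _ 1))
  have hS : (∑ i ∈ range m, PowerSeries.mk (fun k => ∑ α : E k, DHΛ ψ (χ ^ i * A) 1 (DHcp F α))) =
      PowerSeries.mk (fun k => ∑ α : E k, DHΛ ψ (A ^ m) m (DHcp F α)) := by
    ext k
    rw [map_sum]
    simp only [PowerSeries.coeff_mk]
    rw [DHsum_eq ψ χ A m hm hm0]
  rw [hS] at hprod
  have heq := DHode_unique (DHode hE (DHΛ ψ (A ^ m) m) (DHΛ_mul ψ _ m)) hprod (by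
    rw [map_prod]
    simp only [← PowerSeries.coeff_zero_eq_constantCoeff_apply, PowerSeries.coeff_mk]
    rw [DHc_zero _ (DHΛ_one ψ _ m), Finset.prod_eq_one]
    intro i _
    exact DHc_zero _ (DHΛ_one ψ _ 1))
  have hc := congrArg (PowerSeries.coeff m) heq
  rw [PowerSeries.coeff_mk] at hc
  rw [hc]
  simp only [DHL_eq ψ _ hψ]
  have hpc : (∏ i ∈ range m, ((1 + C (gaussSum (χ ^ i * A) ψ) * X : ℂ[X]) : PowerSeries ℂ)) =
      ((∏ i ∈ range m, (1 + C (gaussSum (χ ^ i * A) ψ) * X) : ℂ[X]) : PowerSeries ℂ) := by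
    exact (map_prod (Polynomial.coeToPowerSeries.ringHom (R := ℂ))
      (fun i => (1 + C (gaussSum (χ ^ i * A) ψ) * X : ℂ[X])) (range m)).symm
  rw [hpc, Polynomial.coeff_coe]
  have := Polynomial.coeff_prod_of_natDegree_le (s := range m)
    (fun i => (1 + C (gaussSum (χ ^ i * A) ψ) * X : ℂ[X])) 1 (by
      intro i _
      compute_degree)
  rw [card_range, mul_one] at this
  rw [this]
  apply Finset.prod_congr rfl
  intro i _
  simp [coeff_one]
end


/-- Davenport–Hasse relation: if `χ` has order `m` then
`Π_{i=0}^{m-1} g(χ^i A) = g(A^m)·Ā^m(m)·Π_{i=1}^{m-1} g(χ^i)`. -/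
theorem davenport_hasse (ψ : AddChar F ℂ) (hψ : ψ ≠ 1) (χ A : MulChar F ℂ) (m : ℕ)
    (hm : orderOf χ = m) (hm0 : 0 < m) :
    ∏ i ∈ Finset.range m, gaussSum (χ ^ i * A) ψ =
      gaussSum (A ^ m) ψ * (A ^ m)⁻¹ ((m : F)) * ∏ i ∈ Finset.Ico 1 m, gaussSum (χ ^ i) ψ := by
  have hmF : (m : F) ≠ 0 := by
    intro h0
    have hdvd : m ∣ Fintype.card F - 1 := by
      rw [← hm]
      exact MulChar.orderOf_dvd_card_sub_one _ χ
    obtain ⟨t, ht⟩ := hdvd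
    have hpos : 0 < Fintype.card F := Fintype.card_pos
    have h1 : Fintype.card F = m * t + 1 := by omega
    have h2 : ((Fintype.card F : ℕ) : F) = 0 := FiniteField.cast_card_eq_zero F
    rw [h1] at h2
    push_cast at h2
    rw [h0] at h2
    simp at h2
  have hA := DHmain ψ hψ χ A m hm hm0
  have h1 := DHmain ψ hψ χ 1 m hm hm0
  rw [DHfactor ψ _ m hm0 hmF] at hA h1
  rw [hA]
  simp only [mul_one, one_pow, inv_one] at h1
  rw [MulChar.one_apply (Ne.isUnit hmF), gaussSum_one_left hψ, Finset.range_eq_Ico,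
    Finset.prod_eq_prod_Ico_succ_bot hm0, pow_zero, gaussSum_one_left hψ] at h1
  simp only [zero_add] at h1
  linear_combination (gaussSum (A ^ m) ψ * (A ^ m)⁻¹ (m : F)) * h1
end

section
/- Finite field Clausen identity: let q be an odd prime power, φ the quadratic character, and A, B multiplicative characters on F_q with A², B², A·B̄·φ, A·B, A·B·φ all nontrivial. Then for x ∈ F_q with x ≠ 1 and x ≠ 1/2: ₂F₁(A,B; ABφ | 4x(1-x))² = (AB(4)·g(B)²·g(Aφ)²/(q·g(A²)·g(B²)))·₃F₂(A², B², AB; A²B², ABφ | 4x(1-x)) + g(B)²·g(Aφ)²·(AB)⁻¹φ(x-x²)/(q²·g(A²)·g(B²)). -/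
open Finset

variable {F : Type*} [Field F] [Fintype F] [DecidableEq F]

set_option linter.unusedSectionVars false

namespace Clausen

@[simp] lemma chz (A : MulChar F ℂ) : A 0 = 0 := MulChar.map_zero A

lemma chinv (A : MulChar F ℂ) (a : F) : A⁻¹ a = (A a)⁻¹ := by
  by_cases h : a = 0
  · subst h; simp
  · rw [MulChar.inv_apply_eq_inv']

lemma chne (A : MulChar F ℂ) {a : F} (h : a ≠ 0) : A a ≠ 0 :=
  (IsUnit.map A (isUnit_iff_ne_zero.mpr h)).ne_zero

lemma chinv' (A : MulChar F ℂ) (a : F) : A a⁻¹ = (A a)⁻¹ := by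
  rw [← MulChar.inv_apply', chinv]

lemma chdiv (A : MulChar F ℂ) (a b : F) : A (a / b) = A a / A b := by
  rw [div_eq_mul_inv, map_mul, chinv', div_eq_mul_inv]

lemma chpow (A : MulChar F ℂ) (a : F) : (A ^ 2) a = (A a) ^ 2 := by
  rw [MulChar.pow_apply' A two_ne_zero]

lemma ch1 (A : MulChar F ℂ) : A 1 = 1 := by simp

lemma chm1 (A : MulChar F ℂ) : A (-1) * A (-1) = 1 := by
  rw [← map_mul]; simp

lemma chneg (A : MulChar F ℂ) (a : F) : A (-a) = A (-1) * A a := by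
  rw [← map_mul]; simp

/-- Reindexing of sums along a partial bijection. -/
lemma reindex {α β : Type*} [Fintype α] [Fintype β] (f : α → ℂ) (g : β → ℂ)
    (p : α → Prop) (r : β → Prop) (i : α → β) (j : β → α)
    (hf : ∀ a, ¬ p a → f a = 0) (hg : ∀ b, ¬ r b → g b = 0)
    (hi : ∀ a, p a → r (i a)) (hj : ∀ b, r b → p (j b))
    (hji : ∀ a, p a → j (i a) = a) (hij : ∀ b, r b → i (j b) = b)
    (h : ∀ a, p a → f a = g (i a)) : ∑ a, f a = ∑ b, g b := by
  classical
  have h1 : ∑ a, f a = ∑ a ∈ univ.filter p, f a := by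
    rw [Finset.sum_filter]; refine Finset.sum_congr rfl fun a _ => ?_
    split_ifs with hh
    · rfl
    · exact hf a hh
  have h2 : ∑ a, g a = ∑ a ∈ univ.filter r, g a := by
    rw [Finset.sum_filter]; refine Finset.sum_congr rfl fun a _ => ?_
    split_ifs with hh
    · rfl
    · exact hg a hh
  rw [h1, h2]
  refine Finset.sum_nbij' i j ?_ ?_ ?_ ?_ ?_ <;> simp <;> assumption

/-- The properties of the quadratic character. -/
structure Quad (φ : MulChar F ℂ) : Prop where
  two : (2 : F) ≠ 0
  sq : φ ^ 2 = 1
  ne : φ ≠ 1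

lemma Quad.of (hq : Odd (Fintype.card F)) (φ : MulChar F ℂ) (hφ : orderOf φ = 2) : Quad φ := by
  refine ⟨?_, ?_, ?_⟩
  · apply Ring.two_ne_zero
    intro h
    rw [FiniteField.even_card_iff_char_two] at h
    exact (Nat.not_even_iff_odd.mpr hq) (Nat.even_iff.mpr h)
  · rw [← hφ]; exact pow_orderOf_eq_one φ
  · rintro rfl; simp at hφ

variable {φ : MulChar F ℂ}

lemma Quad.mul_self (h : Quad φ) {a : F} (ha : a ≠ 0) : φ a * φ a = 1 := by
  rw [← pow_two, ← chpow, h.sq]; exact MulChar.one_apply (isUnit_iff_ne_zero.mpr ha)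

lemma Quad.four (h : Quad φ) : (4 : F) ≠ 0 := by
  have : (4 : F) = 2 * 2 := by norm_num
  rw [this]; exact mul_ne_zero h.two h.two

lemma Quad.inv (h : Quad φ) (a : F) : (φ a)⁻¹ = φ a := by
  by_cases ha : a = 0
  · subst ha; simp
  · exact inv_eq_of_mul_eq_one_left (h.mul_self ha)

lemma Quad.apply (h : Quad φ) (a : F) : φ a = ((quadraticChar F a : ℤ) : ℂ) := by
  have hc : ringChar F ≠ 2 := by
    intro hc
    apply h.two
    have := ringChar.Nat.cast_ringChar (R := F)
    rw [hc] at this; exact_mod_cast this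
  by_cases ha : a = 0
  · subst ha; simp
  have key : ∀ b : F, b ≠ 0 → IsSquare b → φ b = 1 := by
    rintro b hb ⟨c, rfl⟩
    rw [map_mul]; exact h.mul_self (by rintro rfl; simp at hb)
  by_cases hs : IsSquare a
  · rw [key a ha hs, (quadraticChar_one_iff_isSquare ha).mpr hs]; simp
  · rw [quadraticChar_neg_one_iff_not_isSquare.mpr hs]
    have h1 := h.mul_self ha
    have : φ a = 1 ∨ φ a = -1 := mul_self_eq_one_iff.mp h1
    rcases this with h2 | h2
    · exfalso; apply h.ne
      ext b
      rw [MulChar.one_apply_coe]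
      by_cases hb : IsSquare (b : F)
      · exact key _ b.ne_zero hb
      · have hab : IsSquare (a * b) := by
          rw [← quadraticChar_one_iff_isSquare (mul_ne_zero ha b.ne_zero), map_mul,
            quadraticChar_neg_one_iff_not_isSquare.mpr hs,
            quadraticChar_neg_one_iff_not_isSquare.mpr hb]; norm_num
        have := key _ (mul_ne_zero ha b.ne_zero) hab
        rw [map_mul, h2, one_mul] at this; exact this
    · rw [h2]; simp

lemma Quad.ringChar (h : Quad φ) : ringChar F ≠ 2 := by
  intro hc
  apply h.two
  have := ringChar.Nat.cast_ringChar (R := F)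
  rw [hc] at this; exact_mod_cast this

lemma Quad.card_sqrt (h : Quad φ) (a : F) :
    (∑ t : F, if t ^ 2 = a then (1 : ℂ) else 0) = 1 + φ a := by
  have := quadraticChar_card_sqrts h.ringChar a
  rw [h.apply, Finset.sum_boole]
  have h2 : ((#{x | x ^ 2 = a} : ℕ) : ℤ) = 1 + quadraticChar F a := by
    rw [add_comm, ← this]; congr 2; ext; simp
  have h3 : (((#{x | x ^ 2 = a} : ℕ) : ℤ) : ℂ) = ((1 + quadraticChar F a : ℤ) : ℂ) := by rw [h2]
  push_cast at h3; exact h3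

lemma Quad.sum_sq (h : Quad φ) (f : F → ℂ) : ∑ t : F, f (t ^ 2) = ∑ a, (1 + φ a) * f a := by
  simp_rw [← h.card_sqrt, Finset.sum_mul]
  rw [Finset.sum_comm]
  simp

lemma Quad.count (h : Quad φ) {α : F} (hα : α ≠ 0) (β γ : F) :
    (∑ u : F, if α * u ^ 2 - 2 * β * u + γ = 0 then (1 : ℂ) else 0) = 1 + φ (β ^ 2 - α * γ) := by
  rw [← h.card_sqrt]
  refine reindex _ _ (fun _ => True) (fun _ => True) (fun u => α * u - β) (fun t => (t + β) / α)
    (by simp) (by simp) (by simp) (by simp) ?_ ?_ ?_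
  · intro a _; field_simp; ring
  · intro a _; field_simp; ring
  · intro u _
    have : (α * u ^ 2 - 2 * β * u + γ = 0) ↔ (α * u - β) ^ 2 = β ^ 2 - α * γ := by
      constructor
      · intro hh; linear_combination α * hh
      · intro hh
        apply (mul_eq_zero_iff_left hα).mp
        linear_combination hh
    simp only [this]

lemma sum_ch {A : MulChar F ℂ} (hA : A ≠ 1) : ∑ a, A a = 0 := MulChar.sum_eq_zero_of_ne_one hA

lemma gs {A : MulChar F ℂ} (hA : A ≠ 1) (ψ : AddChar F ℂ) (Q : F) :
    ∑ s, A s * ψ (s * Q) = (A Q)⁻¹ * gaussSum A ψ := by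
  by_cases hQ : Q = 0
  · subst hQ; simp [sum_ch hA]
  · have := gaussSum_mulShift A ψ (Units.mk0 Q hQ)
    simp only [Units.val_mk0] at this
    rw [← this, inv_mul_cancel_left₀ (chne A hQ), gaussSum]
    simp [AddChar.mulShift_apply, mul_comm]


lemma Quad.sq1 (h : Quad φ) {a : F} (ha : a ≠ 0) : φ (a ^ 2) = 1 := by
  rw [pow_two, map_mul, h.mul_self ha]

lemma salie_aux (h : Quad φ) {e k : F} (he : e ≠ 0) (hk : k + 2 * e ≠ 0) :
    (∑ l : F, if l ^ 2 - k * l + e ^ 2 = 0 then φ l else 0) = φ (k + 2 * e) + φ (k - 2 * e) := by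
  have h2 := h.two
  have h1 : ∀ l : F, (if l ^ 2 - k * l + e ^ 2 = 0 then φ l else 0) =
      φ (k + 2 * e) * (if 1 * l ^ 2 - 2 * (k / 2) * l + e ^ 2 = 0 then 1 else 0) := by
    intro l
    have e1 : 1 * l ^ 2 - 2 * (k / 2) * l + e ^ 2 = l ^ 2 - k * l + e ^ 2 := by
      field_simp
    rw [e1]
    split_ifs with hl
    · rw [mul_one]
      have h3 : (l + e) ^ 2 = l * (k + 2 * e) := by linear_combination hl
      by_cases h0 : l = 0
      · subst h0
        exfalso
        have : e = 0 := by simpa using hl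
        exact he this
      · have h4 : φ l * φ (k + 2 * e) = 1 := by
          rw [← map_mul, ← h3]
          apply h.sq1
          intro h5
          rw [h5] at h3
          exact mul_ne_zero h0 hk (by rw [← h3]; simp)
        rw [← h.inv (k + 2 * e)]
        exact eq_inv_of_mul_eq_one_left h4
    · simp
  simp_rw [h1]
  rw [← Finset.mul_sum, h.count one_ne_zero, mul_add, mul_one]
  congr 1
  have : ((k / 2) ^ 2 - 1 * e ^ 2) = (k + 2 * e) * (k - 2 * e) / (2 * 2) := by
    field_simp; ring
  rw [this, chdiv, map_mul, map_mul, h.mul_self h2, ← mul_div_assoc, ← mul_assoc, h.mul_self hk]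
  simp

lemma salie_pt (h : Quad φ) {b : F} (hb : b ≠ 0) (k : F) :
    (∑ l : F, if l ^ 2 - k * l + b ^ 2 = 0 then φ l else 0) = φ (k + 2 * b) + φ (k - 2 * b) := by
  by_cases hk : k + 2 * b = 0
  · have hk' : k + 2 * (-b) ≠ 0 := by
      intro h0
      have : (4 : F) * b = 0 := by linear_combination hk - h0
      exact mul_ne_zero h.four hb this
    have := salie_aux h (neg_ne_zero.mpr hb) hk'
    rw [neg_sq] at this
    rw [this, add_comm]
    congr 2 <;> ring
  · exact salie_aux h hb hk

lemma gauss_shift (χ : MulChar F ℂ) (ψ : AddChar F ℂ) (c : F) :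
    gaussSum χ ψ * ψ c = ∑ k, χ (k - c) * ψ k := by
  rw [gaussSum, Finset.sum_mul]
  rw [← Equiv.sum_comp (Equiv.addRight c) (fun k => χ (k - c) * ψ k)]
  refine Finset.sum_congr rfl fun k _ => ?_
  simp [AddChar.map_add_eq_mul, mul_assoc]

lemma salie_sq (h : Quad φ) (ψ : AddChar F ℂ) {b : F} (hb : b ≠ 0) :
    ∑ l : F, φ l * ψ (l + b ^ 2 / l) = gaussSum φ ψ * (ψ (2 * b) + ψ (-(2 * b))) := by
  rw [mul_add, gauss_shift, gauss_shift, ← Finset.sum_add_distrib]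
  have h1 : ∀ l : F, φ l * ψ (l + b ^ 2 / l) =
      ∑ k, (if l ^ 2 - k * l + b ^ 2 = 0 then φ l else 0) * ψ k := by
    intro l
    by_cases hl : l = 0
    · subst hl; simp
    · rw [Finset.sum_eq_single (l + b ^ 2 / l)]
      · rw [if_pos]
        field_simp; ring
      · intro k _ hk
        rw [if_neg, zero_mul]
        intro h0
        apply hk
        field_simp
        linear_combination -h0
      · simp
  simp_rw [h1]
  rw [Finset.sum_comm]
  refine Finset.sum_congr rfl fun k _ => ?_
  rw [← Finset.sum_mul, salie_pt h hb]
  rw [sub_neg_eq_add]; ring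

lemma salie (h : Quad φ) (ψ : AddChar F ℂ) {z a : F} (hz : z ≠ 0) (ha : a ≠ 0) :
    ∑ l : F, φ l * ψ (l + z ^ 2 * a / l) =
      gaussSum φ ψ * ∑ t : F, if t ^ 2 = a then ψ (-(2 * z * t)) else 0 := by
  by_cases hs : IsSquare a
  · obtain ⟨t, rfl⟩ := hs
    have ht : t ≠ 0 := by rintro rfl; simp at ha
    have := salie_sq h ψ (mul_ne_zero hz ht)
    have e : z ^ 2 * (t * t) = (z * t) ^ 2 := by ring
    rw [e, this]
    congr 1
    have h3 : ∀ s : F, (if s ^ 2 = t * t then ψ (-(2 * z * s)) else 0) =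
        (if s = t then ψ (-(2 * z * s)) else 0) + (if s = -t then ψ (-(2 * z * s)) else 0) := by
      intro s
      have hne : t ≠ -t := by
        intro h0
        have : 2 * t = 0 := by linear_combination h0
        exact mul_ne_zero h.two ht this
      have : s ^ 2 = t * t ↔ s = t ∨ s = -t := by rw [← pow_two, sq_eq_sq_iff_eq_or_eq_neg]
      simp only [this]
      by_cases h1 : s = t
      · subst h1; simp [hne]
      · simp [h1]
    simp_rw [h3]
    rw [Finset.sum_add_distrib]
    simp
    rw [add_comm]; congr 2 <;> ring
  · have h3 : ∀ s : F, (if s ^ 2 = a then ψ (-(2 * z * s)) else 0) = 0 := by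
      intro s
      rw [if_neg]
      rintro rfl
      exact hs ⟨s, pow_two s⟩
    simp only [h3, Finset.sum_const_zero, mul_zero]
    have hφ : φ a = -1 := by
      rw [h.apply, quadraticChar_neg_one_iff_not_isSquare.mpr hs]; simp
    have h4 : ∑ l : F, φ l * ψ (l + z ^ 2 * a / l) = ∑ l : F, -(φ l * ψ (l + z ^ 2 * a / l)) := by
      refine reindex _ _ (fun l => l ≠ 0) (fun l => l ≠ 0) (fun l => z ^ 2 * a / l)
        (fun l => z ^ 2 * a / l) ?_ ?_ ?_ ?_ ?_ ?_ ?_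
      · intro l hl; simp at hl; subst hl; simp
      · intro l hl; simp at hl; subst hl; simp
      · intro l hl; exact div_ne_zero (mul_ne_zero (pow_ne_zero _ hz) ha) hl
      · intro l hl; exact div_ne_zero (mul_ne_zero (pow_ne_zero _ hz) ha) hl
      · intro l hl; field_simp
      · intro l hl; field_simp
      · intro l hl
        have : z ^ 2 * a / (z ^ 2 * a / l) = l := by field_simp
        simp only [this]
        rw [chdiv, map_mul, h.sq1 hz, hφ, div_eq_mul_inv (1 * -1 : ℂ), h.inv, add_comm l]
        ring
    rw [Finset.sum_neg_distrib] at h4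
    exact self_eq_neg.mp h4

lemma key (h : Quad φ) (ψ : AddChar F ℂ) (A : MulChar F ℂ) {z : F} (hz : z ≠ 0) (f : F → ℂ) :
    gaussSum φ ψ * ∑ t, (A ^ 2) t * f (t ^ 2) * ψ (-(2 * z * t)) =
      ∑ b, A b * f b * ∑ l, φ l * ψ (l + z ^ 2 * b / l) := by
  have h1 : ∀ t, (A ^ 2) t * f (t ^ 2) * ψ (-(2 * z * t)) =
      ∑ b, A b * f b * if t ^ 2 = b then ψ (-(2 * z * t)) else 0 := by
    intro t
    simp [chpow]
  simp_rw [h1]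
  rw [Finset.sum_comm, Finset.mul_sum]
  refine Finset.sum_congr rfl fun b _ => ?_
  by_cases hb : b = 0
  · subst hb; simp
  · rw [salie h ψ hz hb, ← Finset.mul_sum]; ring

lemma hasse_davenport (h : Quad φ) (ψ : AddChar F ℂ) {A : MulChar F ℂ} (hA : A ≠ 1) :
    gaussSum φ ψ * gaussSum (A ^ 2) ψ = A 4 * gaussSum A ψ * gaussSum (A * φ) ψ := by
  have h1 : gaussSum (A ^ 2) ψ = A 4 * ∑ t, (A ^ 2) t * 1 * ψ (-(2 * 1 * t)) := by
    rw [gaussSum, Finset.mul_sum]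
    have h2 := h.two
    refine reindex _ _ (fun _ => True) (fun _ => True) (fun t => -t / 2) (fun t => -(2 * t))
      (by simp) (by simp) (by simp) (by simp) ?_ ?_ ?_
    · intro a _; field_simp
    · intro a _; field_simp
    · intro a _
      have e : a = -(2 * 1 * (-a / 2)) := by field_simp
      rw [← e]
      have e2 : (A ^ 2) a = A 4 * (A ^ 2) (-a / 2) := by
        have h4 := h.four
        rw [chpow, chpow, ← map_pow, ← map_pow, ← map_mul]
        congr 1
        field_simp; norm_num
      rw [e2]; ring
  rw [h1, mul_left_comm, key h ψ A one_ne_zero (fun _ => 1)]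
  rw [mul_assoc]; congr 1
  simp only [Finset.mul_sum]
  rw [Finset.sum_comm]
  rw [gaussSum, gaussSum, mul_comm, Finset.sum_mul]
  refine Finset.sum_congr rfl fun l _ => ?_
  by_cases hl : l = 0
  · subst hl; simp
  have := gs hA ψ (l⁻¹)
  rw [chinv', inv_inv, gaussSum] at this
  simp only [MulChar.mul_apply]
  have e : A l * φ l * ψ l * ∑ a, A a * ψ a = φ l * ψ l * ∑ s, A s * ψ (s * l⁻¹) := by
    rw [this]; ring
  rw [e, Finset.mul_sum]
  refine Finset.sum_congr rfl fun s _ => ?_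
  rw [AddChar.map_add_eq_mul]
  have : 1 ^ 2 * s / l = s * l⁻¹ := by field_simp
  rw [this]; ring

lemma Quad.cases (h : Quad φ) {a : F} (ha : a ≠ 0) : φ a = 1 ∨ φ a = -1 :=
  mul_self_eq_one_iff.mp (h.mul_self ha)

lemma chm1_cases (A : MulChar F ℂ) : A (-1) = 1 ∨ A (-1) = -1 :=
  mul_self_eq_one_iff.mp (chm1 A)

/-- The Gegenbauer type sum. -/
noncomputable def PP (A D : MulChar F ℂ) (z : F) : ℂ :=
  ∑ t, (A ^ 2) t * D (t ^ 2 - 2 * z * t + 1)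

/-- The Euler type sum. -/
noncomputable def HH (φ A B : MulChar F ℂ) (y : F) : ℂ :=
  ∑ m, (A * φ) (m - 1) * A⁻¹ (m - y) * (B⁻¹ * φ) m

lemma PP_eq (h : Quad φ) (ψ : AddChar F ℂ) {A B : MulChar F ℂ} (hA : A ≠ 1) (hAB : A * B ≠ 1)
    (hB : B * φ ≠ 1) {z : F} (hz : z ≠ 0) :
    gaussSum φ ψ * gaussSum (A * B) ψ * PP A (A * B)⁻¹ z =
      gaussSum A ψ * gaussSum (B * φ) ψ * HH φ A B (1 - z ^ 2) := by
  have step1 : gaussSum φ ψ * gaussSum (A * B) ψ * PP A (A * B)⁻¹ z =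
      ∑ s, (A * B) s * ψ s * (gaussSum φ ψ *
        ∑ t, (A ^ 2) t * ψ (s * t ^ 2) * ψ (s * (-(2 * z * t)))) := by
    rw [PP, mul_assoc, Finset.mul_sum, Finset.mul_sum]
    have : ∀ t, gaussSum φ ψ * (gaussSum (A * B) ψ * ((A ^ 2) t * (A * B)⁻¹ (t ^ 2 - 2 * z * t + 1)))
        = ∑ s, gaussSum φ ψ * (A ^ 2) t * (A * B) s * ψ (s * (t ^ 2 - 2 * z * t + 1)) := by
      intro t
      have := gs hAB ψ (t ^ 2 - 2 * z * t + 1)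
      simp_rw [mul_assoc (gaussSum φ ψ * (A ^ 2) t)]
      rw [← Finset.mul_sum, this, chinv]; ring
    simp_rw [this]
    rw [Finset.sum_comm]
    refine Finset.sum_congr rfl fun s _ => ?_
    rw [Finset.mul_sum, Finset.mul_sum]
    refine Finset.sum_congr rfl fun t _ => ?_
    have e : s * (t ^ 2 - 2 * z * t + 1) = s + s * t ^ 2 + s * (-(2 * z * t)) := by ring
    rw [e, AddChar.map_add_eq_mul, AddChar.map_add_eq_mul]; ring
  have step2 : ∀ s, (A * B) s * ψ s * (gaussSum φ ψ *
        ∑ t, (A ^ 2) t * ψ (s * t ^ 2) * ψ (s * (-(2 * z * t)))) =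
      ∑ l, φ l * ((A * B) s * φ s * ψ (s * (1 + l)) * ∑ b, A b * ψ (b * (s * (1 + z ^ 2 / l)))) := by
    intro s
    by_cases hs : s = 0
    · subst hs; simp
    have h1 := gaussSum_mulShift φ ψ (Units.mk0 s hs)
    simp only [Units.val_mk0] at h1
    have h2 := key h (ψ.mulShift s) A hz (fun b => ψ (s * b))
    simp only [AddChar.mulShift_apply] at h2
    rw [← h1, mul_assoc (φ s), h2]
    simp only [Finset.mul_sum]
    rw [Finset.sum_comm]
    refine Finset.sum_congr rfl fun l _ => ?_
    refine Finset.sum_congr rfl fun b _ => ?_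
    by_cases hl : l = 0
    · subst hl; simp
    have e1 : s * (1 + l) = s + s * l := by ring
    have e2 : b * (s * (1 + z ^ 2 / l)) = s * b + s * (z ^ 2 * b / l) := by ring
    rw [e1, e2, mul_add s l]
    simp only [AddChar.map_add_eq_mul]; ring
  rw [step1]
  simp_rw [step2]
  rw [Finset.sum_comm]
  simp_rw [← Finset.mul_sum, gs hA]
  have step3 : ∀ l, φ l * ∑ s, (A * B) s * φ s * ψ (s * (1 + l)) *
        ((A (s * (1 + z ^ 2 / l)))⁻¹ * gaussSum A ψ) =
      gaussSum A ψ * gaussSum (B * φ) ψ * ((A * φ) l * A⁻¹ (l + z ^ 2) * (B⁻¹ * φ) (l + 1)) := by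
    intro l
    by_cases hl : l = 0
    · subst hl; simp
    have e1 : 1 + z ^ 2 / l = (l + z ^ 2) / l := by field_simp
    have h1 : ∀ s, (A * B) s * φ s * ψ (s * (1 + l)) *
        ((A (s * (1 + z ^ 2 / l)))⁻¹ * gaussSum A ψ) =
        (gaussSum A ψ * A l * (A (l + z ^ 2))⁻¹) * ((B * φ) s * ψ (s * (1 + l))) := by
      intro s
      by_cases hs : s = 0
      · subst hs; simp
      rw [e1, map_mul A, chdiv, mul_inv, inv_div]
      simp only [MulChar.mul_apply]
      have := chne A hs
      field_simp
    simp_rw [h1]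
    rw [← Finset.mul_sum, gs hB]
    simp only [MulChar.mul_apply, chinv, mul_inv, h.inv]
    rw [add_comm 1 l]
    ring
  simp_rw [step3]
  rw [← Finset.mul_sum, HH]
  congr 1
  rw [← Equiv.sum_comp (Equiv.addRight (1 : F))
    (fun m => (A * φ) (m - 1) * A⁻¹ (m - (1 - z ^ 2)) * (B⁻¹ * φ) m)]
  refine Finset.sum_congr rfl fun l _ => ?_
  simp only [Equiv.coe_addRight]
  have e1 : l + 1 - 1 = l := by ring
  have e2 : l + 1 - (1 - z ^ 2) = l + z ^ 2 := by ring
  rw [e1, e2]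

lemma HH_symm (h : Quad φ) (A B : MulChar F ℂ) {y : F} (hy : y ≠ 0) :
    HH φ A B y = φ (-1) * (A * B * φ)⁻¹ y * HH φ (A⁻¹ * φ) (B⁻¹ * φ) y := by
  rw [HH, HH, Finset.mul_sum]
  refine reindex _ _ (fun m => m ≠ 0) (fun m => m ≠ 0) (fun m => y / m) (fun m => y / m)
    ?_ ?_ ?_ ?_ ?_ ?_ ?_
  · intro m hm; simp at hm; subst hm; simp
  · intro m hm; simp at hm; subst hm; simp
  · intro m hm; exact div_ne_zero hy hm
  · intro m hm; exact div_ne_zero hy hm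
  · intro m hm; field_simp
  · intro m hm; field_simp
  · intro m hm
    have e1 : y / m - 1 = -(m - y) / m := by field_simp; ring
    have e2 : y / m - y = -(y * (m - 1)) / m := by field_simp; ring
    rw [e1, e2]
    simp only [MulChar.mul_apply, chinv, chdiv, mul_inv, h.inv, inv_inv]
    rw [chneg A (m - y), chneg φ (m - y), chneg A (y * _), chneg φ (y * _)]
    simp only [map_mul, mul_inv, h.inv]
    have a1 := chne A hm
    have a2 := chne A hy
    have a3 := chne B hm
    have a4 := chne B hy
    have a5 := chne φ hm
    have a6 := chne φ hy
    by_cases hmy : m - y = 0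
    · rw [hmy]; simp
    rcases h.cases hmy with c5 | c5 <;>
    rcases h.cases hm with c1 | c1 <;> rcases h.cases hy with c2 | c2 <;>
      rcases chm1_cases φ with c3 | c3 <;> rcases chm1_cases A with c4 | c4 <;>
      simp only [c1, c2, c3, c4, c5] <;> field_simp

lemma ratio_sum {D : MulChar F ℂ} (hD : D ≠ 1) (p r : F) :
    D p * D⁻¹ r = ∑ k, D k * if p = k * r then 1 else 0 := by
  by_cases hr : r = 0
  · subst hr
    by_cases hp : p = 0
    · subst hp; simp [sum_ch hD]
    · simp [hp]
  · rw [Finset.sum_eq_single (p / r)]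
    · rw [if_pos (by field_simp), chdiv, chinv]; ring
    · intro k _ hk
      rw [if_neg, mul_zero]
      rintro rfl
      apply hk; field_simp
    · simp

lemma inner_sum (h : Quad φ) {D : MulChar F ℂ} (hD : D ≠ 1) {v z : F} (hv : v ≠ 0) (hz : z ≠ 0) :
    ∑ u, D ((v * u) ^ 2 - 2 * z * (v * u) + 1) * D⁻¹ (u ^ 2 - 2 * z * u + 1) =
      ∑ k, D k * φ (k * (1 - v) ^ 2 - (1 - z ^ 2) * (v - k) ^ 2) +
        ((if v = 1 then (Fintype.card F : ℂ) else 0) - (D ^ 2) v) := by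
  simp_rw [ratio_sum hD]
  rw [Finset.sum_comm]
  simp_rw [← Finset.mul_sum]
  have hk : ∀ k, (∑ u : F, if (v * u) ^ 2 - 2 * z * (v * u) + 1 = k * (u ^ 2 - 2 * z * u + 1)
        then (1 : ℂ) else 0) = 1 + φ (k * (1 - v) ^ 2 - (1 - z ^ 2) * (v - k) ^ 2) +
        if k = v ^ 2 then ((if v = 1 then (Fintype.card F : ℂ) else 0) - 1) else 0 := by
    intro k
    have e : ∀ u, ((v * u) ^ 2 - 2 * z * (v * u) + 1 = k * (u ^ 2 - 2 * z * u + 1)) ↔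
        (v ^ 2 - k) * u ^ 2 - 2 * (z * (v - k)) * u + (1 - k) = 0 := by
      intro u
      constructor
      · intro h; linear_combination h
      · intro h; linear_combination h
    simp_rw [e]
    by_cases hkv : k = v ^ 2
    · subst hkv
      rw [if_pos rfl]
      by_cases hv1 : v = 1
      · subst hv1; simp
      · rw [if_neg hv1]
        have hv1' : 1 - v ≠ 0 := sub_ne_zero.mpr (Ne.symm hv1)
        have h2 := h.two
        rw [Finset.sum_eq_single ((1 + v) / (2 * z * v))]
        · rw [if_pos (by field_simp; ring)]
          have : v ^ 2 * (1 - v) ^ 2 - (1 - z ^ 2) * (v - v ^ 2) ^ 2 = (z * v * (1 - v)) ^ 2 := by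
            ring
          rw [this, h.sq1 (by positivity)]; ring
        · intro u _ hu
          rw [if_neg]
          intro h0
          apply hu
          field_simp
          apply mul_left_cancel₀ hv1'
          linear_combination -h0
        · simp
    · rw [if_neg hkv, h.count (sub_ne_zero.mpr (Ne.symm hkv))]
      rw [add_zero]
      congr 2
      ring
  simp_rw [hk, mul_add, mul_one]
  rw [Finset.sum_add_distrib, Finset.sum_add_distrib, sum_ch hD, zero_add]
  congr 1
  simp only [mul_ite, mul_zero, Finset.sum_ite_eq', Finset.mem_univ, if_true]
  rw [map_pow, ← chpow]
  split_ifs with h1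
  · subst h1; simp
  · ring

/-- The double sum which the product of two Gegenbauer sums and the `₃F₂` are reduced to. -/
noncomputable def WW (φ A E : MulChar F ℂ) (y : F) : ℂ :=
  ∑ P, E P * ∑ w, (A ^ 2) w * φ ((1 + w * y * P) ^ 2 - P * (1 + w) ^ 2)

lemma PP_mul (h : Quad φ) {A D : MulChar F ℂ} (hD : D ≠ 1) (hA2 : A ^ 2 ≠ 1)
    (hAD : A ^ 2 * D ^ 2 ≠ 1) {z : F} (hz : z ≠ 0) :
    PP A D z * PP (A⁻¹ * φ) D⁻¹ z =
      ∑ v, (A ^ 2) v * ∑ k, D k * φ (k * (1 - v) ^ 2 - (1 - z ^ 2) * (v - k) ^ 2) +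
        (Fintype.card F : ℂ) := by
  have h1 : PP A D z * PP (A⁻¹ * φ) D⁻¹ z = ∑ u, ∑ v, (if u = 0 then 0 else
      (A ^ 2) v * (D ((v * u) ^ 2 - 2 * z * (v * u) + 1) * D⁻¹ (u ^ 2 - 2 * z * u + 1))) := by
    rw [mul_comm, PP, Finset.sum_mul]
    refine Finset.sum_congr rfl fun u _ => ?_
    by_cases hu : u = 0
    · subst hu; simp
    · rw [PP, Finset.mul_sum]
      refine reindex _ _ (fun _ => True) (fun _ => True) (fun t => t / u) (fun v => v * u)
        (by simp) (by simp) (by simp) (by simp) ?_ ?_ ?_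
      · intro a _; field_simp
      · intro a _; field_simp
      · intro t _
        have : t / u * u = t := by field_simp
        simp only [this, if_neg hu]
        rw [chpow, MulChar.mul_apply, chinv, mul_pow, pow_two (φ u), h.mul_self hu, chpow, chpow,
          chdiv]
        have := chne A hu
        field_simp
  have h2 : ∀ v, (∑ u, if u = 0 then 0 else
      (A ^ 2) v * (D ((v * u) ^ 2 - 2 * z * (v * u) + 1) * D⁻¹ (u ^ 2 - 2 * z * u + 1))) =
      (A ^ 2) v * ∑ k, D k * φ (k * (1 - v) ^ 2 - (1 - z ^ 2) * (v - k) ^ 2) +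
      ((if v = 1 then (Fintype.card F : ℂ) else 0) - (A ^ 2 * D ^ 2) v - (A ^ 2) v) := by
    intro v
    by_cases hv : v = 0
    · subst hv; simp
    have h3 : ∀ u, (if u = 0 then 0 else
      (A ^ 2) v * (D ((v * u) ^ 2 - 2 * z * (v * u) + 1) * D⁻¹ (u ^ 2 - 2 * z * u + 1))) =
      (A ^ 2) v * (D ((v * u) ^ 2 - 2 * z * (v * u) + 1) * D⁻¹ (u ^ 2 - 2 * z * u + 1)) -
        if u = 0 then (A ^ 2) v else 0 := by
      intro u
      split_ifs with hu
      · subst hu; simp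
      · simp
    simp_rw [h3]
    rw [Finset.sum_sub_distrib, ← Finset.mul_sum, inner_sum h hD hv hz]
    simp only [Finset.sum_ite_eq', Finset.mem_univ, if_true, MulChar.mul_apply]
    split_ifs with hv1
    · subst hv1; simp; ring
    · ring
  rw [h1, Finset.sum_comm]
  simp_rw [h2]
  rw [Finset.sum_add_distrib, Finset.sum_sub_distrib, Finset.sum_sub_distrib, sum_ch hAD,
    sum_ch hA2]
  simp

lemma W_eq (h : Quad φ) (A E : MulChar F ℂ) {y : F} (hy : y ≠ 0) :
    ∑ v, (A ^ 2) v * ∑ k, E⁻¹ k * φ (k * (1 - v) ^ 2 - y * (v - k) ^ 2) =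
      φ (-1) * (E * φ) y * WW φ A E y := by
  have h1 : ∀ v, ∑ k, E⁻¹ k * φ (k * (1 - v) ^ 2 - y * (v - k) ^ 2) =
      ∑ P, φ (-1) * (E * φ) y * E P * φ ((1 + (-v) * y * P) ^ 2 - P * (1 + (-v)) ^ 2) := by
    intro v
    refine reindex _ _ (fun m => m ≠ 0) (fun m => m ≠ 0) (fun k => 1 / (y * k))
      (fun P => 1 / (y * P)) ?_ ?_ ?_ ?_ ?_ ?_ ?_
    · intro m hm; simp at hm; subst hm; simp
    · intro m hm; simp at hm; subst hm; simp
    · intro m hm; exact div_ne_zero one_ne_zero (mul_ne_zero hy hm)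
    · intro m hm; exact div_ne_zero one_ne_zero (mul_ne_zero hy hm)
    · intro m hm; field_simp
    · intro m hm; field_simp
    · intro k hk
      have e : (1 + (-v) * y * (1 / (y * k))) ^ 2 - (1 / (y * k)) * (1 + (-v)) ^ 2 =
        (-1) * (k * (1 - v) ^ 2 - y * (v - k) ^ 2) / (y * k ^ 2) := by field_simp; ring
      simp only [e]
      rw [chdiv, chdiv, map_mul φ (-1), map_mul φ y, h.sq1 hk, chinv]
      simp only [MulChar.mul_apply, map_mul, ch1]
      have a1 := chne E hk
      have a2 := chne E hy
      rcases h.cases hy with c2 | c2 <;> rcases chm1_cases φ with c3 | c3 <;>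
      simp only [c2, c3] <;> field_simp
  simp_rw [h1]
  rw [WW]
  simp only [Finset.mul_sum]
  rw [Finset.sum_comm]
  refine Finset.sum_congr rfl fun P _ => ?_
  rw [← Equiv.sum_comp (Equiv.neg F)]
  refine Finset.sum_congr rfl fun v _ => ?_
  simp only [Equiv.neg_apply, neg_neg]
  rw [chpow, chpow, chneg, mul_pow, pow_two (A (-1)), chm1]
  ring

lemma card_sub_ne : (Fintype.card F : ℂ) - 1 ≠ 0 := by
  have h : 1 < Fintype.card F := Fintype.one_lt_card
  rw [sub_ne_zero]; exact_mod_cast h.ne'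

lemma card_ne : (Fintype.card F : ℂ) ≠ 0 := by
  exact_mod_cast Fintype.card_ne_zero

lemma orth (a : F) : ∑ χ : MulChar F ℂ, χ a = if a = 1 then (Fintype.card F : ℂ) - 1 else 0 := by
  split_ifs with ha
  · subst ha
    simp only [ch1, Finset.sum_const, nsmul_eq_mul, mul_one, Finset.card_univ]
    have h1 := MulChar.card_eq_card_units_of_hasEnoughRootsOfUnity F ℂ
    rw [Nat.card_eq_fintype_card, Nat.card_eq_fintype_card, Fintype.card_units] at h1
    rw [h1, Nat.cast_sub Fintype.card_pos]; simp
  · obtain ⟨χ₀, hχ⟩ := MulChar.exists_apply_ne_one_of_hasEnoughRootsOfUnity F ℂ ha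
    have : χ₀ a * ∑ χ : MulChar F ℂ, χ a = ∑ χ : MulChar F ℂ, χ a := by
      rw [Finset.mul_sum, ← Equiv.sum_comp (Equiv.mulLeft χ₀) (fun χ : MulChar F ℂ => χ a)]
      simp [MulChar.mul_apply]
    by_contra hne
    exact hχ (mul_right_cancel₀ hne (by rw [this, one_mul]))

lemma base (A : MulChar F ℂ) (x : F) : ∑ χ : MulChar F ℂ, greeneBinom (A * χ) χ * χ x =
    if x = 0 then 0 else ((Fintype.card F : ℂ) - 1) / (Fintype.card F : ℂ) * A⁻¹ (1 - x) := by
  have h1 : ∀ χ : MulChar F ℂ, greeneBinom (A * χ) χ * χ x =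
      ∑ a, 1 / (Fintype.card F : ℂ) * A a * χ (-1 * a * x / (1 - a)) := by
    intro χ
    rw [greeneBinom, Finset.mul_sum, Finset.sum_mul]
    refine Finset.sum_congr rfl fun a _ => ?_
    rw [chdiv, map_mul, map_mul, chinv, MulChar.mul_apply]
    ring
  simp_rw [h1]
  rw [Finset.sum_comm]
  simp_rw [← Finset.mul_sum, orth]
  split_ifs with hx
  · subst hx; simp
  · rw [Finset.sum_eq_single (1 - x)⁻¹]
    · by_cases h1x : 1 - x = 0
      · simp [h1x]
      · rw [if_pos, chinv', chinv]
        · ring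
        · have : 1 - (1 - x)⁻¹ = -x / (1 - x) := by field_simp; ring
          rw [this]; field_simp
    · intro b _ hb
      rw [if_neg, mul_zero]
      intro h
      apply hb
      have h2 : 1 - b ≠ 0 := by rintro h2; rw [h2] at h; simp at h
      rw [div_eq_one_iff_eq h2] at h
      exact eq_inv_of_mul_eq_one_left (by linear_combination h)
    · simp

lemma recur (c : MulChar F ℂ → ℂ) (C E : MulChar F ℂ) (x : F) :
    ∑ χ : MulChar F ℂ, c χ * greeneBinom (C * χ) (E * χ) * χ x =
    E (-1) / (Fintype.card F : ℂ) * ∑ a, C a * E⁻¹ (1 - a) *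
      ∑ χ : MulChar F ℂ, c χ * χ (-1 * a * x / (1 - a)) := by
  simp_rw [Finset.mul_sum]
  rw [Finset.sum_comm]
  refine Finset.sum_congr rfl fun χ _ => ?_
  rw [greeneBinom, Finset.mul_sum, Finset.mul_sum, Finset.sum_mul]
  refine Finset.sum_congr rfl fun a _ => ?_
  rw [chdiv, map_mul, map_mul, chinv, chinv, MulChar.mul_apply, MulChar.mul_apply,
    MulChar.mul_apply, mul_inv]
  ring

lemma F21_int (A B C : MulChar F ℂ) {y : F} (hy : y ≠ 0) :
    greeneF21 A B C y = C (-1) / (Fintype.card F : ℂ) *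
      ∑ b, B b * C⁻¹ (1 - b) * A⁻¹ (1 - (-1 * b * y / (1 - b))) := by
  rw [greeneF21, recur (fun χ => greeneBinom (A * χ) χ) B C y]
  simp_rw [base]
  have : ∀ b, B b * C⁻¹ (1 - b) * (if -1 * b * y / (1 - b) = 0 then 0 else
      ((Fintype.card F : ℂ) - 1) / (Fintype.card F : ℂ) * A⁻¹ (1 - (-1 * b * y / (1 - b)))) =
      ((Fintype.card F : ℂ) - 1) / (Fintype.card F : ℂ) *
      (B b * C⁻¹ (1 - b) * A⁻¹ (1 - (-1 * b * y / (1 - b)))) := by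
    intro b
    split_ifs with h
    · simp only [div_eq_zero_iff, mul_eq_zero, neg_eq_zero, one_ne_zero, hy, or_false, false_or] at h
      rcases h with h | h <;> simp [h]
    · ring
  simp_rw [this]
  rw [← Finset.mul_sum]
  have := card_ne (F := F)
  have := card_sub_ne (F := F)
  generalize (∑ b, B b * C⁻¹ (1 - b) * A⁻¹ (1 - -1 * b * y / (1 - b))) = S
  field_simp

lemma F21_HH (h : Quad φ) (A B : MulChar F ℂ) {y : F} (hy : y ≠ 0) :
    greeneF21 A B (A * B * φ) y = (A * φ) (-1) / (Fintype.card F : ℂ) * HH φ A B y := by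
  rw [F21_int _ _ _ hy, HH, Finset.mul_sum, Finset.mul_sum]
  refine reindex _ _ (fun b => b ≠ 0 ∧ b ≠ 1) (fun m => m ≠ 0 ∧ m ≠ 1) (fun b => (b - 1) / b)
      (fun m => 1 / (1 - m)) ?_ ?_ ?_ ?_ ?_ ?_ ?_
  · intro m hm
    by_cases h0 : m = 0
    · subst h0; simp
    · have : m = 1 := by tauto
      subst this; simp
  · intro m hm
    by_cases h0 : m = 0
    · subst h0; simp
    · have : m = 1 := by tauto
      subst this; simp
  · rintro b ⟨h0, h1⟩
    refine ⟨div_ne_zero (sub_ne_zero.2 h1) h0, ?_⟩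
    intro e; rw [div_eq_one_iff_eq h0] at e; exact one_ne_zero (α := F) (by linear_combination -e)
  · rintro b ⟨h0, h1⟩
    have h1' : 1 - b ≠ 0 := sub_ne_zero.2 (Ne.symm h1)
    refine ⟨div_ne_zero one_ne_zero h1', ?_⟩
    intro e; rw [div_eq_one_iff_eq h1'] at e; apply h0; linear_combination e
  · rintro b ⟨h0, h1⟩
    have : 1 - (b - 1) / b = 1 / b := by field_simp; ring
    simp only [this]; field_simp
  · rintro m ⟨h0, h1⟩
    have h1' : 1 - m ≠ 0 := sub_ne_zero.2 (Ne.symm h1)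
    field_simp; ring
  · rintro b ⟨h0, h1⟩
    have h1' : 1 - b ≠ 0 := sub_ne_zero.2 (Ne.symm h1)
    have e1 : 1 - (-1 * b * y / (1 - b)) = ((b - 1) / b - y) / ((-1) * ((1 - b) / b)) := by
      field_simp; ring
    have e2 : (b - 1) / b = (-1) * ((1 - b) / b) := by field_simp; ring
    have e3 : (b - 1) / b - 1 = (-1) / b := by field_simp; ring
    simp only [e1]
    rw [e3, chinv, chinv, chdiv A, chinv]
    generalize hk : (b - 1) / b - y = k
    rw [e2]
    simp only [MulChar.mul_apply, map_mul, chdiv, chinv]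
    have a1 := chne A h1'
    have a2 := chne B h1'
    have a3 := chne A h0
    have a4 := chne B h0
    rcases h.cases h1' with c1 | c1 <;> rcases h.cases h0 with c2 | c2 <;>
    rcases chm1_cases φ with c3 | c3 <;> rcases chm1_cases A with c4 | c4 <;>
    rcases chm1_cases B with c5 | c5 <;>
    simp only [c1, c2, c3, c4, c5] <;> field_simp

/-- The double sum attached to the ₃F₂. -/
noncomputable def TT (φ A B : MulChar F ℂ) (y : F) : ℂ :=
  ∑ u, (A * B) u * φ (1 - u) * ∑ t, (B ^ 2) t * (A ^ 2) (1 - t) * (A ^ 2)⁻¹ (1 - y * t * u)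

lemma F32_TT (h : Quad φ) (A B : MulChar F ℂ) {y : F} (hy : y ≠ 0) :
    greeneF32 (A ^ 2) (B ^ 2) (A * B) (A ^ 2 * B ^ 2) (A * B * φ) y =
      φ (-1) / (Fintype.card F : ℂ) ^ 2 * TT φ A B y := by
  rw [greeneF32, recur (fun χ => greeneBinom (A ^ 2 * χ) χ *
    greeneBinom (B ^ 2 * χ) (A ^ 2 * B ^ 2 * χ)) (A * B) (A * B * φ) y]
  have h1 : ∀ w, (Fintype.card F : ℂ) / ((Fintype.card F : ℂ) - 1) *
      ∑ χ : MulChar F ℂ, greeneBinom (A ^ 2 * χ) χ *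
      greeneBinom (B ^ 2 * χ) (A ^ 2 * B ^ 2 * χ) * χ w =
      if w = 0 then 0 else 1 / (Fintype.card F : ℂ) *
      ∑ t, (B ^ 2) t * (A ^ 2) (1 - t) * (A ^ 2)⁻¹ (1 - w * t) := by
    intro w
    split_ifs with hw
    · subst hw; simp
    · have := F21_int (A ^ 2) (B ^ 2) (A ^ 2 * B ^ 2) hw
      rw [greeneF21] at this
      rw [this]
      have hm : (A ^ 2 * B ^ 2) (-1) = 1 := by
        rw [MulChar.mul_apply, chpow, chpow, pow_two, pow_two, chm1, chm1, one_mul]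
      rw [hm]
      congr 1
      refine reindex _ _ (fun b => b ≠ 1) (fun m => m ≠ 1) (fun b => b / (b - 1))
        (fun m => m / (m - 1)) ?_ ?_ ?_ ?_ ?_ ?_ ?_
      · intro m hm; simp at hm; subst hm; simp
      · intro m hm; simp at hm; subst hm; simp
      · intro b hb e; rw [div_eq_one_iff_eq (sub_ne_zero.2 hb)] at e; exact one_ne_zero (α := F) (by linear_combination e)
      · intro b hb e; rw [div_eq_one_iff_eq (sub_ne_zero.2 hb)] at e; exact one_ne_zero (α := F) (by linear_combination e)
      · intro b hb
        have hb' := sub_ne_zero.2 hb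
        have : b / (b - 1) - 1 = 1 / (b - 1) := by field_simp; ring
        simp only [this]; field_simp
      · intro b hb
        have hb' := sub_ne_zero.2 hb
        have : b / (b - 1) - 1 = 1 / (b - 1) := by field_simp; ring
        simp only [this]; field_simp
      · intro b hb
        have hb' : 1 - b ≠ 0 := sub_ne_zero.2 (Ne.symm hb)
        have hb2 : b - 1 ≠ 0 := sub_ne_zero.2 hb
        have e1 : b / (b - 1) = (-1) * (b / (1 - b)) := by field_simp; ring
        have e2 : 1 - b / (b - 1) = 1 / (1 - b) := by field_simp; ring
        have e3 : 1 - (-1 * b * w / (1 - b)) = 1 - w * (b / (b - 1)) := by rw [e1]; ring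
        simp only [e3]
        generalize (A ^ 2)⁻¹ (1 - w * (b / (b - 1))) = k
        rw [e2, e1]
        simp only [MulChar.mul_apply, map_mul, chdiv, chinv, chpow, ch1]
        have a1 := chne A hb'
        have a2 := chne B hb'
        rcases chm1_cases B with c5 | c5 <;> simp only [c5] <;> field_simp <;> try ring
  rw [mul_left_comm, Finset.mul_sum]
  simp_rw [mul_left_comm _ ((A * B) _ * _), h1]
  rw [TT, Finset.mul_sum, Finset.mul_sum]
  refine reindex _ _ (fun b => b ≠ 1) (fun m => m ≠ 1) (fun b => b / (b - 1))
        (fun m => m / (m - 1)) ?_ ?_ ?_ ?_ ?_ ?_ ?_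
  · intro m hm; simp at hm; subst hm; simp
  · intro m hm; simp at hm; subst hm; simp
  · intro b hb e; rw [div_eq_one_iff_eq (sub_ne_zero.2 hb)] at e; exact one_ne_zero (α := F) (by linear_combination e)
  · intro b hb e; rw [div_eq_one_iff_eq (sub_ne_zero.2 hb)] at e; exact one_ne_zero (α := F) (by linear_combination e)
  · intro b hb
    have hb' := sub_ne_zero.2 hb
    have : b / (b - 1) - 1 = 1 / (b - 1) := by field_simp; ring
    simp only [this]; field_simp
  · intro b hb
    have hb' := sub_ne_zero.2 hb
    have : b / (b - 1) - 1 = 1 / (b - 1) := by field_simp; ring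
    simp only [this]; field_simp
  · intro b hb
    have hb' : 1 - b ≠ 0 := sub_ne_zero.2 (Ne.symm hb)
    have hb2 : b - 1 ≠ 0 := sub_ne_zero.2 hb
    by_cases hb0 : b = 0
    · subst hb0; simp
    have e1 : b / (b - 1) = (-1) * (b / (1 - b)) := by field_simp; ring
    have e2 : 1 - b / (b - 1) = 1 / (1 - b) := by field_simp; ring
    have e3 : ∀ t, y * t * (b / (b - 1)) = -1 * b * y / (1 - b) * t := by intro t; rw [e1]; ring
    have e4 : -1 * b * y / (1 - b) ≠ 0 := by
      refine div_ne_zero (mul_ne_zero (mul_ne_zero (by simp) hb0) hy) hb'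
    simp only [e3, if_neg e4]
    generalize (∑ t, (B ^ 2) t * (A ^ 2) (1 - t) *
      (A ^ 2)⁻¹ (1 - -1 * b * y / (1 - b) * t)) = k
    rw [e2, e1]
    simp only [MulChar.mul_apply, map_mul, chdiv, chinv, chpow, ch1]
    have a1 := chne A hb'
    have a2 := chne B hb'
    rcases h.cases hb' with c1 | c1 <;>
    rcases chm1_cases φ with c3 | c3 <;> rcases chm1_cases A with c4 | c4 <;>
    rcases chm1_cases B with c5 | c5 <;>
    simp only [c1, c3, c4, c5] <;> field_simp

lemma sum_sq_sub (h : Quad φ) {P : F} (hP : P ≠ 0) : ∑ t, φ (t ^ 2 - P) = -1 := by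
  rw [h.sum_sq (fun a => φ (a - P))]
  simp only [add_mul, one_mul]
  have h0 : ∑ a, φ (a - P) = 0 := by
    rw [← sum_ch h.ne]; exact (Equiv.subRight P).sum_comp (fun a => φ a)
  rw [Finset.sum_add_distrib, h0, zero_add]
  have : ∑ a, φ a * φ (a - P) = ∑ b, (φ b - if b = 1 then 1 else 0) := by
    refine reindex _ _ (fun a => a ≠ 0) (fun b => b ≠ 1) (fun a => 1 - P / a)
      (fun b => P / (1 - b)) ?_ ?_ ?_ ?_ ?_ ?_ ?_
    · intro m hm; simp at hm; subst hm; simp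
    · intro m hm; simp at hm; subst hm; simp
    · intro a ha e
      exact div_ne_zero hP ha (by linear_combination -e)
    · intro b hb
      exact div_ne_zero hP (sub_ne_zero.2 (Ne.symm hb))
    · intro a ha; simp only [sub_sub_cancel]; field_simp
    · intro b hb
      have := sub_ne_zero.2 (Ne.symm hb)
      field_simp; ring
    · intro a ha
      have e : 1 - P / a ≠ 1 := by
        intro e
        exact div_ne_zero hP ha (by linear_combination -e)
      have e2 : 1 - P / a = (a - P) / a := by field_simp
      rw [if_neg e, e2, chdiv, div_eq_mul_inv, h.inv]; ring
  rw [this, Finset.sum_sub_distrib, sum_ch h.ne]; simp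

lemma inner_P (h : Quad φ) {A : MulChar F ℂ} (hA2 : A ^ 2 ≠ 1) (y : F) {P : F} (hP : P ≠ 0) :
    ∑ t, φ (t ^ 2 - P) * (A ^ 2) (1 - t) * (A ^ 2)⁻¹ (t - y * P) =
      ∑ w, (A ^ 2) w * φ ((1 + w * y * P) ^ 2 - P * (1 + w) ^ 2) - 1 := by
  have hm : (A ^ 2) (-1) = 1 := by rw [chpow, pow_two, chm1]
  by_cases hyP : y * P = 1
  · have h1 : ∀ t, φ (t ^ 2 - P) * (A ^ 2) (1 - t) * (A ^ 2)⁻¹ (t - y * P) =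
        φ (t ^ 2 - P) - if t = 1 then φ (1 - P) else 0 := by
      intro t
      rw [hyP]
      split_ifs with ht
      · subst ht; simp
      · have : 1 - t = -(t - 1) := by ring
        have h2 := chne (A ^ 2) (sub_ne_zero.2 ht)
        rw [this, chneg, hm, chinv]; field_simp; simp
    have h2 : ∀ w, (A ^ 2) w * φ ((1 + w * y * P) ^ 2 - P * (1 + w) ^ 2) =
        φ (1 - P) * ((A ^ 2) w - if w = -1 then 1 else 0) := by
      intro w
      have : (1 + w * y * P) ^ 2 - P * (1 + w) ^ 2 = (1 - P) * (1 + w) ^ 2 := by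
        rw [mul_assoc, hyP]; ring
      rw [this, map_mul]
      split_ifs with hw
      · subst hw; rw [hm]; simp
      · rw [h.sq1]
        · ring
        · intro e; apply hw; linear_combination e
    simp_rw [h1, h2]
    rw [Finset.sum_sub_distrib, sum_sq_sub h hP, ← Finset.mul_sum, Finset.sum_sub_distrib,
      sum_ch hA2]
    simp; ring
  · have hk : 1 - y * P ≠ 0 := sub_ne_zero.2 (Ne.symm hyP)
    have h1 : ∑ t, φ (t ^ 2 - P) * (A ^ 2) (1 - t) * (A ^ 2)⁻¹ (t - y * P) =
        ∑ w, ((A ^ 2) w * φ ((1 + w * y * P) ^ 2 - P * (1 + w) ^ 2) -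
          if w = -1 then 1 else 0) := by
      refine reindex _ _ (fun t => t - y * P ≠ 0) (fun w => 1 + w ≠ 0)
        (fun t => (1 - t) / (t - y * P))
        (fun w => (1 + w * y * P) / (1 + w)) ?_ ?_ ?_ ?_ ?_ ?_ ?_
      · intro t ht; simp only [not_not] at ht; rw [ht]; simp
      · intro w hw
        simp only [not_not] at hw
        have : w = -1 := by linear_combination hw
        subst this
        have e : (1 + -1 * y * P) ^ 2 - P * (1 + -1) ^ 2 = (1 - y * P) ^ 2 := by ring
        rw [hm, e, h.sq1 hk]; simp
      · intro t ht
        have : 1 + (1 - t) / (t - y * P) = (1 - y * P) / (t - y * P) := by field_simp; ring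
        simp only [this]; exact div_ne_zero hk ht
      · intro w hw
        have : (1 + w * y * P) / (1 + w) - y * P = (1 - y * P) / (1 + w) := by field_simp; ring
        simp only [this]; exact div_ne_zero hk hw
      · intro t ht
        have : 1 + (1 - t) / (t - y * P) = (1 - y * P) / (t - y * P) := by field_simp; ring
        simp only [this]; field_simp; ring
      · intro w hw
        have : (1 + w * y * P) / (1 + w) - y * P = (1 - y * P) / (1 + w) := by field_simp; ring
        simp only [this]; field_simp; ring
      · intro t ht
        have e1 : 1 + (1 - t) / (t - y * P) = (1 - y * P) / (t - y * P) := by field_simp; ring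
        have e2 : (1 - t) / (t - y * P) ≠ -1 := by
          intro e
          rw [e] at e1
          exact div_ne_zero hk ht (by rw [← e1]; ring)
        have e3 : (1 + (1 - t) / (t - y * P) * y * P) ^ 2 - P * (1 + (1 - t) / (t - y * P)) ^ 2 =
            (t ^ 2 - P) * ((1 - y * P) / (t - y * P)) ^ 2 := by
          rw [e1]; field_simp; ring
        rw [if_neg e2, e3, map_mul, h.sq1 (div_ne_zero hk ht), chdiv, chinv]
        ring
    rw [h1, Finset.sum_sub_distrib]; simp

lemma TT_WW (h : Quad φ) {A B : MulChar F ℂ} (hA2 : A ^ 2 ≠ 1) (hAB : A * B ≠ 1)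
    (hABφ : A * B⁻¹ * φ ≠ 1) (y : F) : TT φ A B y = WW φ A (A * B) y := by
  have hne : A⁻¹ * B * φ ≠ 1 := by
    intro e
    apply hABφ
    have h2 : φ⁻¹ = φ := by
      rw [inv_eq_iff_mul_eq_one, ← pow_two]; exact h.sq
    have : A * B⁻¹ * φ = (A⁻¹ * B * φ)⁻¹ := by
      rw [mul_inv, mul_inv, h2, inv_inv]
    rw [this, e, inv_one]
  have h1 : ∀ t, ∑ u, (A * B) u * φ (1 - u) *
      ((B ^ 2) t * (A ^ 2) (1 - t) * (A ^ 2)⁻¹ (1 - y * t * u)) =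
      ∑ P, (A * B) P * (φ (t ^ 2 - P) * (A ^ 2) (1 - t) * (A ^ 2)⁻¹ (t - y * P)) := by
    intro t
    by_cases ht : t = 0
    · subst ht
      have : ∀ P, (A * B) P * (φ (0 ^ 2 - P) * (A ^ 2) (1 - 0) * (A ^ 2)⁻¹ (0 - y * P)) =
          φ (-1) * (A ^ 2)⁻¹ (-y) * (A⁻¹ * B * φ) P := by
        intro P
        by_cases hP : P = 0
        · subst hP; simp
        have e1 : (0 : F) ^ 2 - P = -P := by ring
        have e2 : 0 - y * P = (-y) * P := by ring
        have := chne A hP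
        rw [e1, e2, chneg]
        simp only [MulChar.mul_apply, map_mul, chinv, chpow, sub_zero, ch1]
        field_simp
      simp_rw [this]
      rw [← Finset.mul_sum, sum_ch hne]
      simp
    · refine reindex _ _ (fun _ => True) (fun _ => True) (fun u => t ^ 2 * u)
        (fun P => P / t ^ 2) ?_ ?_ ?_ ?_ ?_ ?_ ?_
      · simp
      · simp
      · simp
      · simp
      · intro a _; field_simp
      · intro a _; field_simp
      · intro u _
        have e1 : t ^ 2 - t ^ 2 * u = t ^ 2 * (1 - u) := by ring
        have e2 : t - y * (t ^ 2 * u) = t * (1 - y * t * u) := by ring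
        simp only [e1, e2]
        rw [map_mul φ, h.sq1 ht]
        simp only [MulChar.mul_apply, map_mul, chinv, chpow, map_pow]
        have := chne A ht
        field_simp
  rw [TT]
  simp_rw [Finset.mul_sum]
  rw [Finset.sum_comm]
  simp_rw [h1]
  rw [Finset.sum_comm, WW]
  have h2 : ∀ P, ∑ t, (A * B) P * (φ (t ^ 2 - P) * (A ^ 2) (1 - t) * (A ^ 2)⁻¹ (t - y * P)) =
      (A * B) P * (∑ w, (A ^ 2) w * φ ((1 + w * y * P) ^ 2 - P * (1 + w) ^ 2)) - (A * B) P := by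
    intro P
    by_cases hP : P = 0
    · subst hP; simp
    rw [← Finset.mul_sum, inner_P h hA2 y hP]; ring
  simp_rw [h2]
  rw [Finset.sum_sub_distrib, sum_ch hAB, sub_zero]

lemma gs_inv {A : MulChar F ℂ} (hA : A ≠ 1) {ψ : AddChar F ℂ} (hψ : ψ ≠ 1) :
    gaussSum A ψ * gaussSum A⁻¹ ψ = A (-1) * (Fintype.card F : ℂ) := by
  have h1 := gaussSum_mul_gaussSum_eq_card hA (AddChar.IsPrimitive.of_ne_one hψ)
  have h2 := mul_gaussSum_inv_eq_gaussSum A⁻¹ ψ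
  rw [← h2, ← h1, chinv]
  rcases chm1_cases A with c | c <;> simp only [c] <;> norm_num

lemma HH_sq (h : Quad φ) {ψ : AddChar F ℂ} (hψ : ψ ≠ 1) {A B : MulChar F ℂ}
    (hA2 : A ^ 2 ≠ 1) (hB2 : B ^ 2 ≠ 1) (hABφ : A * B⁻¹ * φ ≠ 1)
    (hAB : A * B ≠ 1) {y z : F} (hy : y ≠ 0) (hz : z ≠ 0) (hyz : y = 1 - z ^ 2) :
    gaussSum A ψ * gaussSum (B * φ) ψ * HH φ A B y ^ 2 =
      gaussSum B ψ * gaussSum (A * φ) ψ * (φ (-1) * ((A * B * φ) y)⁻¹) *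
        (φ (-1) * (A * B * φ) y * TT φ A B y + Fintype.card F) := by
  have hφ2 : φ * φ = 1 := by rw [← pow_two]; exact h.sq
  have hφi : φ⁻¹ = φ := by rw [inv_eq_iff_mul_eq_one]; exact hφ2
  have hA : A ≠ 1 := by rintro rfl; simp at hA2
  have hB : B ≠ 1 := by rintro rfl; simp at hB2
  have hAφ : A * φ ≠ 1 := by
    intro e; apply hA2; have := congrArg (· ^ 2) e
    simpa [mul_pow, h.sq] using this
  have hBφ : B * φ ≠ 1 := by
    intro e; apply hB2; have := congrArg (· ^ 2) e
    simpa [mul_pow, h.sq] using this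
  have hA' : A⁻¹ * φ = (A * φ)⁻¹ := by rw [mul_inv, hφi]
  have hAB' : (A⁻¹ * φ) * (B⁻¹ * φ) = (A * B)⁻¹ := by
    rw [mul_mul_mul_comm, hφ2, mul_one, mul_inv]
  have hB' : (B⁻¹ * φ) * φ = B⁻¹ := by rw [mul_assoc, hφ2, mul_one]
  have P1 := PP_eq h ψ hA hAB hBφ hz
  have P2 := PP_eq h ψ (A := A⁻¹ * φ) (B := B⁻¹ * φ) (by rw [hA']; exact inv_ne_one.2 hAφ)
    (by rw [hAB']; exact inv_ne_one.2 hAB) (by rw [hB']; exact inv_ne_one.2 hB) hz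
  have hAD : A ^ 2 * ((A * B)⁻¹) ^ 2 ≠ 1 := by
    have : A ^ 2 * ((A * B)⁻¹) ^ 2 = (B ^ 2)⁻¹ := by
      rw [inv_pow, mul_pow, mul_inv, mul_inv_cancel_left]
    rw [this]; exact inv_ne_one.2 hB2
  have P3 := PP_mul h (D := (A * B)⁻¹) (inv_ne_one.2 hAB) hA2 hAD hz
  rw [hAB', hB', inv_inv] at P2
  rw [← hyz] at P1 P2 P3
  rw [W_eq h A (A * B) hy, ← TT_WW h hA2 hAB hABφ, inv_inv] at P3
  rw [← P3]
  have S := HH_symm h A B hy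
  rw [chinv] at S
  have g1 := gs_inv h.ne hψ
  rw [hφi] at g1
  have g2 := gs_inv hAB hψ
  have g3 := gs_inv hAφ hψ
  have g4 := gs_inv hB hψ
  rw [← hA'] at g3
  have hq := card_ne (F := F)
  have m1 : ∀ χ : MulChar F ℂ, χ (-1) ≠ 0 := fun χ => chne χ (by simp)
  rw [MulChar.mul_apply] at g2 g3
  generalize HH φ (A⁻¹ * φ) (B⁻¹ * φ) y = H' at *
  generalize PP A (A * B)⁻¹ z = p1 at *
  generalize PP (A⁻¹ * φ) (A * B) z = p2 at *
  have hK : (Fintype.card F : ℂ) ^ 2 * (A (-1) * B (-1) * φ (-1)) ≠ 0 := by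
    have := m1 A; have := m1 B; have := m1 φ
    positivity
  have S2 : HH φ A B y ^ 2 = HH φ A B y * (φ (-1) * ((A * B * φ) y)⁻¹ * H') := by
    rw [← S, pow_two]
  rw [S2]
  apply mul_left_cancel₀ hK
  generalize HH φ A B y = H at *
  generalize ((A * B * φ) y)⁻¹ = c at *
  generalize gaussSum A ψ = gA at *
  generalize gaussSum (B * φ) ψ = gBφ at *
  generalize gaussSum B ψ = gB at *
  generalize gaussSum (A * φ) ψ = gAφ at *
  generalize gaussSum φ ψ = gφ at *
  generalize gaussSum (A * B) ψ = gAB at *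
  generalize gaussSum (A * B)⁻¹ ψ = gAB' at *
  generalize gaussSum (A⁻¹ * φ) ψ = gA' at *
  generalize gaussSum B⁻¹ ψ = gB' at *
  calc _ = (B (-1) * Fintype.card F) * (A (-1) * φ (-1) * Fintype.card F) *
          (φ (-1) * c) * (gA * gBφ * H) * H' := by ring
    _ = gB * gAφ * (φ (-1) * c) * (gA * gBφ * H) * (gA' * gB' * H') := by
      rw [← g3, ← g4]; ring
    _ = gB * gAφ * (φ (-1) * c) * p1 * p2 * ((gφ * gφ) * (gAB * gAB')) := by
      rw [← P1, ← P2]; ring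
    _ = _ := by rw [g1, g2]; ring

end Clausen

/-- Finite field analogue of Clausen's identity (Theorem 1.4 of Tripathi–Barman):
`₂F₁(A,B;ABφ|4x(1-x))² = (AB(4)g(B)²g(Aφ)²/(q·g(A²)g(B²)))·₃F₂(A²,B²,AB;A²B²,ABφ|4x(1-x))
  + g(B)²g(Aφ)²·(AB)⁻¹φ(x-x²)/(q²·g(A²)g(B²))`. -/
theorem finite_field_clausen (hq : Odd (Fintype.card F)) (ψ : AddChar F ℂ) (hψ : ψ ≠ 1)
    (φ : MulChar F ℂ) (hφ : orderOf φ = 2) (A B : MulChar F ℂ)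
    (hA2 : A ^ 2 ≠ 1) (hB2 : B ^ 2 ≠ 1) (hABφ : A * B⁻¹ * φ ≠ 1)
    (hAB : A * B ≠ 1) (hABφ' : A * B * φ ≠ 1)
    (x : F) (hx1 : x ≠ 1) (hx2 : x ≠ (2 : F)⁻¹) :
    (greeneF21 A B (A * B * φ) (4 * x * (1 - x))) ^ 2 =
      (A * B) (4 : F) * (gaussSum B ψ) ^ 2 * (gaussSum (A * φ) ψ) ^ 2 /
          ((Fintype.card F : ℂ) * gaussSum (A ^ 2) ψ * gaussSum (B ^ 2) ψ) *
        greeneF32 (A ^ 2) (B ^ 2) (A * B) (A ^ 2 * B ^ 2) (A * B * φ) (4 * x * (1 - x)) +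
      (gaussSum B ψ) ^ 2 * (gaussSum (A * φ) ψ) ^ 2 * ((A * B)⁻¹ * φ) (x - x ^ 2) /
        ((Fintype.card F : ℂ) ^ 2 * gaussSum (A ^ 2) ψ * gaussSum (B ^ 2) ψ) := by
  have h := Clausen.Quad.of hq φ hφ
  by_cases hx0 : x = 0
  · subst hx0
    simp [greeneF21, greeneF32]
  have hx1' : 1 - x ≠ 0 := sub_ne_zero.2 (Ne.symm hx1)
  have hy : 4 * x * (1 - x) ≠ 0 := mul_ne_zero (mul_ne_zero h.four hx0) hx1'
  have hz : 1 - 2 * x ≠ 0 := by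
    intro e
    apply hx2
    exact eq_inv_of_mul_eq_one_left (by linear_combination -e)
  have hyz : 4 * x * (1 - x) = 1 - (1 - 2 * x) ^ 2 := by ring
  have key := Clausen.HH_sq h hψ hA2 hB2 hABφ hAB hy hz hyz
  have hA : A ≠ 1 := by rintro rfl; simp at hA2
  have hB : B ≠ 1 := by rintro rfl; simp at hB2
  have hBφ : B * φ ≠ 1 := by
    intro e; apply hB2; have := congrArg (· ^ 2) e
    simpa [mul_pow, h.sq] using this
  have d1 := Clausen.hasse_davenport h ψ hA
  have d2 := Clausen.hasse_davenport h ψ hB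
  have g1 := Clausen.gs_inv h.ne hψ
  have hφi : φ⁻¹ = φ := by rw [inv_eq_iff_mul_eq_one, ← pow_two]; exact h.sq
  rw [hφi] at g1
  have hq0 := Clausen.card_ne (F := F)
  have hprim := AddChar.IsPrimitive.of_ne_one hψ
  have n1 := gaussSum_ne_zero_of_nontrivial hq0 hA hprim
  have n2 := gaussSum_ne_zero_of_nontrivial hq0 hBφ hprim
  have n3 := gaussSum_ne_zero_of_nontrivial hq0 hA2 hprim
  have n4 := gaussSum_ne_zero_of_nontrivial hq0 hB2 hprim
  rw [Clausen.F21_HH h A B hy, Clausen.F32_TT h A B hy]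
  have e1 : ((A * B)⁻¹ * φ) (x - x ^ 2) = (A * B) 4 * ((A * B * φ) (4 * x * (1 - x)))⁻¹ := by
    have e : 4 * x * (1 - x) = 4 * (x - x ^ 2) := by ring
    have f4 : φ 4 = 1 := by
      have : (4 : F) = 2 ^ 2 := by norm_num
      rw [this, h.sq1 h.two]
    rw [e, map_mul (A * B * φ), MulChar.mul_apply (A * B) φ, MulChar.mul_apply (A * B) φ, f4,
      MulChar.mul_apply (A * B)⁻¹ φ, Clausen.chinv, mul_one, mul_inv, mul_inv, h.inv]
    have := Clausen.chne (A * B) h.four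
    field_simp
  rw [e1]
  have hC := Clausen.chne (A * B * φ) hy
  have hAB4 := Clausen.chne (A * B) h.four
  have k1 : (gaussSum A ψ * gaussSum (B * φ) ψ) * (gaussSum B ψ * gaussSum (A * φ) ψ) *
      (A * B) 4 = φ (-1) * Fintype.card F * (gaussSum (A ^ 2) ψ * gaussSum (B ^ 2) ψ) := by
    rw [← g1, MulChar.mul_apply]
    linear_combination (-gaussSum φ ψ * gaussSum (B ^ 2) ψ) * d1 -
      A 4 * gaussSum A ψ * gaussSum (A * φ) ψ * d2
  have hs : ((A * φ) (-1)) ^ 2 = 1 := by rw [pow_two, Clausen.chm1]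
  have hs2 : (φ (-1)) ^ 2 = 1 := by rw [pow_two, Clausen.chm1]
  rw [mul_pow, div_pow, hs]
  generalize (A * B * φ) (4 * x * (1 - x)) = C at *
  generalize Clausen.HH φ A B (4 * x * (1 - x)) = H at *
  generalize Clausen.TT φ A B (4 * x * (1 - x)) = T at *
  generalize (A * B) 4 = a at *
  generalize gaussSum A ψ = gA at *
  generalize gaussSum (B * φ) ψ = gBφ at *
  generalize gaussSum B ψ = gB at *
  generalize gaussSum (A * φ) ψ = gAφ at *
  generalize gaussSum (A ^ 2) ψ = gA2 at *
  generalize gaussSum (B ^ 2) ψ = gB2 at *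
  generalize φ (-1) = s at *
  generalize (Fintype.card F : ℂ) = Q at *
  have hs0 : s ≠ 0 := by rintro rfl; simp at hs2
  apply mul_left_cancel₀ (mul_ne_zero n1 n2)
  have L : gA * gBφ * (1 / Q ^ 2 * H ^ 2) =
      1 / Q ^ 2 * (gB * gAφ * (s * C⁻¹) * (s * C * T + Q)) := by rw [← key]; ring
  have R : gA * gBφ * (a * gB ^ 2 * gAφ ^ 2 / (Q * gA2 * gB2) * (s / Q ^ 2 * T) +
      gB ^ 2 * gAφ ^ 2 * (a * C⁻¹) / (Q ^ 2 * gA2 * gB2)) =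
      (gA * gBφ * (gB * gAφ) * a) * (gB * gAφ / (Q * gA2 * gB2) * (s / Q ^ 2 * T + C⁻¹ / Q)) := by
    field_simp
  rw [L, R, k1]
  field_simp
end

section
/- Let q ≡ 1 (mod 4), φ the quadratic character, χ₄ a fixed character of order 4 on F_q. For any multiplicative character A with A² ∉ {ε, φ, χ₄, χ₄⁻¹}: ₄F₃(A², A²φ, A²χ₄, A²χ₄⁻¹; A⁴φ, A⁴, φ | 1) equals -g(φ)/(q·g(A²χ₄)·g(A²⁻¹χ₄)) plus, if q ≡ 1 (mod 8), the term [2 + A⁻⁸(1+√2) + A⁻⁸(1-√2)]/(g(φ)·g(A²χ₄)·g(A²⁻¹χ₄)), and plus 0 if q ≡ 5 (mod 8). -/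
open Finset

variable {F : Type*} [Field F] [Fintype F] [DecidableEq F]

lemma gr_sum_char (a : F) :
    ∑ χ : MulChar F ℂ, χ a = if a = 1 then ((Fintype.card F : ℂ) - 1) else 0 := by
  split_ifs with ha
  · subst ha
    have h := MulChar.card_eq_card_units_of_hasEnoughRootsOfUnity F ℂ
    simp only [map_one, Finset.sum_const, Finset.card_univ, nsmul_eq_mul, mul_one,
      ← Nat.card_eq_fintype_card, h]
    rw [Nat.card_units, Nat.cast_sub Nat.card_pos]
    simp
  · obtain ⟨χ, hχ⟩ := MulChar.exists_apply_ne_one_of_hasEnoughRootsOfUnity F ℂ ha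
    refine eq_zero_of_mul_eq_self_left hχ ?_
    simp only [Finset.mul_sum, ← MulChar.mul_apply]
    exact Fintype.sum_bijective _ (Group.mulLeft_bijective χ) _ _ fun χ' ↦ rfl

lemma gr_phi_apply (hF : ringChar F ≠ 2) (φ : MulChar F ℂ) (hφ : orderOf φ = 2) (v : F) :
    φ v = (quadraticChar F v : ℂ) := by
  have hsq : φ ^ 2 = 1 := hφ ▸ pow_orderOf_eq_one φ
  have hne : φ ≠ 1 := by
    rintro rfl
    simp at hφ
  have key : ∀ w : F, w ≠ 0 → φ w ^ 2 = 1 := by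
    intro w hw
    rw [← MulChar.pow_apply' φ two_ne_zero, hsq, MulChar.one_apply hw.isUnit]
  by_cases hv : v = 0
  · subst hv; rw [MulChar.map_zero, MulChar.map_zero, Int.cast_zero]
  have h1 : ∀ w : F, w ≠ 0 → IsSquare w → φ w = 1 := by
    rintro w hw ⟨u, rfl⟩
    have hu : u ≠ 0 := by rintro rfl; simp at hw
    rw [map_mul, ← sq, key u hu]
  rcases quadraticChar_dichotomy hv with h | h
  · rw [h, h1 v hv ((quadraticChar_one_iff_isSquare hv).1 h)]; simp
  · obtain ⟨w, hw⟩ := MulChar.ne_one_iff.1 hne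
    have hw0 : (w : F) ≠ 0 := w.ne_zero
    have hw2 : φ w = -1 := (or_iff_not_imp_left.1 (sq_eq_sq_iff_eq_or_eq_neg.1 ((key _ hw0).trans (one_pow 2).symm))) hw
    have hwq : quadraticChar F (w : F) = -1 := by
      rcases quadraticChar_dichotomy hw0 with h' | h'
      · exact absurd (h1 _ hw0 ((quadraticChar_one_iff_isSquare hw0).1 h')) hw
      · exact h'
    have hvw : φ (v * w) = 1 := by
      apply h1 _ (mul_ne_zero hv hw0)
      apply (quadraticChar_one_iff_isSquare (mul_ne_zero hv hw0)).1
      rw [map_mul, h, hwq]; norm_num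
    rw [map_mul, hw2] at hvw
    rw [h]; push_cast; linear_combination -hvw

lemma gr_sum_sq (hF : ringChar F ≠ 2) (φ : MulChar F ℂ) (hφ : orderOf φ = 2) (h : F → ℂ) :
    ∑ u : F, h (u ^ 2) = ∑ v : F, h v * (1 + φ v) := by
  rw [← Finset.sum_fiberwise (s := univ) (g := fun u : F => u ^ 2)]
  refine Finset.sum_congr rfl fun v _ => ?_
  rw [Finset.sum_congr rfl (g := fun _ => h v)
    (fun u hu => by simp only [mem_filter] at hu; rw [hu.2])]
  have := quadraticChar_card_sqrts hF v
  have h2 : ({x : F | x ^ 2 = v}.toFinset) = univ.filter (fun u : F => u ^ 2 = v) := by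
    ext; simp
  rw [h2] at this
  rw [Finset.sum_const, nsmul_eq_mul, gr_phi_apply hF φ hφ]
  have h3 : ((#(univ.filter (fun u : F => u ^ 2 = v)) : ℤ) : ℂ) = quadraticChar F v + 1 := by
    rw [this]; push_cast; rfl
  push_cast at h3
  rw [h3]; ring

lemma gr_two_ne (hF : ringChar F ≠ 2) : (2 : F) ≠ 0 := Ring.two_ne_zero hF

lemma gr_jac_dup (hF : ringChar F ≠ 2) (φ : MulChar F ℂ) (hφ : orderOf φ = 2)
    (α : MulChar F ℂ) (hα : α ≠ 1) :
    jacobiSum α α = α⁻¹ 4 * jacobiSum α φ := by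
  have h2 := gr_two_ne hF
  have h4 : (4 : F) ≠ 0 := by
    have : (4 : F) = 2 * 2 := by norm_num
    rw [this]; exact mul_ne_zero h2 h2
  have e : ∑ v : F, α (1 - v) = 0 := by
    rw [← MulChar.sum_eq_zero_of_ne_one hα]
    exact (Equiv.subLeft (1 : F)).sum_comp (fun v => α v)
  have hs := gr_sum_sq hF φ hφ (fun v => α (1 - v))
  simp only [mul_add, mul_one, Finset.sum_add_distrib, e, zero_add] at hs
  rw [jacobiSum_comm α φ]
  have : jacobiSum φ α = ∑ u : F, α (1 - u ^ 2) := by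
    rw [hs, jacobiSum]; exact Finset.sum_congr rfl fun _ _ => mul_comm _ _
  rw [this, jacobiSum, Finset.mul_sum]
  let e' : F ≃ F := (Equiv.mulLeft₀ (2 : F) h2).trans (Equiv.subLeft 1)
  conv_rhs => rw [← e'.sum_comp]
  refine Finset.sum_congr rfl fun x _ => ?_
  have : 1 - (e' x) ^ 2 = 4 * (x * (1 - x)) := by
    rw [show e' x = 1 - 2 * x from rfl]; ring
  rw [this, map_mul α 4, ← mul_assoc, ← MulChar.mul_apply, inv_mul_cancel,
    MulChar.one_apply h4.isUnit, one_mul, map_mul]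

lemma gr_card_ne : (Fintype.card F : ℂ) ≠ 0 := by
  exact_mod_cast Fintype.card_ne_zero

lemma gr_gauss_ne (ψ : AddChar F ℂ) (hψ : ψ ≠ 1) (α : MulChar F ℂ) : gaussSum α ψ ≠ 0 := by
  by_cases h : α = 1
  · subst h; rw [gaussSum_one_left hψ]; norm_num
  · exact gaussSum_ne_zero_of_nontrivial gr_card_ne h (AddChar.IsPrimitive.of_ne_one hψ)

lemma gr_gauss_inv (ψ : AddChar F ℂ) (hψ : ψ ≠ 1) (α : MulChar F ℂ) (h : α ≠ 1) :
    gaussSum α ψ * gaussSum α⁻¹ ψ = α (-1) * Fintype.card F := by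
  rw [← gaussSum_mul_gaussSum_eq_card h (AddChar.IsPrimitive.of_ne_one hψ),
    ← mul_gaussSum_inv_eq_gaussSum α⁻¹ ψ]
  have : α⁻¹ (-1) = α (-1) := by rw [MulChar.inv_apply']; norm_num
  rw [this]; ring

lemma gr_HD (hF : ringChar F ≠ 2) (ψ : AddChar F ℂ) (hψ : ψ ≠ 1)
    (φ : MulChar F ℂ) (hφ : orderOf φ = 2) (α : MulChar F ℂ) :
    gaussSum α ψ * gaussSum (α * φ) ψ = α⁻¹ 4 * gaussSum (α ^ 2) ψ * gaussSum φ ψ := by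
  have h2 := gr_two_ne hF
  have h4 : (4 : F) = 2 ^ 2 := by norm_num
  have h4' : (4 : F) ≠ 0 := by rw [h4]; exact pow_ne_zero 2 h2
  have hsq : φ ^ 2 = 1 := hφ ▸ pow_orderOf_eq_one φ
  by_cases h1 : α = 1
  · subst h1
    simp [MulChar.one_apply h4'.isUnit]
  by_cases h3 : α * φ = 1
  · have : α = φ := by
      rw [eq_inv_of_mul_eq_one_left h3]
      exact (eq_inv_of_mul_eq_one_left (by rw [← sq, hsq])).symm
    subst this
    have : α⁻¹ 4 = 1 := by
      rw [h4, map_pow, ← MulChar.pow_apply' _ two_ne_zero, inv_pow, hsq, inv_one,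
        MulChar.one_apply h2.isUnit]
    rw [this, ← sq, hsq]; ring
  by_cases h5 : α ^ 2 = 1
  · exfalso
    -- an element of order two is unique
    have ho : orderOf α = 2 := orderOf_eq_prime h5 h1
    apply h3
    have : α = φ := by
      ext v
      rw [gr_phi_apply hF α ho, gr_phi_apply hF φ hφ]
    rw [this, ← sq, hsq]
  · have a := jacobiSum_mul_nontrivial (show α * α ≠ 1 by rwa [← sq]) ψ
    have b := jacobiSum_mul_nontrivial h3 ψ
    rw [gr_jac_dup hF φ hφ α h1, ← sq] at a
    have hg := gr_gauss_ne ψ hψ α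
    apply mul_left_cancel₀ hg
    linear_combination (-gaussSum (α * φ) ψ) * a + α⁻¹ 4 * gaussSum (α ^ 2) ψ * b

lemma gr_triple (ψ : AddChar F ℂ) (hψ : ψ ≠ 1) (α β : MulChar F ℂ)
    (hα : α (-1) = 1) (hβ : β (-1) = 1) (hnt : α ≠ 1 ∨ β ≠ 1) :
    gaussSum (α * β)⁻¹ ψ * gaussSum α ψ * gaussSum β ψ = Fintype.card F * jacobiSum α β := by
  by_cases h1 : α * β = 1
  · have hb : β = α⁻¹ := eq_inv_of_mul_eq_one_right h1
    have ha : α ≠ 1 := by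
      rintro rfl
      simp [hb] at hnt
    subst hb
    rw [h1, inv_one, gaussSum_one_left hψ, mul_assoc, gr_gauss_inv ψ hψ α ha,
      jacobiSum_nontrivial_inv ha, hα]; ring
  · rw [mul_assoc, ← jacobiSum_mul_nontrivial h1 ψ, ← mul_assoc,
      mul_comm (gaussSum (α * β)⁻¹ ψ), gr_gauss_inv ψ hψ _ h1, MulChar.mul_apply, hα, hβ]
    ring

lemma gr_binom (ψ : AddChar F ℂ) (hψ : ψ ≠ 1) (A B C : MulChar F ℂ) (hC : A * B⁻¹ = C)
    (h : C ≠ 1) :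
    greeneBinom A B =
      B (-1) / Fintype.card F * (gaussSum A ψ * gaussSum B⁻¹ ψ / gaussSum C ψ) := by
  subst hC
  rw [← jacobiSum_eq_gaussSum_mul_gaussSum_div_gaussSum gr_card_ne h
    (AddChar.IsPrimitive.of_ne_one hψ)]
  rfl

lemma gr_inv_val (α : MulChar F ℂ) (x : F) : α⁻¹ x = (α x)⁻¹ := by
  rw [MulChar.inv_apply_eq_inv']

lemma gr_val_ne (α : MulChar F ℂ) {x : F} (hx : x ≠ 0) : α x ≠ 0 :=
  (hx.isUnit.map α).ne_zero

lemma gr_term (hF : ringChar F ≠ 2) (ψ : AddChar F ℂ) (hψ : ψ ≠ 1)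
    (φ : MulChar F ℂ) (hφ : orderOf φ = 2) (χ₄ : MulChar F ℂ) (h42 : χ₄ ^ 2 = φ)
    (B : MulChar F ℂ) (hB : B (-1) = 1) (hB4 : B ^ 4 ≠ 1) (χ : MulChar F ℂ) :
    greeneBinom (B * χ) χ * greeneBinom (B * φ * χ) (B ^ 2 * φ * χ) *
      greeneBinom (B * χ₄ * χ) (B ^ 2 * χ) * greeneBinom (B * χ₄⁻¹ * χ) (φ * χ) =
    (gaussSum φ ψ / ((Fintype.card F : ℂ) ^ 2 * gaussSum (B * χ₄) ψ * gaussSum (B⁻¹ * χ₄) ψ) *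
      χ₄⁻¹ 4 * B⁻¹ 16) *
      (χ⁻¹ 16 * jacobiSum (χ⁻¹ ^ 2) (B⁻¹ ^ 4 * χ⁻¹ ^ 2)) := by
  have h2 := gr_two_ne hF
  have h4 : (4 : F) = 2 ^ 2 := by norm_num
  have h4' : (4 : F) ≠ 0 := by rw [h4]; exact pow_ne_zero 2 h2
  have h16 : (16 : F) = 4 ^ 2 := by norm_num
  have hφ2 : φ ^ 2 = 1 := hφ ▸ pow_orderOf_eq_one φ
  have hφi : φ⁻¹ = φ := inv_eq_of_mul_eq_one_left (by rw [← sq, hφ2])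
  have h44 : χ₄ ^ 4 = 1 := by rw [show 4 = 2 * 2 from rfl, pow_mul, h42, hφ2]
  have h4i : χ₄⁻¹ = χ₄ * φ := by
    apply inv_eq_of_mul_eq_one_right
    rw [← h42, ← h44, ← mul_assoc, ← sq, ← pow_add]
  have hφ1 : φ ≠ 1 := by rintro rfl; simp at hφ
  have hneg : ∀ α : MulChar F ℂ, (α ^ 2) (-1) = 1 := by
    intro α
    rw [MulChar.pow_apply' _ two_ne_zero, ← map_pow]; simp
  have hφneg : φ (-1) = 1 := by rw [← h42, hneg]
  have hgφ : gaussSum φ ψ ^ 2 = Fintype.card F := by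
    have := gr_gauss_inv ψ hψ φ hφ1
    rw [hφi, hφneg] at this
    rw [sq, this, one_mul]
  have hB1 : B ≠ 1 := by rintro rfl; simp at hB4
  have hBχ : B * χ₄ ≠ 1 := by
    intro h
    apply hB4
    have : (B * χ₄) ^ 4 = 1 := by rw [h, one_pow]
    rwa [mul_pow, h44, mul_one] at this
  have hBiχ : B⁻¹ * χ₄ ≠ 1 := by
    intro h
    apply hB4
    have : (B⁻¹ * χ₄) ^ 4 = 1 := by rw [h, one_pow]
    rwa [mul_pow, h44, mul_one, inv_pow, inv_eq_one] at this
  have hBi1 : B⁻¹ ≠ 1 := by rwa [Ne, inv_eq_one]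
  have hgB := gr_gauss_inv ψ hψ B hB1
  rw [hB, one_mul] at hgB
  rw [gr_binom ψ hψ (B * χ) χ B (by group) hB1,
    gr_binom ψ hψ (B * φ * χ) (B ^ 2 * φ * χ) B⁻¹
      (by rw [mul_inv_eq_iff_eq_mul, sq]; simp only [← mul_assoc, inv_mul_cancel, one_mul]) hBi1,
    gr_binom ψ hψ (B * χ₄ * χ) (B ^ 2 * χ) (B⁻¹ * χ₄)
      (by rw [mul_inv_eq_iff_eq_mul, sq, inv_mul_eq_div, ← mul_left_inj B, eq_comm,
            mul_right_comm, div_mul_cancel]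
          simp only [mul_comm, mul_left_comm]) hBiχ,
    gr_binom ψ hψ (B * χ₄⁻¹ * χ) (φ * χ) (B * χ₄)
      (by rw [mul_inv_eq_iff_eq_mul, h4i]; simp only [mul_assoc]) hBχ]
  have d1 := gr_HD hF ψ hψ φ hφ (B * χ)
  have d2 := gr_HD hF ψ hψ φ hφ (B * χ₄ * χ)
  have d3 := gr_HD hF ψ hψ φ hφ ((B * χ) ^ 2)
  have d4 := gr_HD hF ψ hψ φ hφ χ⁻¹
  have d5 := gr_HD hF ψ hψ φ hφ (B⁻¹ ^ 2 * χ⁻¹)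
  have d6 := gr_triple ψ hψ (χ⁻¹ ^ 2) (B⁻¹ ^ 4 * χ⁻¹ ^ 2) (hneg _)
    (by rw [MulChar.mul_apply, hneg, show 4 = 2 * 2 from rfl, pow_mul, hneg, one_mul])
    (by
      by_contra! h
      rw [h.1, mul_one, inv_pow, inv_eq_one] at h
      exact hB4 h.2)
  have e1 : B * χ * φ = B * φ * χ := by rw [mul_right_comm]
  have e2 : B * χ₄ * χ * φ = B * χ₄⁻¹ * χ := by rw [h4i]; simp only [mul_assoc, mul_comm φ]
  have e2' : (B * χ₄ * χ) ^ 2 = (B * χ) ^ 2 * φ := by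
    rw [← h42]; simp only [mul_pow]; rw [mul_right_comm]
  have e3 : (B * χ) ^ 2 * φ = (B * χ) ^ 2 * φ := rfl
  have e4 : χ⁻¹ * φ = (φ * χ)⁻¹ := by rw [mul_inv, hφi, mul_comm]
  have e5 : B⁻¹ ^ 2 * χ⁻¹ * φ = (B ^ 2 * φ * χ)⁻¹ := by
    rw [mul_inv, mul_inv, hφi, inv_pow, mul_right_comm]
  have e5a : B⁻¹ ^ 2 * χ⁻¹ = (B ^ 2 * χ)⁻¹ := by rw [mul_inv, inv_pow]
  have e5' : (B⁻¹ ^ 2 * χ⁻¹) ^ 2 = B⁻¹ ^ 4 * χ⁻¹ ^ 2 := by rw [mul_pow, ← pow_mul]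
  have e6 : (χ⁻¹ ^ 2 * (B⁻¹ ^ 4 * χ⁻¹ ^ 2))⁻¹ = ((B * χ) ^ 2) ^ 2 := by
    simp only [inv_pow, mul_inv, inv_inv, mul_pow, ← pow_mul]
    rw [mul_left_comm, ← pow_add]
  rw [e1] at d1
  rw [e2, e2'] at d2
  rw [e4] at d4
  rw [e5', e5, e5a] at d5
  rw [e6] at d6
  have hq := gr_card_ne (F := F)
  have hb := gr_val_ne B h4'
  have hx := gr_val_ne χ h4'
  have hw := gr_val_ne χ₄ h4'
  have hBi := gr_gauss_ne ψ hψ B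
  have hBi' := gr_gauss_ne ψ hψ B⁻¹
  have hD1 := gr_gauss_ne ψ hψ (B * χ₄)
  have hD2 := gr_gauss_ne ψ hψ (B⁻¹ * χ₄)
  have hs : ∀ α : MulChar F ℂ, (α ^ 2) 4 = α 4 ^ 2 := fun α =>
    MulChar.pow_apply' _ two_ne_zero _
  have hxn : χ (-1) ^ 2 = 1 := by rw [← map_pow]; simp
  simp only [gr_inv_val, MulChar.mul_apply, hs, inv_inv] at d1 d2 d3 d4 d5
  simp only [gr_inv_val, MulChar.mul_apply, hneg, hφneg, h16, map_pow, hs]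
  generalize gaussSum (B * χ) ψ = G1 at *
  generalize gaussSum (B * φ * χ) ψ = G2 at *
  generalize gaussSum (B * χ₄ * χ) ψ = G3 at *
  generalize gaussSum (B * χ₄⁻¹ * χ) ψ = G4 at *
  generalize gaussSum χ⁻¹ ψ = H1 at *
  generalize gaussSum (B ^ 2 * φ * χ)⁻¹ ψ = H2 at *
  generalize gaussSum (B ^ 2 * χ)⁻¹ ψ = H3 at *
  generalize gaussSum (φ * χ)⁻¹ ψ = H4 at *
  generalize gaussSum ((B * χ) ^ 2) ψ = P1 at *
  generalize gaussSum ((B * χ) ^ 2 * φ) ψ = P2 at *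
  generalize gaussSum (((B * χ) ^ 2) ^ 2) ψ = P3 at *
  generalize gaussSum (χ⁻¹ ^ 2) ψ = P4 at *
  generalize gaussSum (B⁻¹ ^ 4 * χ⁻¹ ^ 2) ψ = P5 at *
  generalize jacobiSum (χ⁻¹ ^ 2) (B⁻¹ ^ 4 * χ⁻¹ ^ 2) = J at *
  generalize gaussSum φ ψ = gφ at *
  generalize gaussSum B ψ = gB at *
  generalize gaussSum B⁻¹ ψ = gBi at *
  generalize gaussSum (B * χ₄) ψ = D1 at *
  generalize gaussSum (B⁻¹ * χ₄) ψ = D2 at *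
  generalize B 4 = b at *
  generalize χ 4 = x at *
  generalize χ₄ 4 = w at *
  generalize (Fintype.card F : ℂ) = q at *
  have hxn4 : χ (-1) ^ 4 = 1 := by rw [show 4 = 2 * 2 from rfl, pow_mul, hxn, one_pow]
  generalize χ (-1) = n at *
  have big : (G1 * G2) * (G3 * G4) * (H1 * H4) * (H3 * H2) =
      q ^ 3 * gφ * w⁻¹ * (b⁻¹) ^ 2 * ((x⁻¹) ^ 2) * J := by
    rw [d1, d2, d4, d5]
    calc _ = (P1 * P2) * P4 * P5 * gφ ^ 4 * ((b * x)⁻¹ * (b * w * x)⁻¹ * x * (b ^ 2 * x)) := by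
            ring
      _ = (P3 * P4 * P5) * (gφ ^ 2) ^ 2 * gφ *
            (((b * x) ^ 2)⁻¹ * (b * x)⁻¹ * (b * w * x)⁻¹ * x * (b ^ 2 * x)) := by
            rw [d3]; ring
      _ = _ := by rw [d6, hgφ]; field_simp
  calc _ = n ^ 4 * ((G1 * G2) * (G3 * G4) * (H1 * H4) * (H3 * H2)) /
        (q ^ 4 * (gB * gBi) * D1 * D2) := by field_simp
    _ = _ := by rw [big, hgB, hxn4]; field_simp

lemma gr_charsum (hF : ringChar F ≠ 2) (B : MulChar F ℂ) :
    B⁻¹ 16 * ∑ χ : MulChar F ℂ, χ⁻¹ 16 * jacobiSum (χ⁻¹ ^ 2) (B⁻¹ ^ 4 * χ⁻¹ ^ 2) =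
      ((Fintype.card F : ℂ) - 1) *
        ∑ y : F, if (y * (2 - y)) ^ 2 = 1 then (B ^ 4)⁻¹ y else 0 := by
  have h2 := gr_two_ne hF
  simp only [jacobiSum, Finset.mul_sum]
  rw [Finset.sum_comm]
  let e' : F ≃ F := (Equiv.subLeft 1).trans (Equiv.mulLeft₀ (2 : F) h2)
  have he' : ∀ x, e' x = 2 * (1 - x) := fun x => rfl
  conv_rhs => rw [← e'.sum_comp]
  refine Finset.sum_congr rfl fun x _ => ?_
  have key : ∀ χ : MulChar F ℂ,
      B⁻¹ 16 * (χ⁻¹ 16 * ((χ⁻¹ ^ 2) x * (B⁻¹ ^ 4 * χ⁻¹ ^ 2) (1 - x))) =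
      (B ^ 4)⁻¹ (e' x) * χ (((e' x * (2 - e' x)) ^ 2)⁻¹) := by
    intro χ
    have e1 : (e' x * (2 - e' x)) ^ 2 = 16 * x ^ 2 * (1 - x) ^ 2 := by rw [he']; ring
    rw [e1, he', ← MulChar.inv_apply', ← inv_pow]
    simp only [MulChar.mul_apply, map_mul, map_pow, MulChar.pow_apply' _ two_ne_zero,
      MulChar.pow_apply' _ four_ne_zero]
    rw [show (16 : F) = 2 ^ 4 by norm_num, map_pow B⁻¹]
    ring
  rw [Finset.sum_congr rfl fun χ _ => key χ, ← Finset.mul_sum, gr_sum_char]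
  by_cases h : (e' x * (2 - e' x)) ^ 2 = 1
  · simp [h, mul_comm]
  · have : ((e' x * (2 - e' x)) ^ 2)⁻¹ ≠ 1 := by rwa [Ne, inv_eq_one]
    rw [if_neg this, if_neg h]; simp

lemma gr_cond (y : F) : (y * (2 - y)) ^ 2 = 1 ↔ y = 1 ∨ (y - 1) ^ 2 = 2 := by
  have : (y * (2 - y)) ^ 2 - 1 = (y - 1) ^ 2 * ((y - 1) ^ 2 - 2) := by ring
  rw [← sub_eq_zero, this, mul_eq_zero, pow_eq_zero_iff two_ne_zero, sub_eq_zero, sub_eq_zero]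

lemma gr_sum_nonsq (E : MulChar F ℂ) (h : ¬ IsSquare (2 : F)) :
    (∑ y : F, if (y * (2 - y)) ^ 2 = 1 then E y else 0) = 1 := by
  rw [Finset.sum_eq_single 1]
  · rw [if_pos ((gr_cond 1).2 (Or.inl rfl)), map_one]
  · intro y _ hy
    rw [if_neg]
    rw [gr_cond]
    rintro (h' | h')
    · exact hy h'
    · exact h ⟨y - 1, by rw [← sq, h']⟩
  · simp

lemma gr_sum_sqrt (hF : ringChar F ≠ 2) (E : MulChar F ℂ) (s : F) (hs : s ^ 2 = 2) :
    (∑ y : F, if (y * (2 - y)) ^ 2 = 1 then E y else 0) = 1 + E (1 + s) + E (1 - s) := by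
  have h2 := gr_two_ne hF
  have hs0 : s ≠ 0 := by rintro rfl; apply h2; rw [← hs]; simp
  rw [← Finset.sum_filter]
  have : univ.filter (fun y : F => (y * (2 - y)) ^ 2 = 1) = {1, 1 + s, 1 - s} := by
    ext y
    simp only [mem_filter, mem_univ, true_and, gr_cond, mem_insert, mem_singleton]
    rw [← hs, sq_eq_sq_iff_eq_or_eq_neg, sub_eq_iff_eq_add, sub_eq_iff_eq_add, add_comm s,
      neg_add_eq_sub]
  rw [this, Finset.sum_insert, Finset.sum_insert, Finset.sum_singleton, map_one, add_assoc]
  · rw [mem_singleton]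
    intro h
    have : 2 * s = 0 := by linear_combination h
    exact (mul_ne_zero h2 hs0) this
  · simp only [mem_insert, mem_singleton, not_or]
    exact ⟨fun h => hs0 (by linear_combination -h), fun h => hs0 (by linear_combination h)⟩

lemma gr_main (hF : ringChar F ≠ 2) (ψ : AddChar F ℂ) (hψ : ψ ≠ 1)
    (φ : MulChar F ℂ) (hφ : orderOf φ = 2) (χ₄ : MulChar F ℂ) (h42 : χ₄ ^ 2 = φ)
    (A : MulChar F ℂ) (hA : A ^ 8 ≠ 1) :
    greeneF43 (A ^ 2) (A ^ 2 * φ) (A ^ 2 * χ₄) (A ^ 2 * χ₄⁻¹) (A ^ 4 * φ) (A ^ 4) φ 1 =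
      gaussSum φ ψ / ((Fintype.card F : ℂ) * gaussSum (A ^ 2 * χ₄) ψ *
        gaussSum ((A ^ 2)⁻¹ * χ₄) ψ) * φ 2 *
        ∑ y : F, if (y * (2 - y)) ^ 2 = 1 then (A ^ 8)⁻¹ y else 0 := by
  have h2 := gr_two_ne hF
  have hB : (A ^ 2) (-1) = 1 := by
    rw [MulChar.pow_apply' _ two_ne_zero, ← map_pow]; simp
  have e4 : A ^ 4 = (A ^ 2) ^ 2 := by rw [← pow_mul]
  have e8 : A ^ 8 = (A ^ 2) ^ 4 := by rw [← pow_mul]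
  rw [e4, e8]
  rw [e8] at hA
  generalize A ^ 2 = B at *
  unfold greeneF43
  simp only [map_one, mul_one]
  rw [Finset.sum_congr rfl fun χ _ => gr_term hF ψ hψ φ hφ χ₄ h42 B hB hA χ, ← Finset.mul_sum]
  have hw : χ₄⁻¹ 4 = φ 2 := by
    have hφ2 : φ ^ 2 = 1 := hφ ▸ pow_orderOf_eq_one φ
    have hφi : φ⁻¹ = φ := inv_eq_of_mul_eq_one_left (by rw [← sq, hφ2])
    rw [show (4 : F) = 2 ^ 2 by norm_num, map_pow, ← MulChar.pow_apply' _ two_ne_zero, inv_pow,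
      h42, hφi]
  have hc := gr_charsum hF B
  have hq := gr_card_ne (F := F)
  have hq1 : (Fintype.card F : ℂ) - 1 ≠ 0 := by
    rw [sub_ne_zero]
    exact_mod_cast (Fintype.one_lt_card (α := F)).ne'
  have hD1 := gr_gauss_ne ψ hψ (B * χ₄)
  have hD2 := gr_gauss_ne ψ hψ (B⁻¹ * χ₄)
  rw [hw, mul_assoc _ (B⁻¹ 16), hc]
  field_simp

/-- Special value of a `₄F₃` at `1` (Corollary 1.8 of Tripathi–Barman). -/
theorem greeneF43_value_at_one (ψ : AddChar F ℂ) (hψ : ψ ≠ 1)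
    (hq4 : Fintype.card F % 4 = 1) (φ : MulChar F ℂ) (hφ : orderOf φ = 2)
    (χ₄ : MulChar F ℂ) (hχ₄ : orderOf χ₄ = 4) (A : MulChar F ℂ)
    (h1 : A ^ 2 ≠ 1) (h2 : A ^ 2 ≠ φ) (h3 : A ^ 2 ≠ χ₄) (h4 : A ^ 2 ≠ χ₄⁻¹) :
    (Fintype.card F % 8 = 5 →
      greeneF43 (A ^ 2) (A ^ 2 * φ) (A ^ 2 * χ₄) (A ^ 2 * χ₄⁻¹) (A ^ 4 * φ) (A ^ 4) φ 1 =
        -gaussSum φ ψ /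
          ((Fintype.card F : ℂ) * gaussSum (A ^ 2 * χ₄) ψ * gaussSum ((A ^ 2)⁻¹ * χ₄) ψ)) ∧
    (Fintype.card F % 8 = 1 → ∀ s : F, s ^ 2 = 2 →
      greeneF43 (A ^ 2) (A ^ 2 * φ) (A ^ 2 * χ₄) (A ^ 2 * χ₄⁻¹) (A ^ 4 * φ) (A ^ 4) φ 1 =
        -gaussSum φ ψ /
          ((Fintype.card F : ℂ) * gaussSum (A ^ 2 * χ₄) ψ * gaussSum ((A ^ 2)⁻¹ * χ₄) ψ) +
        (2 + (A ^ 8)⁻¹ (1 + s) + (A ^ 8)⁻¹ (1 - s)) /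
          (gaussSum φ ψ * gaussSum (A ^ 2 * χ₄) ψ * gaussSum ((A ^ 2)⁻¹ * χ₄) ψ)) := by
  have hF : ringChar F ≠ 2 := by
    intro h
    have := FiniteField.even_card_of_char_two h
    omega
  have h2_ne := gr_two_ne hF
  have h44 : χ₄ ^ 4 = 1 := hχ₄ ▸ pow_orderOf_eq_one χ₄
  have ho : orderOf (χ₄ ^ 2) = 2 := by
    rw [orderOf_pow, hχ₄]; rfl
  have h42 : χ₄ ^ 2 = φ := by
    ext v
    rw [gr_phi_apply hF _ ho, gr_phi_apply hF φ hφ]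
  have hφ2 : φ ^ 2 = 1 := hφ ▸ pow_orderOf_eq_one φ
  have hφi : φ⁻¹ = φ := inv_eq_of_mul_eq_one_left (by rw [← sq, hφ2])
  have hφ1 : φ ≠ 1 := by rintro rfl; simp at hφ
  -- elements of square one are `1` or `φ`
  have two : ∀ α : MulChar F ℂ, α ^ 2 = 1 → α = 1 ∨ α = φ := by
    intro α hα
    by_cases h : α = 1
    · exact Or.inl h
    · right
      have hoα : orderOf α = 2 := orderOf_eq_prime hα h
      ext v
      rw [gr_phi_apply hF _ hoα, gr_phi_apply hF φ hφ]
  have hA : A ^ 8 ≠ 1 := by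
    intro h8
    have e : ((A ^ 2) ^ 2) ^ 2 = 1 := by rw [← pow_mul, ← pow_mul]; exact h8
    rcases two _ e with h | h
    · rcases two _ h with h | h
      · exact h1 h
      · exact h2 h
    · have : (A ^ 2 * χ₄) ^ 2 = 1 := by rw [mul_pow, h, h42, ← sq, hφ2]
      rcases two _ this with h | h
      · exact h4 (eq_inv_of_mul_eq_one_left h)
      · apply h3
        rw [← h42, sq χ₄] at h
        exact mul_right_cancel h
  have hm := gr_main hF ψ hψ φ hφ χ₄ h42 A hA
  have hgφ : gaussSum φ ψ ^ 2 = Fintype.card F := by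
    have := gr_gauss_inv ψ hψ φ hφ1
    have hφneg : φ (-1) = 1 := by
      rw [← h42, MulChar.pow_apply' _ two_ne_zero, ← map_pow]; simp
    rw [hφi, hφneg] at this
    rw [sq, this, one_mul]
  have hq := gr_card_ne (F := F)
  have hg := gr_gauss_ne ψ hψ φ
  have hD1 := gr_gauss_ne ψ hψ (A ^ 2 * χ₄)
  have hD2 := gr_gauss_ne ψ hψ ((A ^ 2)⁻¹ * χ₄)
  constructor
  · intro h8
    have hns : ¬ IsSquare (2 : F) := by
      rw [FiniteField.isSquare_two_iff]; omega
    have hφ2v : φ 2 = -1 := by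
      rw [gr_phi_apply hF φ hφ, quadraticChar_neg_one_iff_not_isSquare.2 hns]; simp
    rw [hm, gr_sum_nonsq _ hns, hφ2v]; ring
  · intro h8 s hs
    have hφ2v : φ 2 = 1 := by
      rw [gr_phi_apply hF φ hφ,
        (quadraticChar_one_iff_isSquare h2_ne).2 ⟨s, by rw [← sq, hs]⟩]; simp
    rw [hm, gr_sum_sqrt hF _ s hs, hφ2v, ← hgφ]
    field_simp
    ring
end

section
/- Suppose C is a multiplicative character on F_q whose order is not 1, 2, or 4, and q ≡ 1 (mod 8). Then ₃F₂(φ, C²φ, Cφ; C², C | -1) equals 1/q if C·χ₄ is not a square of a character, and equals 1/q + (2/q²)·Re(J(D,φ)·J(D̄χ₄, φ)) if C·χ₄ = D² for some character D. -/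
open Finset

variable {F : Type*} [Field F] [Fintype F] [DecidableEq F]

set_option linter.unusedSectionVars false

lemma quad_unique (hF : ringChar F ≠ 2) (φ : MulChar F ℂ) (hφ : orderOf φ = 2) (a : F) :
    φ a = ((quadraticChar F a : ℤ) : ℂ) := by
  have key : φ = (quadraticChar F).ringHomComp (Int.castRingHom ℂ) := by
    obtain ⟨g, hg⟩ := IsCyclic.exists_generator (α := Fˣ)
    have aux : ∀ ψ : MulChar F ℂ, ψ ^ 2 = 1 → ψ ≠ 1 → ψ g = -1 := by
      intro ψ h2 h1
      have : (ψ g) ^ 2 = 1 := by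
        rw [← MulChar.pow_apply_coe, h2, MulChar.one_apply_coe]
      rcases sq_eq_one_iff.mp this with h | h
      · exact absurd ((MulChar.eq_iff hg ψ 1).mpr (by rw [h, MulChar.one_apply_coe])) h1
      · exact h
    rw [MulChar.eq_iff hg, aux φ (by rw [← hφ, pow_orderOf_eq_one]) (by
      intro h; rw [h, orderOf_one] at hφ; omega), aux]
    · ext a
      simp only [MulChar.pow_apply_coe, MulChar.ringHomComp_apply, MulChar.one_apply_coe]
      rw [← map_pow, quadraticChar_sq_one a.ne_zero, map_one]
    · rw [MulChar.ringHomComp_ne_one_iff (RingHom.injective_int _)]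
      exact quadraticChar_ne_one hF
  rw [key]; rfl

lemma sum_sq (hF : ringChar F ≠ 2) (φ : MulChar F ℂ) (hφ : orderOf φ = 2) (h : F → ℂ) :
    ∑ y, h (y ^ 2) = ∑ r, (1 + φ r) * h r := by
  rw [← Finset.sum_fiberwise (s := univ) (g := fun y : F => y ^ 2)]
  refine Finset.sum_congr rfl fun r _ => ?_
  have h1 := quadraticChar_card_sqrts hF r
  have h2 : ({x : F | x ^ 2 = r}.toFinset) = ({x : F | x ^ 2 = r} : Finset F) := by
    ext; simp
  rw [h2] at h1
  rw [Finset.sum_congr rfl (g := fun _ => h r), Finset.sum_const, nsmul_eq_mul]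
  · congr 1
    rw [quad_unique hF φ hφ, add_comm]
    exact_mod_cast h1
  · intro x hx
    simp at hx; rw [hx]

lemma sum_scale (f : F → ℂ) {a : F} (ha : a ≠ 0) : ∑ x, f x = ∑ x, f (a * x) :=
  (Equiv.sum_comp (Equiv.mulLeft₀ a ha) f).symm

lemma sum_inv' (f : F → ℂ) : ∑ x, f x = ∑ x, f x⁻¹ :=
  (Equiv.sum_comp (Equiv.inv F) f).symm

lemma sum_shift (f : F → ℂ) (a : F) : ∑ x, f x = ∑ x, f (x + a) :=
  (Equiv.sum_comp (Equiv.addRight a) f).symm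

lemma sum_negg (f : F → ℂ) : ∑ x, f x = ∑ x, f (-x) :=
  (Equiv.sum_comp (Equiv.neg F) f).symm

lemma quad_congr {φ : MulChar F ℂ} (hφ : orderOf φ = 2) {x y : F} (a : F) (ha : a ≠ 0)
    (h : x = a ^ 2 * y) : φ x = φ y := by
  have h2 : φ a ^ 2 = 1 := by
    rw [← MulChar.pow_apply' φ (by norm_num), ← hφ, pow_orderOf_eq_one,
      MulChar.one_apply (isUnit_iff_ne_zero.mpr ha)]
  rw [h, map_mul, map_pow, h2, one_mul]

lemma neg_one_pow4 (hq8 : Fintype.card F % 8 = 1) : ∃ j : F, j ≠ 0 ∧ j ^ 4 = -1 := by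
  have hF : ringChar F ≠ 2 := by
    intro h
    have := FiniteField.even_card_of_char_two h
    omega
  obtain ⟨g, hg⟩ := IsCyclic.exists_generator (α := Fˣ)
  have hc : orderOf g = Fintype.card F - 1 := by
    rw [orderOf_eq_card_of_forall_mem_zpowers hg, Nat.card_eq_fintype_card, Fintype.card_units]
  refine ⟨((g ^ (Fintype.card F / 8) : Fˣ) : F), Units.ne_zero _, ?_⟩
  have hlt : 1 < Fintype.card F := Fintype.one_lt_card
  have h2 : (((g ^ (Fintype.card F / 8) : Fˣ) : F) ^ 4) ^ 2 = 1 := by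
    rw [← Units.val_pow_eq_pow_val, ← Units.val_pow_eq_pow_val, ← pow_mul, ← pow_mul,
      show Fintype.card F / 8 * (4 * 2) = orderOf g by omega, pow_orderOf_eq_one, Units.val_one]
  rcases sq_eq_one_iff.mp h2 with h | h
  · exfalso
    have h3 : g ^ (Fintype.card F / 8 * 4) = 1 := by
      ext; rw [pow_mul]; simpa using h
    have := orderOf_dvd_of_pow_eq_one h3
    have := Nat.le_of_dvd (by omega) this
    omega
  · exact h

/-- quadratic change of variables `s = 1/u + t u`. -/
lemma sum_joukowski (hF : ringChar F ≠ 2) (φ : MulChar F ℂ) (hφ : orderOf φ = 2) (G : F → ℂ)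
    {t : F} (ht : t ≠ 0) :
    ∑ u, (if u = 0 then 0 else G (u⁻¹ + t * u)) = ∑ s, G s * (1 + φ (s ^ 2 - 4 * t)) := by
  have h2 : (2 : F) ≠ 0 := Ring.two_ne_zero hF
  have hcount : ∀ s : F, (1 + φ (s ^ 2 - 4 * t)) =
      ∑ u : F, if t * u ^ 2 - s * u + 1 = 0 then 1 else 0 := by
    intro s
    have h := sum_sq hF φ hφ (fun r => if r = s ^ 2 - 4 * t then 1 else 0)
    simp only [mul_ite, mul_one, mul_zero, Finset.sum_ite_eq', Finset.mem_univ, if_true] at h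
    rw [← h, sum_shift _ (-s), sum_scale _ (mul_ne_zero h2 ht)]
    refine Finset.sum_congr rfl fun u _ => ?_
    have : (2 * t * u + -s) ^ 2 = s ^ 2 - 4 * t ↔ t * u ^ 2 - s * u + 1 = 0 := by
      rw [← sub_eq_zero, show (2 * t * u + -s) ^ 2 - (s ^ 2 - 4 * t)
        = (2 * 2 * t) * (t * u ^ 2 - s * u + 1) by ring]
      simp [h2, ht]
    simp only [this]
  simp only [hcount, Finset.mul_sum]
  rw [Finset.sum_comm]
  refine Finset.sum_congr rfl fun u _ => ?_
  split_ifs with hu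
  · subst hu; simp
  · have : ∀ s : F, t * u ^ 2 - s * u + 1 = 0 ↔ s = u⁻¹ + t * u := by
      intro s
      constructor
      · intro h
        field_simp
        linear_combination -h
      · rintro rfl
        field_simp; ring
    simp only [this, mul_ite, mul_one, mul_zero, Finset.sum_ite_eq', Finset.mem_univ, if_true]

lemma sum_mulChars (a : F) : ∑ χ : MulChar F ℂ, χ a =
    if a = 1 then (Fintype.card F : ℂ) - 1 else 0 := by
  split_ifs with ha
  · subst ha
    have h := MulChar.card_eq_card_units_of_hasEnoughRootsOfUnity F ℂ
    rw [Nat.card_eq_fintype_card, Nat.card_eq_fintype_card, Fintype.card_units] at h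
    simp only [map_one, Finset.sum_const, Finset.card_univ, nsmul_eq_mul, mul_one, h]
    rw [Nat.cast_sub Fintype.card_pos]; simp
  · obtain ⟨χ, hχ⟩ := MulChar.exists_apply_ne_one_of_hasEnoughRootsOfUnity F ℂ ha
    refine eq_zero_of_mul_eq_self_left hχ ?_
    simp only [Finset.mul_sum, ← MulChar.mul_apply]
    exact Fintype.sum_bijective _ (Group.mulLeft_bijective χ) _ _ fun χ' ↦ rfl

lemma exists_sqrt_char (hF : ringChar F ≠ 2) (E : MulChar F ℂ) (hE : E (-1) = 1) :
    ∃ D : MulChar F ℂ, D ^ 2 = E := by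
  obtain ⟨g, hg⟩ := IsCyclic.exists_generator (α := Fˣ)
  have hc : orderOf g = Fintype.card Fˣ := by
    rw [orderOf_eq_card_of_forall_mem_zpowers hg, Nat.card_eq_fintype_card]
  have hodd := FiniteField.odd_card_of_char_ne_two hF
  have hcu : Fintype.card Fˣ = Fintype.card F - 1 := Fintype.card_units F
  have hlt : 1 < Fintype.card F := Fintype.one_lt_card
  have hg2 : ((g ^ (Fintype.card Fˣ / 2) : Fˣ) : F) = -1 := by
    have h2 : (((g ^ (Fintype.card Fˣ / 2) : Fˣ) : F)) ^ 2 = 1 := by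
      rw [← Units.val_pow_eq_pow_val, ← pow_mul,
        show Fintype.card Fˣ / 2 * 2 = orderOf g by omega, pow_orderOf_eq_one, Units.val_one]
    rcases sq_eq_one_iff.mp h2 with h | h
    · exfalso
      have h3 : g ^ (Fintype.card Fˣ / 2) = 1 := by
        ext; simpa using h
      have := orderOf_dvd_of_pow_eq_one h3
      have := Nat.le_of_dvd (by omega) this
      omega
    · exact h
  obtain ⟨z, hz⟩ := IsAlgClosed.exists_pow_nat_eq (E g) (n := 2) (by norm_num)
  have hEg : E g ≠ 0 := (IsUnit.map E g.isUnit).ne_zero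
  have hz0 : z ≠ 0 := by rintro rfl; simp at hz; exact hEg hz.symm
  have hmem : Units.mk0 z hz0 ∈ rootsOfUnity (Fintype.card Fˣ) ℂ := by
    rw [mem_rootsOfUnity]
    ext
    rw [Units.val_pow_eq_pow_val, Units.val_mk0, Units.val_one,
      show Fintype.card Fˣ = 2 * (Fintype.card Fˣ / 2) by omega, pow_mul, hz, ← map_pow,
      ← Units.val_pow_eq_pow_val, hg2, hE]
  refine ⟨MulChar.ofRootOfUnity hmem hg, ?_⟩
  rw [MulChar.eq_iff hg, MulChar.pow_apply_coe, MulChar.ofRootOfUnity_spec]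
  simpa using hz

@[simp] lemma mc_zero (χ : MulChar F ℂ) : χ (0 : F) = 0 := MulChar.map_zero χ

lemma greeneBinom_eq (φ : MulChar F ℂ) (hφ : orderOf φ = 2) {i : F} (hi : i ^ 2 = -1)
    (ψ : MulChar F ℂ) :
    greeneBinom (φ * ψ) ψ = 1 / (Fintype.card F : ℂ) * ∑ u, φ u * φ (1 - u) * ψ u := by
  have hi0 : i ≠ 0 := by rintro rfl; simp at hi
  let σ : F → F := fun u => if u = 1 then 1 else u / (u - 1)
  have hσ : Function.Involutive σ := by
    intro u
    by_cases hu : u = 1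
    · simp [σ, hu]
    · have h1 : u - 1 ≠ 0 := sub_ne_zero.mpr hu
      have h2 : u / (u - 1) ≠ 1 := by
        intro h
        rw [div_eq_one_iff_eq h1] at h
        exact one_ne_zero (α := F) (by linear_combination h)
      simp only [σ, hu, h2, if_false]
      field_simp
      ring
  unfold greeneBinom
  rw [← Equiv.sum_comp hσ.toPerm, div_mul_eq_mul_div, div_mul_eq_mul_div, one_mul, Finset.mul_sum]
  congr 1
  refine Finset.sum_congr rfl fun u _ => ?_
  change ψ (-1) * ((φ * ψ) (σ u) * ψ⁻¹ (1 - σ u)) = _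
  by_cases hu : u = 1
  · simp [σ, hu]
  · have h1 : u - 1 ≠ 0 := sub_ne_zero.mpr hu
    simp only [σ, hu, if_false]
    have e1 : φ (u / (u - 1)) = φ u * φ (1 - u) := by
      rw [← map_mul]
      refine quad_congr hφ (i / (u - 1)) (div_ne_zero hi0 h1) ?_
      rw [div_pow, hi]; field_simp; ring
    have e2 : 1 - u / (u - 1) = (-(u - 1))⁻¹ := by
      field_simp; ring
    rw [MulChar.mul_apply, e1, e2, MulChar.inv_apply', inv_inv]
    have e3 : ψ (-1) * (ψ (u / (u - 1)) * ψ (-(u - 1))) = ψ u := by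
      rw [← map_mul, ← map_mul]; congr 1; field_simp
    linear_combination (φ u * φ (1 - u)) * e3

lemma greeneF32_sum (φ : MulChar F ℂ) (hφ : orderOf φ = 2) {i : F} (hi : i ^ 2 = -1)
    (C : MulChar F ℂ) :
    greeneF32 φ (C ^ 2 * φ) (C * φ) (C ^ 2) C (-1 : F) =
      1 / (Fintype.card F : ℂ) ^ 2 * (C (-1) * ∑ t, C t * φ t *
        ∑ u : F, if u = 0 then 0 else φ ((1 - u) * (1 - t * u) * (1 + t * u ^ 2))) := by
  have hi0 : i ≠ 0 := by rintro rfl; simp at hi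
  have hq0 : (Fintype.card F : ℂ) ≠ 0 := by exact_mod_cast Fintype.card_ne_zero
  have hq1 : (Fintype.card F : ℂ) - 1 ≠ 0 := by
    have : (1 : ℕ) < Fintype.card F := Fintype.one_lt_card
    rw [sub_ne_zero]; exact_mod_cast this.ne'
  unfold greeneF32
  set K : F → ℂ := fun u => φ u * φ (1 - u) with hK
  have hb := fun ψ => greeneBinom_eq φ hφ hi ψ
  have step1 : ∀ χ : MulChar F ℂ, greeneBinom (φ * χ) χ *
      greeneBinom (C ^ 2 * φ * χ) (C ^ 2 * χ) * greeneBinom (C * φ * χ) (C * χ) * χ (-1) =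
      1 / (Fintype.card F : ℂ) ^ 3 * ∑ u, ∑ v, ∑ w, K u * K v * K w * (C v ^ 2 * C w) *
        χ (-(u * v * w)) := by
    intro χ
    rw [show C ^ 2 * φ * χ = φ * (C ^ 2 * χ) by rw [mul_right_comm, mul_comm],
      show C * φ * χ = φ * (C * χ) by rw [mul_right_comm, mul_comm], hb, hb, hb]
    have : ∑ u, ∑ v, ∑ w, K u * K v * K w * (C v ^ 2 * C w) * χ (-(u * v * w)) =
      (∑ u, K u * χ u) * (∑ v, K v * (C ^ 2 * χ) v) * (∑ w, K w * (C * χ) w) * χ (-1) := by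
      rw [Finset.sum_mul_sum, Finset.sum_mul, Finset.sum_mul]
      refine Finset.sum_congr rfl fun u _ => ?_
      rw [Finset.sum_mul, Finset.sum_mul]
      refine Finset.sum_congr rfl fun v _ => ?_
      rw [Finset.mul_sum, Finset.sum_mul]
      refine Finset.sum_congr rfl fun w _ => ?_
      rw [neg_eq_neg_one_mul, map_mul, map_mul, map_mul, MulChar.mul_apply, MulChar.mul_apply,
        MulChar.pow_apply' C (by norm_num)]
      ring
    rw [this]
    simp only [hK]
    ring
  have step2 : ∀ u v : F, ∑ χ : MulChar F ℂ, ∑ w, K u * K v * K w * (C v ^ 2 * C w) *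
      χ (-(u * v * w)) = ((Fintype.card F : ℂ) - 1) *
        (K u * K v * K (-(u * v)⁻¹) * (C v ^ 2 * C (-(u * v)⁻¹))) := by
    intro u v
    by_cases hu : u = 0
    · simp [hK, hu]
    by_cases hv : v = 0
    · simp [hK, hv]
    rw [Finset.sum_comm]
    simp only [← Finset.mul_sum, sum_mulChars]
    have : ∀ w : F, -(u * v * w) = 1 ↔ w = -(u * v)⁻¹ := by
      intro w
      constructor
      · intro h; field_simp; linear_combination -h
      · rintro rfl; field_simp
    simp only [this, mul_ite, mul_zero, Finset.sum_ite_eq', Finset.mem_univ, if_true]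
    ring
  have step3 : ∀ u : F, ∑ v, K u * K v * K (-(u * v)⁻¹) * (C v ^ 2 * C (-(u * v)⁻¹)) =
      ∑ t, C (-1) * (C t * φ t *
        if u = 0 then 0 else φ ((1 - u) * (1 - t * u) * (1 + t * u ^ 2))) := by
    intro u
    by_cases hu : u = 0
    · simp [hK, hu]
    rw [sum_scale _ hu]
    refine Finset.sum_congr rfl fun t _ => ?_
    by_cases ht : t = 0
    · subst ht; simp [hK]
    rw [if_neg hu]
    have e1 : C (u * t) ^ 2 * C (-(u * (u * t))⁻¹) = C (-1) * C t := by
      rw [← map_pow, ← map_mul, ← map_mul]; congr 1; field_simp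
    have e2 : K u * K (u * t) * K (-(u * (u * t))⁻¹) = φ t *
        φ ((1 - u) * (1 - t * u) * (1 + t * u ^ 2)) := by
      simp only [hK, ← map_mul]
      refine quad_congr hφ (i / (u * t)) (div_ne_zero hi0 (mul_ne_zero hu ht)) ?_
      rw [div_pow, hi]; field_simp; ring
    rw [e1, e2]; ring
  simp only [step1, ← Finset.mul_sum]
  rw [Finset.sum_comm]
  have : ∀ u : F, ∑ χ : MulChar F ℂ, ∑ v, ∑ w, K u * K v * K w * (C v ^ 2 * C w) *
      χ (-(u * v * w)) = ((Fintype.card F : ℂ) - 1) * ∑ t, C (-1) * (C t * φ t *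
        if u = 0 then 0 else φ ((1 - u) * (1 - t * u) * (1 + t * u ^ 2))) := by
    intro u
    rw [Finset.sum_comm]
    simp only [step2, ← Finset.mul_sum, ← step3]
  simp only [this, ← Finset.mul_sum]
  rw [Finset.sum_comm' (t' := univ) (s' := fun _ => univ) (by simp)]
  simp only [← Finset.mul_sum]
  field_simp

/-- The first part of the inner sum. -/
lemma sum_A (hF : ringChar F ≠ 2) (φ : MulChar F ℂ) (hφ : orderOf φ = 2)
    (hm : φ (-1) = 1) (c : F) :
    ∑ s, φ (s * (s - c)) = if c = 0 then (Fintype.card F : ℂ) - 1 else -1 := by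
  have hne : φ ≠ 1 := by intro h; rw [h, orderOf_one] at hφ; omega
  have h0 := MulChar.sum_eq_zero_of_ne_one hne
  split_ifs with hc
  · subst hc
    have : ∀ s : F, φ (s * (s - 0)) = 1 - if s = 0 then 1 else 0 := by
      intro s
      split_ifs with hs
      · simp [hs]
      · rw [quad_congr hφ s hs (y := 1) (by ring)]; simp
    simp only [this]
    simp
  · have : ∀ s : F, φ (s * (s - c)) = φ (1 - c * s⁻¹) - if s = 0 then 1 else 0 := by
      intro s
      split_ifs with hs
      · simp [hs]
      · rw [sub_zero]; refine quad_congr hφ s hs ?_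
        field_simp
    simp only [this, Finset.sum_sub_distrib, Finset.sum_ite_eq', Finset.mem_univ, if_true]
    rw [← sum_inv' (fun s => φ (1 - c * s)), ← sum_scale (fun s => φ (1 - s)) hc, sum_negg,
      sum_shift _ (-1)]
    simp [h0]

lemma sum_B (hF : ringChar F ≠ 2) (φ : MulChar F ℂ) (hφ : orderOf φ = 2)
    (hm : φ (-1) = 1) (h2 : φ 2 = 1) {t : F} (ht : t ≠ 0) :
    φ t * ∑ s, φ (s * (s - (1 + t)) * (s ^ 2 - 4 * t)) =
      ∑ m, φ ((m + 2) * (m ^ 2 - (1 + t) ^ 2 / t)) - φ t := by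
  have hne : φ ≠ 1 := by intro h; rw [h, orderOf_one] at hφ; omega
  have h0 := MulChar.sum_eq_zero_of_ne_one hne
  have h20 : (2 : F) ≠ 0 := Ring.two_ne_zero hF
  by_cases hc : 1 + t = 0
  · obtain rfl : t = -1 := by linear_combination hc
    have e1 : ∀ s : F, φ (s * (s - (1 + -1)) * (s ^ 2 - 4 * -1)) =
        φ (s ^ 2 + 4) - if s = 0 then 1 else 0 := by
      intro s
      split_ifs with hs
      · simp only [hs]
        rw [quad_congr hφ (x := 0 ^ 2 + 4) 2 h20 (y := 1) (by ring)]; simp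
      · rw [sub_zero]; refine quad_congr hφ s hs ?_
        ring
    have e2 : ∀ m : F, φ ((m + 2) * (m ^ 2 - (1 + -1) ^ 2 / -1)) =
        φ (m + 2) - if m = 0 then 1 else 0 := by
      intro s
      split_ifs with hs
      · simp [hs, h2]
      · rw [sub_zero]; refine quad_congr hφ s hs ?_
        ring
    have e3 : ∑ s, φ (s ^ 2 + 4) = -1 := by
      rw [sum_sq hF φ hφ (fun s => φ (s + 4))]
      simp only [add_mul, one_mul, Finset.sum_add_distrib]
      rw [← sum_shift (fun s => φ s), h0, zero_add]
      have := sum_A hF φ hφ hm (-4)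
      rw [if_neg (by rw [neg_eq_zero, show (4 : F) = 2 * 2 by norm_num]; simp [h20])] at this
      simpa using this
    simp only [e1, e2, Finset.sum_sub_distrib, Finset.sum_ite_eq', Finset.mem_univ, if_true,
      ← sum_shift (fun s => φ s), h0, e3, hm]
    norm_num
  · have e1 : ∀ s : F, φ (s * (s - (1 + t)) * (s ^ 2 - 4 * t)) =
        φ ((1 - (1 + t) * s⁻¹) * (1 - 4 * t * s⁻¹ ^ 2)) - if s = 0 then 1 else 0 := by
      intro s
      split_ifs with hs
      · simp [hs]
      · rw [sub_zero]; refine quad_congr hφ (s ^ 2) (pow_ne_zero 2 hs) ?_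
        field_simp
    simp only [e1, Finset.sum_sub_distrib, Finset.sum_ite_eq', Finset.mem_univ, if_true]
    rw [← sum_inv' (fun s => φ ((1 - (1 + t) * s) * (1 - 4 * t * s ^ 2))),
      sum_scale _ (a := -(2 * (1 + t))⁻¹) (neg_ne_zero.mpr (inv_ne_zero (mul_ne_zero h20 hc))),
      mul_sub, mul_one, Finset.mul_sum]
    congr 1
    refine Finset.sum_congr rfl fun m _ => ?_
    have e4 : φ ((m + 2) * (m ^ 2 - (1 + t) ^ 2 / t)) =
        φ (-1) * φ 2 * φ ((m + 2) * (m ^ 2 - (1 + t) ^ 2 / t)) := by rw [hm, h2]; ring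
    rw [e4, ← map_mul, ← map_mul, ← map_mul]
    refine quad_congr hφ (t / (2 * (1 + t))) (div_ne_zero ht (mul_ne_zero h20 hc)) ?_
    field_simp
    ring

lemma sum_M (hF : ringChar F ≠ 2) (φ χ₄ : MulChar F ℂ) (hφ : orderOf φ = 2)
    (hχ : χ₄ ^ 2 = φ) (hm : φ (-1) = 1) {t : F} (ht : t ≠ 0) :
    ∑ m, φ ((m + 2) * (m ^ 2 - (1 + t) ^ 2 / t)) =
      ∑ z, χ₄ z * φ (1 + z ^ 2 - z * (t + t⁻¹)) := by
  have h20 : (2 : F) ≠ 0 := Ring.two_ne_zero hF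
  have hφ2 : φ ^ 2 = 1 := by rw [← hφ, pow_orderOf_eq_one]
  set k := t + t⁻¹ with hk
  have hk2 : (1 + t) ^ 2 / t = k + 2 := by rw [hk]; field_simp; ring
  rw [hk2]
  set P := ∑ z, χ₄ z * φ (1 + z ^ 2 - z * k) with hP
  set M := ∑ m, φ ((m + 2) * (m ^ 2 - (k + 2))) with hM
  -- the inverse character gives the same sum
  have hPinv : ∑ z, χ₄⁻¹ z * φ (1 + z ^ 2 - z * k) = P := by
    rw [sum_inv', hP]
    refine Finset.sum_congr rfl fun z _ => ?_
    by_cases hz : z = 0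
    · simp [hz]
    · rw [MulChar.inv_apply', inv_inv]
      congr 1
      refine quad_congr hφ z⁻¹ (inv_ne_zero hz) ?_
      field_simp
      ring
  have hφχ : χ₄⁻¹ = φ * χ₄ := by
    rw [inv_eq_iff_mul_eq_one, ← hχ, ← pow_succ, ← pow_succ']
    rw [← hχ, ← pow_mul] at hφ2; exact hφ2
  have hsum : ∑ w, φ w * φ (1 + w ^ 4 - w ^ 2 * k) = 2 * P := by
    have h := sum_sq hF φ hφ (fun z => χ₄ z * φ (1 + z ^ 2 - z * k))
    have e : ∀ w : F, φ w * φ (1 + w ^ 4 - w ^ 2 * k) =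
        χ₄ (w ^ 2) * φ (1 + (w ^ 2) ^ 2 - w ^ 2 * k) := by
      intro w
      rw [map_pow, ← MulChar.pow_apply' χ₄ (by norm_num), hχ]
      congr 2; ring
    simp only [e]
    rw [h]
    simp only [add_mul, one_mul, Finset.sum_add_distrib]
    rw [two_mul, ← hP]
    congr 1
    rw [← hPinv, hφχ]
    refine Finset.sum_congr rfl fun z _ => ?_
    rw [MulChar.mul_apply]; ring
  have hsum2 : ∑ w, φ w * φ (1 + w ^ 4 - w ^ 2 * k) = 2 * M := by
    have h := sum_joukowski hF φ hφ
      (fun m => (φ (m + 2) + if m = -2 then 1 else 0) * φ (m ^ 2 - (k + 2))) (one_ne_zero (α := F))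
    have e : ∀ w : F, φ w * φ (1 + w ^ 4 - w ^ 2 * k) =
        if w = 0 then 0 else (φ (w⁻¹ + 1 * w + 2) + if w⁻¹ + 1 * w = -2 then 1 else 0) *
          φ ((w⁻¹ + 1 * w) ^ 2 - (k + 2)) := by
      intro w
      split_ifs with hw h2
      · simp [hw]
      · have hw1 : (w + 1) ^ 2 = 0 := by
          field_simp at h2
          linear_combination h2
        obtain rfl : w = -1 := by
          have := pow_eq_zero_iff (two_ne_zero) |>.mp hw1
          linear_combination this
        rw [h2, hm]
        simp only [neg_add_cancel, mc_zero, zero_add]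
        congr 2; ring
      · rw [add_zero]
        have hw1 : w + 1 ≠ 0 := by
          intro h
          apply h2
          obtain rfl : w = -1 := by linear_combination h
          norm_num
        congr 1
        · symm
          refine quad_congr hφ ((w + 1) / w) (div_ne_zero hw1 hw) ?_
          field_simp; ring
        · refine quad_congr hφ w hw ?_
          field_simp; ring
    simp only [e]
    rw [h]
    have e2 : ∀ m : F, (φ (m + 2) + if m = -2 then 1 else 0) * φ (m ^ 2 - (k + 2)) *
        (1 + φ (m ^ 2 - 4 * 1)) = φ ((m + 2) * (m ^ 2 - (k + 2))) +
          φ ((-m + 2) * ((-m) ^ 2 - (k + 2))) := by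
      intro m
      have e3 : φ (-m + 2) = φ (m - 2) := by
        rw [show -m + 2 = -1 * (m - 2) by ring, map_mul, hm, one_mul]
      rw [map_mul, map_mul, e3, neg_sq]
      split_ifs with hmm
      · subst hmm
        have : φ (-2 - 2) = 1 := by
          rw [show (-2 - 2 : F) = -1 * (2 ^ 2 * 1) by ring, map_mul, hm, one_mul,
            quad_congr hφ 2 h20 rfl, map_one]
        rw [this, show ((-2) ^ 2 - 4 * 1 : F) = 0 by ring]
        simp
      · have hm2 : m + 2 ≠ 0 := fun h => hmm (by linear_combination h)
        have : φ (m + 2) * φ (m ^ 2 - 4 * 1) = φ (m - 2) := by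
          rw [← map_mul]; refine quad_congr hφ (m + 2) hm2 (by ring)
        rw [add_zero]
        linear_combination φ (m ^ 2 - (k + 2)) * this
    simp only [e2, Finset.sum_add_distrib]
    rw [← sum_negg (fun m => φ ((m + 2) * (m ^ 2 - (k + 2)))), ← hM, two_mul]
  have := hsum.symm.trans hsum2
  exact (mul_left_cancel₀ two_ne_zero this).symm

lemma jacobi_twist (φ : MulChar F ℂ) (hφ : orderOf φ = 2) (hm : φ (-1) = 1) (A : MulChar F ℂ) :
    jacobiSum A⁻¹ φ = jacobiSum (A * φ) φ := by
  unfold jacobiSum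
  rw [sum_inv']
  refine Finset.sum_congr rfl fun x _ => ?_
  by_cases hx : x = 0
  · simp [hx]
  rw [MulChar.inv_apply', inv_inv, MulChar.mul_apply, mul_assoc]
  congr 1
  have e : φ (x * (1 - x)) = φ (-1) * φ (x * (1 - x)) := by rw [hm, one_mul]
  rw [← map_mul, e, ← map_mul]
  refine quad_congr hφ x⁻¹ (inv_ne_zero hx) ?_
  field_simp
  ring

lemma jacobi_conj (φ : MulChar F ℂ) (hφ : orderOf φ = 2) (hm : φ (-1) = 1) (A : MulChar F ℂ) :
    (starRingEnd ℂ) (jacobiSum A φ) = jacobiSum (A * φ) φ := by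
  rw [← jacobi_twist φ hφ hm]
  unfold jacobiSum
  rw [map_sum]
  refine Finset.sum_congr rfl fun x _ => ?_
  have h2 : φ⁻¹ = φ := by
    rw [inv_eq_iff_mul_eq_one, ← sq, ← hφ, pow_orderOf_eq_one]
  rw [map_mul]
  have h3 := MulChar.star_apply' A x
  have h4 := MulChar.star_apply' φ (1 - x)
  rw [h2] at h4
  rw [← h3, ← h4]
  rw [h4]
  congr 1

lemma sum_CP (hF : ringChar F ≠ 2) (φ χ₄ : MulChar F ℂ) (hφ : orderOf φ = 2)
    (hm : φ (-1) = 1) (C D : MulChar F ℂ) (hD : D ^ 2 = C * χ₄) :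
    ∑ t, C t * ∑ z, χ₄ z * φ (1 + z ^ 2 - z * (t + t⁻¹)) =
      2 * ((jacobiSum D φ * jacobiSum (D⁻¹ * χ₄) φ).re : ℂ) := by
  have hre : 2 * ((jacobiSum D φ * jacobiSum (D⁻¹ * χ₄) φ).re : ℂ) =
      jacobiSum D φ * jacobiSum (D⁻¹ * χ₄) φ +
      jacobiSum (D * φ) φ * jacobiSum (D⁻¹ * χ₄ * φ) φ := by
    rw [← jacobi_conj φ hφ hm, ← jacobi_conj φ hφ hm, ← map_mul, Complex.add_conj]
    push_cast; rfl
  rw [hre]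
  unfold jacobiSum
  rw [Finset.sum_mul_sum, Finset.sum_mul_sum, ← Finset.sum_add_distrib]
  simp only [← Finset.sum_add_distrib]
  rw [Finset.sum_comm]
  have step : ∀ b : F, ∑ a, (D a * φ (1 - a) * ((D⁻¹ * χ₄) b * φ (1 - b)) +
      (D * φ) a * φ (1 - a) * ((D⁻¹ * χ₄ * φ) b * φ (1 - b))) =
      ∑ y, C y * (χ₄ (y * b) * φ (1 - b * y ^ 2) * φ (1 - b)) := by
    intro b
    by_cases hb : b = 0
    · simp [hb]
    have h := sum_sq hF φ hφ (fun r => φ (1 - b * r) * φ (1 - b) * χ₄ b * D r)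
    have e : ∀ y : F, C y * (χ₄ (y * b) * φ (1 - b * y ^ 2) * φ (1 - b)) =
        φ (1 - b * y ^ 2) * φ (1 - b) * χ₄ b * D (y ^ 2) := by
      intro y
      rw [map_pow, ← MulChar.pow_apply' D (by norm_num), hD, map_mul, MulChar.mul_apply]; ring
    simp only [e]
    rw [h, sum_scale _ hb]
    refine Finset.sum_congr rfl fun r _ => ?_
    simp only [MulChar.mul_apply]
    have e1 : D (b * r) * D⁻¹ b = D r := by
      rw [MulChar.inv_apply', ← map_mul]; congr 1; field_simp
    have e2 : φ (b * r) * φ b = φ r := by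
      rw [← map_mul]; exact quad_congr hφ b hb (by ring)
    linear_combination (φ (1 - b * r) * χ₄ b * φ (1 - b) * (1 + φ (b * r) * φ b)) * e1 +
      (φ (1 - b * r) * χ₄ b * φ (1 - b) * D r) * e2
  simp only [step]
  rw [Finset.sum_comm]
  refine Finset.sum_congr rfl fun y _ => ?_
  by_cases hy : y = 0
  · simp [hy]
  rw [← Finset.mul_sum, sum_scale (fun b => χ₄ (y * b) * φ (1 - b * y ^ 2) * φ (1 - b))
    (inv_ne_zero hy)]
  congr 1
  refine Finset.sum_congr rfl fun z _ => ?_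
  rw [mul_inv_cancel_left₀ hy, mul_assoc, ← map_mul]
  congr 2
  field_simp
  ring

/-- Evans–Greene value at `-1` (Theorem 1.8 of Tripathi–Barman): for `q ≡ 1 (mod 8)` and
`C` of order not `1, 2, 4`, `₃F₂(φ, C²φ, Cφ; C², C | -1)` equals `1/q` if `Cχ₄` is not a
square, and `1/q + (2/q²)·Re(J(D,φ)J(D̄χ₄,φ))` if `Cχ₄ = D²`. -/
theorem greeneF32_value_neg_one (hq8 : Fintype.card F % 8 = 1)
    (φ : MulChar F ℂ) (hφ : orderOf φ = 2) (χ₄ : MulChar F ℂ) (hχ₄ : orderOf χ₄ = 4)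
    (C : MulChar F ℂ) (h1 : orderOf C ≠ 1) (h2 : orderOf C ≠ 2) (h4 : orderOf C ≠ 4) :
    ((¬ ∃ D : MulChar F ℂ, D ^ 2 = C * χ₄) →
      greeneF32 φ (C ^ 2 * φ) (C * φ) (C ^ 2) C (-1 : F) = 1 / (Fintype.card F : ℂ)) ∧
    (∀ D : MulChar F ℂ, D ^ 2 = C * χ₄ →
      greeneF32 φ (C ^ 2 * φ) (C * φ) (C ^ 2) C (-1 : F) =
        1 / (Fintype.card F : ℂ) +
          2 / (Fintype.card F : ℂ) ^ 2 *
            ((jacobiSum D φ * jacobiSum (D⁻¹ * χ₄) φ).re : ℂ)) := by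
  have hF : ringChar F ≠ 2 := by
    intro h
    have := FiniteField.even_card_of_char_two h
    omega
  have h20 : (2 : F) ≠ 0 := Ring.two_ne_zero hF
  have hq0 : (Fintype.card F : ℂ) ≠ 0 := by exact_mod_cast Fintype.card_ne_zero
  obtain ⟨j, hj0, hj⟩ := neg_one_pow4 hq8
  have hi : (j ^ 2) ^ 2 = -1 := by rw [← pow_mul]; exact hj
  have hm : φ (-1) = 1 := by
    rw [quad_congr hφ (j ^ 2) (pow_ne_zero 2 hj0) (y := 1) (by rw [hi, mul_one]), map_one]
  have hm4 : χ₄ (-1) = 1 := by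
    rw [← hj, map_pow, ← MulChar.pow_apply' χ₄ (by norm_num), ← hχ₄, pow_orderOf_eq_one,
      MulChar.one_apply (isUnit_iff_ne_zero.mpr hj0)]
  have h2 : φ 2 = 1 := by
    obtain ⟨r, hr⟩ := (FiniteField.isSquare_two_iff (F := F)).mpr ⟨by omega, by omega⟩
    have hr0 : r ≠ 0 := by rintro rfl; simp at hr; exact h20 hr
    rw [quad_congr hφ r hr0 (y := 1) (by rw [hr]; ring), map_one]
  have hχ : χ₄ ^ 2 = φ := by
    have : orderOf (χ₄ ^ 2) = 2 := by
      rw [orderOf_pow, hχ₄]; rfl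
    ext a
    rw [quad_unique hF _ this, quad_unique hF _ hφ]
  have hCφ : C * φ ≠ 1 := by
    intro h
    have h3 : φ⁻¹ = φ := by
      rw [inv_eq_iff_mul_eq_one, ← sq, ← hφ, pow_orderOf_eq_one]
    have : C = φ := by rw [← h3]; exact eq_inv_of_mul_eq_one_left h
    exact ‹orderOf C ≠ 2› (by rw [this, hφ])
  have hsum0 : ∑ t, C t * φ t = 0 := by
    have := MulChar.sum_eq_zero_of_ne_one hCφ
    simpa only [MulChar.mul_apply] using this
  have hCm : C (-1) * C (-1) = 1 := by rw [← map_mul]; simp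
  set S := ∑ t, C t * ∑ z, χ₄ z * φ (1 + z ^ 2 - z * (t + t⁻¹)) with hS
  have main : greeneF32 φ (C ^ 2 * φ) (C * φ) (C ^ 2) C (-1 : F) =
      1 / (Fintype.card F : ℂ) + 1 / (Fintype.card F : ℂ) ^ 2 * (C (-1) * S) := by
    rw [greeneF32_sum φ hφ hi C]
    have inner : ∀ t : F, C t * φ t *
        (∑ u : F, if u = 0 then 0 else φ ((1 - u) * (1 - t * u) * (1 + t * u ^ 2))) =
        C t * (∑ z, χ₄ z * φ (1 + z ^ 2 - z * (t + t⁻¹))) - 2 * (C t * φ t) +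
          (if t = -1 then (Fintype.card F : ℂ) * C (-1) else 0) := by
      intro t
      by_cases ht : t = 0
      · simp [ht]
      have hA := sum_A hF φ hφ hm (1 + t)
      have hB := sum_B hF φ hφ hm h2 ht
      rw [sum_M hF φ χ₄ hφ hχ hm ht] at hB
      have hJ := sum_joukowski hF φ hφ (fun s => φ (s * (s - (1 + t)))) ht
      have e : ∀ u : F, (if u = 0 then (0 : ℂ) else φ ((1 - u) * (1 - t * u) * (1 + t * u ^ 2))) =
          if u = 0 then 0 else φ ((u⁻¹ + t * u) * (u⁻¹ + t * u - (1 + t))) := by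
        intro u
        split_ifs with hu
        · rfl
        · refine quad_congr hφ u hu ?_
          field_simp; ring
      simp only [e]
      have hJ2 : ∑ s, φ (s * (s - (1 + t))) * (1 + φ (s ^ 2 - 4 * t)) =
          ∑ s, φ (s * (s - (1 + t))) + ∑ s, φ (s * (s - (1 + t)) * (s ^ 2 - 4 * t)) := by
        rw [← Finset.sum_add_distrib]
        refine Finset.sum_congr rfl fun s _ => ?_
        rw [mul_add, mul_one, map_mul φ (s * (s - (1 + t)))]
      rw [hJ, hJ2, hA]
      have hc : (1 + t = 0) ↔ t = -1 := by
        constructor <;> intro h <;> linear_combination h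
      simp only [hc]
      split_ifs with h
      · subst h
        rw [hm] at hB ⊢
        linear_combination C (-1) * hB
      · linear_combination C t * hB
    simp only [inner, Finset.sum_add_distrib, Finset.sum_sub_distrib, ← Finset.mul_sum, hsum0,
      Finset.sum_ite_eq', Finset.mem_univ, if_true]
    rw [← hS]
    field_simp
    linear_combination (Fintype.card F : ℂ) * hCm
  have hodd : S = C (-1) * S := by
    conv_lhs => rw [hS, sum_negg]
    rw [hS, Finset.mul_sum]
    refine Finset.sum_congr rfl fun t _ => ?_
    rw [neg_eq_neg_one_mul t, map_mul, mul_assoc]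
    congr 2
    rw [sum_negg]
    refine Finset.sum_congr rfl fun z _ => ?_
    rw [neg_eq_neg_one_mul z, map_mul, hm4, one_mul]
    congr 2
    rw [mul_inv]
    ring
  constructor
  · intro hno
    have hC1 : C (-1) ≠ 1 := by
      intro h
      exact hno (exists_sqrt_char hF (C * χ₄) (by rw [MulChar.mul_apply, h, hm4, one_mul]))
    have hS0 : S = 0 := by
      have : (1 - C (-1)) * S = 0 := by linear_combination hodd
      rcases mul_eq_zero.mp this with h | h
      · exact absurd (by linear_combination -h) hC1
      · exact h
    rw [main, hS0]; simp
  · intro D hD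
    rw [main, ← hodd, hS, sum_CP hF φ χ₄ hφ hm C D hD]
    ring
end
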